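/- Let q be an odd prime power with q ≡ 1 (mod 3). A matroid M is representable over both 𝔽₃ and the field ℂ of complex numbers if and only if M is representable over both 𝔽₃ and 𝔽_q. -/

import Mathlib

universe u v w

open Matroid Set

namespace Paper

/-- The deletion of the set `D` from the matroid `M`. -/
def delete {α : Type u} (M : Matroid α) (D : Set α) : Matroid α := M ↾ (M.E \ D)

/-- The contraction of the set `C` in the matroid `M`. -/
def contract {α : Type u} (M : Matroid α) (C : Set α) : Matroid α := (delete M✶ C)✶

/-- `N` is a minor of `M`: it is obtained from `M` by a sequence of deletions and
contractions, equivalently by a single contraction followed by a single deletion. -/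
def IsMinor {α : Type u} (N M : Matroid α) : Prop :=
  ∃ C D : Set α, N = delete (contract M C) D

/-- `M` is a copy of the uniform matroid `U(r,n)`: its ground set has `n` elements and its
independent sets are exactly the subsets of the ground set with at most `r` elements. -/
def IsUniform {α : Type u} (M : Matroid α) (r n : ℕ) : Prop :=
  M.E.Finite ∧ M.E.ncard = n ∧ ∀ I ⊆ M.E, (M.Indep I ↔ I.ncard ≤ r)

/-- `M` has a minor isomorphic to the uniform matroid `U(r,n)`. -/
def HasUniformMinor {α : Type u} (M : Matroid α) (r n : ℕ) : Prop :=
  ∃ N : Matroid α, IsMinor N M ∧ IsUniform N r n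

/-- `M` is without large uniform minors: no minor of `M` is isomorphic to `U(2,5)` or
`U(3,5)`. -/
def NoLargeUniformMinors {α : Type u} (M : Matroid α) : Prop :=
  ¬ HasUniformMinor M 2 5 ∧ ¬ HasUniformMinor M 3 5

/-- `M` is isomorphic to the Fano matroid `F₇`, the matroid on the seven nonzero vectors of
`(𝔽₂)³` whose independent sets are the `𝔽₂`-linearly independent subsets. -/
def IsFano {α : Type u} (M : Matroid α) : Prop :=
  ∃ f : α → (Fin 3 → ZMod 2),
    Set.BijOn f M.E {x | x ≠ 0} ∧
    ∀ I ⊆ M.E, (M.Indep I ↔ Set.InjOn f I ∧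
      LinearIndependent (ZMod 2) (fun x : (f '' I) => (x : Fin 3 → ZMod 2)))

/-- `M` has a minor isomorphic to the Fano matroid `F₇`. -/
def HasFanoMinor {α : Type u} (M : Matroid α) : Prop :=
  ∃ N : Matroid α, IsMinor N M ∧ IsFano N

/-- `M` has a minor isomorphic to the dual Fano matroid `F₇*`. -/
def HasFanoDualMinor {α : Type u} (M : Matroid α) : Prop :=
  ∃ N : Matroid α, IsMinor N M ∧ IsFano N✶

/-- `M` is representable over the field `K`: there are a `K`-vector space `V` and a map
`φ` from the ground type to `V` such that a set `I ⊆ M.E` is independent in `M` if and only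
if the family `φ` restricted to `I` is linearly independent over `K` (equivalently, `φ` is
injective on `I` and the image `φ '' I` is linearly independent). -/
def Representable {α : Type u} (M : Matroid α) (K : Type v) [Field K] : Prop :=
  ∃ (V : Type (max u v)) (_ : AddCommGroup V) (_ : Module K V) (φ : α → V),
    ∀ I ⊆ M.E, (M.Indep I ↔ LinearIndependent K (fun x : I => φ x))

end Paper

namespace TernaryLift

section


section Pivot

variable {E K : Type*} [Field K]

/-- The Kronecker delta. -/
noncomputable def delta (K : Type*) [Field K] {E : Type*} (i j : E) : K :=
  open Classical in if i = j then 1 else 0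

theorem delta_self (i : E) : delta K i i = 1 := by simp [delta]

theorem delta_ne {i j : E} (h : i ≠ j) : delta K i j = 0 := by simp [delta, h]

theorem delta_comm (i j : E) : delta K i j = delta K j i := by
  by_cases h : i = j
  · subst h; rfl
  · rw [delta_ne h, delta_ne (Ne.symm h)]

/-- The principal pivot transform of a skew-symmetric matrix on the pair `x, y`. -/
noncomputable def piv (N : E → E → K) (x y : E) : E → E → K := fun i j =>
  N i j + ((N i x + delta K i x) * (N y j - delta K y j)
    - (N i y + delta K i y) * (N x j - delta K x j)) / N x y

/-- Skew-symmetric matrices with zero diagonal. -/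
def Skew (N : E → E → K) : Prop := (∀ i j, N j i = -N i j) ∧ ∀ i, N i i = 0

theorem Skew.piv {N : E → E → K} (hN : Skew N) (x y : E) : Skew (piv N x y) := by
  constructor
  · intro i j
    simp only [TernaryLift.piv]
    rw [hN.1 i j, hN.1 x j, hN.1 y j, hN.1 i x, hN.1 i y, delta_comm j x, delta_comm j y,
      delta_comm y i, delta_comm x i]
    ring
  · intro i
    simp only [TernaryLift.piv]
    rw [hN.1 i x, hN.1 i y, hN.2, delta_comm x i, delta_comm y i]
    ring

theorem piv_def (N : E → E → K) (x y i j : E) : piv N x y i j =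
    N i j + ((N i x + delta K i x) * (N y j - delta K y j)
      - (N i y + delta K i y) * (N x j - delta K x j)) / N x y := rfl

theorem piv_of_ne {N : E → E → K} {x y i j : E} (hix : i ≠ x) (hiy : i ≠ y) (hjx : j ≠ x)
    (hjy : j ≠ y) : piv N x y i j = N i j + (N i x * N y j - N i y * N x j) / N x y := by
  simp [piv, delta_ne hix, delta_ne hiy, delta_ne hjx.symm, delta_ne hjy.symm]

theorem piv_left {N : E → E → K} (hN : Skew N) {x y j : E} (hxy : N x y ≠ 0) (hjx : j ≠ x)
    (hjy : j ≠ y) : piv N x y x j = N y j / N x y := by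
  have : x ≠ y := by rintro rfl; exact hxy (hN.2 _)
  simp only [piv, delta_ne this, delta_self, delta_ne hjx.symm, delta_ne hjy.symm, hN.2]
  field_simp
  ring

theorem piv_right {N : E → E → K} (hN : Skew N) {x y j : E} (hxy : N x y ≠ 0) (hjx : j ≠ x)
    (hjy : j ≠ y) : piv N x y y j = -N x j / N x y := by
  have : x ≠ y := by rintro rfl; exact hxy (hN.2 _)
  simp only [piv, delta_ne this.symm, delta_self, delta_ne hjx.symm, delta_ne hjy.symm, hN.2,
    hN.1 x y]
  field_simp
  ring

theorem piv_self {N : E → E → K} (hN : Skew N) {x y : E} (hxy : N x y ≠ 0) :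
    piv N x y x y = -(N x y)⁻¹ := by
  have : x ≠ y := by rintro rfl; exact hxy (hN.2 _)
  simp only [piv, delta_ne this, delta_self, hN.2]
  field_simp
  ring

theorem piv_comm {N : E → E → K} (hN : Skew N) (x y : E) : piv N x y = piv N y x := by
  funext i j
  simp only [piv]
  rw [hN.1 x y, div_neg]
  ring

theorem piv_piv {N : E → E → K} (hN : Skew N) {x y : E} (hxy : N x y ≠ 0) :
    piv (piv N x y) x y = N := by
  have hne : x ≠ y := by rintro rfl; exact hxy (hN.2 _)
  funext i j
  have h := piv_self hN hxy
  have hd : (-(N x y)⁻¹) ≠ 0 := by simpa using hxy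
  rw [piv, h]
  simp only [piv, delta_ne hne, delta_ne hne.symm, delta_self, hN.2, hN.1 x y]
  field_simp
  ring

/-- Pivoting on `x u` and then on `u j` amounts to pivoting on `x j`. -/
theorem piv_piv_shift {N : E → E → K} (hN : Skew N) {x u j : E} (hxu : N x u ≠ 0)
    (hxj : N x j ≠ 0) (huj : u ≠ j) : piv (piv N x u) u j = piv N x j := by
  have h1 : x ≠ u := by rintro rfl; exact hxu (hN.2 _)
  have h2 : x ≠ j := by rintro rfl; exact hxj (hN.2 _)
  have h := piv_right hN hxu h2.symm huj.symm
  funext k l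
  rw [piv, h]
  simp only [piv, delta_ne h1, delta_ne h1.symm, delta_ne h2, delta_ne h2.symm, delta_ne huj,
    delta_ne huj.symm, delta_self, hN.2, hN.1 x u, hN.1 x j, hN.1 u j]
  field_simp
  ring

/-- Pivots on disjoint pairs commute. -/
theorem piv_piv_comm {N : E → E → K} (hN : Skew N) {x u i j : E} (hxu : N x u ≠ 0)
    (hij : N i j ≠ 0) (h : piv N x u i j ≠ 0) (hxi : x ≠ i) (hxj : x ≠ j) (hui : u ≠ i)
    (huj : u ≠ j) :
    piv (piv N x u) i j = piv (piv N i j) x u := by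
  have h1 : x ≠ u := by rintro rfl; exact hxu (hN.2 _)
  have h2 : i ≠ j := by rintro rfl; exact hij (hN.2 _)
  have ha := piv_of_ne (N := N) hxi.symm hui.symm hxj.symm huj.symm
  have hb := piv_of_ne (N := N) hxi hxj hui huj
  have e1 : N i j + (N i x * N u j - N i u * N x j) / N x u ≠ 0 := by rwa [← ha]
  set q := N i j * N x u + (N i x * N u j - N i u * N x j) with hq
  have e2 : N i j + (N i x * N u j - N i u * N x j) / N x u = q / N x u := by
    rw [hq]; field_simp
  have hq0 : q ≠ 0 := by
    intro h0; rw [e2, h0] at e1; simp at e1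
  have e3 : N x u + (N x i * N j u - N x j * N i u) / N i j = q / N i j := by
    rw [hq, hN.1 i x, hN.1 u j]; field_simp
  funext k l
  rw [piv_def (piv N x u) i j, piv_def (piv N i j) x u, ha, hb, e2, e3]
  simp only [piv, delta_ne huj, delta_ne huj.symm, delta_ne hxi, delta_ne hxi.symm, delta_ne hxj,
    delta_ne hxj.symm, delta_ne hui, delta_ne hui.symm, hN.1 x j, hN.1 u j, hN.1 x i, hN.1 u i]
  rw [hN.1 x i, hN.1 u i] at hq
  field_simp
  rw [hq]
  ring

end Pivot
end

section


/-- Maps between fields that are compatible with the anharmonic group action on cross-ratios. -/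
structure CrMap {L L' : Type*} [Field L] [Field L'] (f : L → L') : Prop where
  two_ne : (2 : L) ≠ 0
  two_ne' : (2 : L') ≠ 0
  eq_zero_iff : ∀ p, f p = 0 ↔ p = 0
  one_sub : ∀ p, f (1 - p) = 1 - f p
  inv : ∀ p, f p⁻¹ = (f p)⁻¹

theorem eq_neg_one_of_ne : ∀ {x : ZMod 3}, x ≠ 0 → x ≠ 1 → x = -1 := by decide

namespace CrMap

variable {L L' : Type*} [Field L] [Field L'] {f : L → L'}

theorem map_zero (hf : CrMap f) : f 0 = 0 := (hf.eq_zero_iff 0).2 rfl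

theorem map_one (hf : CrMap f) : f 1 = 1 := by
  have := hf.one_sub 0
  simpa [hf.map_zero] using this

theorem map_half (hf : CrMap f) : f 2⁻¹ = 2⁻¹ := by
  have h2 := hf.two_ne
  have h2' := hf.two_ne'
  have h := hf.one_sub 2⁻¹
  have e : (1 : L) - 2⁻¹ = 2⁻¹ := by field_simp; norm_num
  rw [e] at h
  exact eq_inv_of_mul_eq_one_left (by linear_combination h)

theorem map_two (hf : CrMap f) : f 2 = 2 := by
  have := hf.inv 2
  rw [hf.map_half] at this
  exact (inv_injective this).symm

theorem map_neg_one (hf : CrMap f) : f (-1) = -1 := by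
  have h := hf.one_sub 2
  rw [hf.map_two] at h
  norm_num at h
  exact h

/-- The ternary principle: `f` is multiplicative on cross-ratios modelled over `ZMod 3`. -/
theorem map_mul (hf : CrMap f) {p₃ q₃ : ZMod 3} {p q : L} (hp₃ : p₃ ≠ 0) (hq₃ : q₃ ≠ 0)
    (hp : p₃ = 1 ↔ p = 1) (hq : q₃ = 1 ↔ q = 1)
    (hpq : p₃ * q₃ = 1 ↔ p * q = 1) : f (p * q) = f p * f q := by
  by_cases h1 : p = 1
  · simp [h1, hf.map_one]
  by_cases h2 : q = 1
  · simp [h2, hf.map_one]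
  have h3 : p * q = 1 := by
    rw [← hpq]
    rw [← hp] at h1
    rw [← hq] at h2
    rw [eq_neg_one_of_ne hp₃ h1, eq_neg_one_of_ne hq₃ h2]
    decide
  have : q = p⁻¹ := (inv_eq_of_mul_eq_one_right h3).symm
  have hp0 : p ≠ 0 := left_ne_zero_of_mul_eq_one h3
  have : f p ≠ 0 := fun h => hp0 ((hf.eq_zero_iff p).1 h)
  subst q
  rw [h3, hf.inv, hf.map_one]
  field_simp

theorem inv_one_sub (hf : CrMap f) {p q : L} (h : (1 - p) * q = 1) :
    f q = (1 - f p)⁻¹ := by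
  rw [← hf.one_sub, ← hf.inv, inv_eq_of_mul_eq_one_right h]

theorem one_sub_map_ne (hf : CrMap f) {p q : L} (h : (1 - p) * q = 1) : 1 - f p ≠ 0 := by
  rw [← hf.one_sub, Ne, hf.eq_zero_iff]
  exact left_ne_zero_of_mul_eq_one h

theorem map_neg (hf : CrMap f) {p₃ : ZMod 3} {p : L} (hp₃ : p₃ ≠ 0)
    (hp : p₃ = 1 ↔ p = 1) (h : -p₃ = 1 ↔ -p = 1) : f (-p) = -f p := by
  by_cases h1 : p = 1
  · simp [h1, hf.map_one, hf.map_neg_one]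
  · have : -p = 1 := by
      rw [← h]; rw [← hp] at h1; rw [eq_neg_one_of_ne hp₃ h1]; decide
    have : p = -1 := by linear_combination -this
    subst this
    simp [hf.map_one, hf.map_neg_one]

theorem map_neg_mul (hf : CrMap f) {y₃ z₃ : ZMod 3} {η ζ : L} (hy₃ : y₃ ≠ 0) (hz₃ : z₃ ≠ 0)
    (hy : y₃ = 1 ↔ η = 1) (hz : z₃ = 1 ↔ ζ = 1) (h : -(y₃ * z₃) = 1 ↔ -(η * ζ) = 1)
    (hyz : (1 - y₃) * z₃ = 1 ↔ (1 - η) * ζ = 1) : f (-(η * ζ)) = -(f η * f ζ) := by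
  by_cases h1 : η = 1
  · subst h1
    rw [hy.2 rfl, one_mul, one_mul] at h
    rw [hf.map_one, one_mul, one_mul]
    exact hf.map_neg hz₃ hz h
  by_cases h2 : ζ = 1
  · subst h2
    rw [hz.2 rfl, mul_one, mul_one] at h
    rw [hf.map_one, mul_one, mul_one]
    exact hf.map_neg hy₃ hy h
  have h3 : (1 - η) * ζ = 1 := by
    
    rw [← hyz]; rw [← hy] at h1; rw [← hz] at h2
    rw [eq_neg_one_of_ne hy₃ h1, eq_neg_one_of_ne hz₃ h2]; decide
  have e : -(η * ζ) = 1 - ζ := by linear_combination h3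
  have h4 := hf.one_sub_map_ne h3
  rw [e, hf.one_sub, hf.inv_one_sub h3]
  field_simp
  ring

/-- The identity behind the six-cycle case of the gluing argument. -/
theorem map_neg_mul_mul (hf : CrMap f) {x₃ y₃ z₃ : ZMod 3} {ξ η ζ : L}
    (hx₃ : x₃ ≠ 0) (hy₃ : y₃ ≠ 0) (hz₃ : z₃ ≠ 0)
    (hx : x₃ = 1 ↔ ξ = 1) (hy : y₃ = 1 ↔ η = 1) (hz : z₃ = 1 ↔ ζ = 1)
    (h : -(x₃ * y₃ * z₃) = 1 ↔ -(ξ * η * ζ) = 1)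
    (hxy : (1 - x₃) * y₃ = 1 ↔ (1 - ξ) * η = 1)
    (hyz : (1 - y₃) * z₃ = 1 ↔ (1 - η) * ζ = 1)
    (hzx : (1 - z₃) * x₃ = 1 ↔ (1 - ζ) * ξ = 1) :
    f (-(ξ * η * ζ)) = -(f ξ * f η * f ζ) := by
  by_cases h1 : ξ = 1
  · subst h1
    rw [hx.2 rfl, one_mul, one_mul] at h
    rw [hf.map_one, one_mul, one_mul]
    exact hf.map_neg_mul hy₃ hz₃ hy hz h hyz
  by_cases h2 : η = 1
  · subst h2
    rw [hy.2 rfl, mul_one, mul_one, mul_comm, mul_comm ξ] at h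
    rw [hf.map_one, mul_one, mul_one, mul_comm, mul_comm (f ξ)]
    exact hf.map_neg_mul hz₃ hx₃ hz hx h hzx
  by_cases h3 : ζ = 1
  · subst h3
    rw [hz.2 rfl, mul_one, mul_one] at h
    rw [hf.map_one, mul_one, mul_one]
    exact hf.map_neg_mul hx₃ hy₃ hx hy h hxy
  rw [← hx] at h1; rw [← hy] at h2; rw [← hz] at h3
  obtain rfl := eq_neg_one_of_ne hx₃ h1
  obtain rfl := eq_neg_one_of_ne hy₃ h2
  obtain rfl := eq_neg_one_of_ne hz₃ h3
  have e1 : (1 - ξ) * η = 1 := by rw [← hxy]; decide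
  have e2 : (1 - η) * ζ = 1 := by rw [← hyz]; decide
  have e3 : -(ξ * η * ζ) = 1 := by rw [← h]; decide
  have h4 := hf.one_sub_map_ne e1
  have h5 := hf.one_sub_map_ne e2
  have g1 := hf.inv_one_sub e1
  have g2 := hf.inv_one_sub e2
  have g1' : (1 - f ξ) * f η = 1 := by rw [g1]; field_simp
  have g2' : (1 - f η) * f ζ = 1 := by rw [g2]; field_simp
  have : f ζ ≠ 0 := by rw [g2]; exact inv_ne_zero h5
  rw [e3, hf.map_one]
  linear_combination (-f ζ) * g1' - g2'

end CrMap
end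

section

namespace CrMap

variable {L L' : Type*} [Field L'] [Field L]

/-- The `j`-invariant of a cross-ratio. -/
noncomputable def jInv (p : L) : L := (p ^ 2 - p + 1) ^ 3 / (p ^ 2 * (1 - p) ^ 2)

theorem jInv_one_sub (p : L) : jInv (1 - p) = jInv p := by
  rw [jInv, jInv]; congr 1 <;> ring

theorem jInv_inv {p : L} (hp : p ≠ 0) (hp1 : p ≠ 1) : jInv p⁻¹ = jInv p := by
  have : 1 - p ≠ 0 := sub_ne_zero.2 hp1.symm
  have h2 : p - 1 ≠ 0 := sub_ne_zero.2 hp1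
  have e : 1 - p⁻¹ = (p - 1) / p := by field_simp
  rw [jInv, jInv, e]
  field_simp
  ring

theorem orbit_of_jInv_eq {p c : L} (hp : p ≠ 0) (hp1 : p ≠ 1) (hc : c ≠ 0) (hc1 : c ≠ 1)
    (h : jInv p = jInv c) :
    (p = c ∨ p * c = 1) ∨ (1 - p = c ∨ (1 - p) * c = 1) ∨ (p - 1 = p * c ∨ (p - 1) * c = p) := by
  have h1 : 1 - p ≠ 0 := sub_ne_zero.2 hp1.symm
  have h2 : 1 - c ≠ 0 := sub_ne_zero.2 hc1.symm
  rw [jInv, jInv, div_eq_div_iff (by positivity) (by positivity)] at h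
  have : (p - c) * (p * c - 1) * (1 - p - c) * ((1 - p) * c - 1) * (p - 1 - p * c) *
      ((p - 1) * c - p) = 0 := by
    linear_combination -h
  simp only [mul_eq_zero, sub_eq_zero] at this
  tauto

/-- `p` or its inverse is the chosen representative `c`. -/
def Near (c p : L) : Prop := p = c ∨ p * c = 1

theorem near_inv {c p : L} (hp : p ≠ 0) : Near c p⁻¹ ↔ Near c p := by
  unfold Near
  constructor
  · rintro (h | h)
    · right; rw [← h]; exact mul_inv_cancel₀ hp
    · left; field_simp at h; exact h.symm
  · rintro (h | h)
    · right; rw [← h]; exact inv_mul_cancel₀ hp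
    · left; exact (eq_inv_of_mul_eq_one_right h).symm ▸ rfl

theorem exists_of_root {ω' : L'} (h3 : (3 : L) ≠ 0) (hω' : ω' ^ 2 - ω' + 1 = 0) :
    ∃ g : L → L', ∀ p, p ^ 2 - p + 1 = 0 → g (1 - p) = 1 - g p ∧ g p ^ 2 - g p + 1 = 0 := by
  classical
  by_cases h : ∃ ω : L, ω ^ 2 - ω + 1 = 0
  · obtain ⟨ω, hω⟩ := h
    have hne : 1 - ω ≠ ω := by
      intro h
      apply h3
      linear_combination 4 * hω + (2 * ω - 1) * h
    refine ⟨fun p => if p = ω then ω' else 1 - ω', fun p hp => ?_⟩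
    have : (p - ω) * (p - (1 - ω)) = 0 := by linear_combination hp - hω
    rcases mul_eq_zero.1 this with h | h
    · dsimp only
      rw [sub_eq_zero.1 h, if_neg hne, if_pos rfl]
      exact ⟨rfl, hω'⟩
    · dsimp only
      rw [sub_eq_zero.1 h, if_neg hne, if_pos (by ring)]
      exact ⟨by ring, by linear_combination hω'⟩
  · exact ⟨fun _ => 0, fun p hp => (h ⟨p, hp⟩).elim⟩

/-- Cross-ratios for which the value of the map is unconstrained by equations. -/
def Generic (p : L) : Prop := p ≠ 0 ∧ p ≠ 1 ∧ p ^ 2 - p + 1 ≠ 0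

theorem Generic.one_sub {p : L} (h : Generic p) : Generic (1 - p) := by
  refine ⟨sub_ne_zero.2 h.2.1.symm, fun h' => h.1 (by linear_combination -h'), fun h' => h.2.2 ?_⟩
  linear_combination h'

theorem Generic.inv {p : L} (h : Generic p) : Generic p⁻¹ := by
  refine ⟨inv_ne_zero h.1, fun h' => h.2.1 (by simpa using h'), fun h' => h.2.2 ?_⟩
  have := h.1
  field_simp at h'
  linear_combination h'

theorem exists_representative (h2 : (2 : L) ≠ 0) (h3 : (3 : L) ≠ 0) :
    ∃ c : L → L, ∀ p, Generic p → Generic (c (jInv p)) ∧ jInv p = jInv (c (jInv p)) ∧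
      c (jInv p) ≠ 2 ∧ 2 * c (jInv p) ≠ 1 := by
  have key : ∀ j : L, ∃ c : L, (∃ p, Generic p ∧ jInv p = j) →
      Generic c ∧ j = jInv c ∧ c ≠ 2 ∧ 2 * c ≠ 1 := by
    intro j
    by_cases h : ∃ p, Generic p ∧ jInv p = j
    · obtain ⟨p, hp, rfl⟩ := h
      have hm : p = 2 ∨ 2 * p = 1 → Generic (-1 : L) ∧ jInv p = jInv (-1 : L) := by
        intro h
        refine ⟨⟨by simp, fun h => h2 (by linear_combination -h),
          fun h => h3 (by linear_combination h)⟩, ?_⟩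
        have h4 : (4 : L) ≠ 0 := by
          have : (4 : L) = 2 * 2 := by norm_num
          rw [this]; exact mul_ne_zero h2 h2
        rcases h with rfl | h
        · rw [← jInv_one_sub]; norm_num
        · have : p = 2⁻¹ := eq_inv_of_mul_eq_one_right h
          subst this
          rw [jInv_inv h2 (fun h => one_ne_zero (α := L) (by linear_combination h)),
            ← jInv_one_sub]
          norm_num
      by_cases h' : p = 2 ∨ 2 * p = 1
      · refine ⟨-1, fun _ => ⟨(hm h').1, (hm h').2, fun h => h3 (by linear_combination -h),
          fun h => h3 (by linear_combination -h)⟩⟩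
      · push Not at h'
        exact ⟨p, fun _ => ⟨hp, rfl, h'⟩⟩
    · exact ⟨0, fun h' => (h h').elim⟩
  choose c hc using key
  exact ⟨c, fun p hp => hc _ ⟨p, hp, rfl⟩⟩

theorem exists_crMap (h2 : (2 : L) ≠ 0) (h3 : (3 : L) ≠ 0) (h2' : (2 : L') ≠ 0) {ω' : L'}
    (hω' : ω' ^ 2 - ω' + 1 = 0) : ∃ f : L → L', CrMap f := by
  classical
  obtain ⟨g, hg⟩ := exists_of_root (L := L) h3 hω'
  obtain ⟨c, hc⟩ := exists_representative h2 h3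
  set f : L → L' := fun p => if p = 0 then 0 else if p = 1 then 1 else
    if p ^ 2 - p + 1 = 0 then g p else
    if Near (c (jInv p)) p then -1 else if Near (c (jInv p)) (1 - p) then 2 else 2⁻¹ with hf
  have f0 : f 0 = 0 := by simp [hf]
  have f1 : f 1 = 1 := by simp [hf]
  have fg : ∀ p, p ^ 2 - p + 1 = 0 → f p = g p := by
    intro p hp
    have h0 : p ≠ 0 := by rintro rfl; simp at hp
    have h1 : p ≠ 1 := by rintro rfl; simp at hp
    simp [hf, h0, h1, hp]
  have fG : ∀ p, Generic p → f p =
      if Near (c (jInv p)) p then -1 else if Near (c (jInv p)) (1 - p) then 2 else 2⁻¹ := by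
    intro p hp
    simp [hf, hp.1, hp.2.1, hp.2.2]
  have hcases : ∀ p : L, p = 0 ∨ p = 1 ∨ p ^ 2 - p + 1 = 0 ∨ Generic p := by
    intro p; unfold Generic; tauto
  have hroot : ∀ p : L, p ^ 2 - p + 1 = 0 → p⁻¹ = 1 - p := by
    intro p hp
    exact inv_eq_of_mul_eq_one_right (by linear_combination -hp)
  have hroot' : ∀ p : L', p ^ 2 - p + 1 = 0 → p⁻¹ = 1 - p := by
    intro p hp
    exact inv_eq_of_mul_eq_one_right (by linear_combination -hp)
  refine ⟨f, h2, h2', ?_, ?_, ?_⟩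
  · intro p
    refine ⟨fun h => ?_, fun h => h ▸ f0⟩
    rcases hcases p with rfl | rfl | hp | hp
    · rfl
    · rw [f1] at h; exact (one_ne_zero h).elim
    · have := (hg p hp).2
      rw [fg p hp] at h
      simp [h] at this
    · rw [fG p hp] at h
      split_ifs at h
      · exact (neg_ne_zero.2 one_ne_zero h).elim
      · exact (h2' h).elim
      · exact (inv_ne_zero h2' h).elim
  · intro p
    rcases hcases p with rfl | rfl | hp | hp
    · simp [f0, f1]
    · simp [f0, f1]
    · rw [fg p hp, fg (1 - p) (by linear_combination hp), (hg p hp).1]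
    · obtain ⟨hc1, hc2, hc3, hc4⟩ := hc p hp
      rw [fG p hp, fG _ hp.one_sub, jInv_one_sub, sub_sub_cancel]
      set d := c (jInv p)
      by_cases n1 : Near d p
      · have n2 : ¬ Near d (1 - p) := by
          rintro (h | h) <;> rcases n1 with h' | h'
          · exact hc4 (by linear_combination -h - h')
          · exact hc1.2.2 (by linear_combination -h' - d * h)
          · exact hc1.2.2 (by linear_combination -h + (-d) * h')
          · exact hc3 (by linear_combination h + h')
        simp only [n1, n2, if_true, if_false]
        norm_num
      · by_cases n2 : Near d (1 - p)
        · simp only [n1, n2, if_true, if_false]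
          norm_num
        · simp only [n1, n2, if_false]
          field_simp
          norm_num
  · intro p
    rcases hcases p with rfl | rfl | hp | hp
    · simp [f0]
    · simp [f1]
    · rw [hroot p hp, fg p hp, fg (1 - p) (by linear_combination hp), (hg p hp).1,
        hroot' _ (hg p hp).2]
    · obtain ⟨hc1, hc2, hc3, hc4⟩ := hc p hp
      rw [fG p hp, fG _ hp.inv, jInv_inv hp.1 hp.2.1]
      have horb := orbit_of_jInv_eq hp.1 hp.2.1 hc1.1 hc1.2.1 hc2
      set d := c (jInv p)
      have hp0 := hp.1
      rw [near_inv hp.1]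
      by_cases n1 : Near d p
      · simp only [n1, if_true]
        norm_num
      · have e1 : 1 - p⁻¹ = d ↔ p - 1 = p * d := by
          field_simp
        have e2 : (1 - p⁻¹) * d = 1 ↔ (p - 1) * d = p := by
          field_simp
        have n3 : Near d (1 - p⁻¹) ↔ ¬ Near d (1 - p) := by
          unfold Near
          rw [e1, e2]
          constructor
          · rintro (h | h) (h' | h')
            · refine hc3 (mul_left_cancel₀ hc1.1 ?_)
              linear_combination h + h' - d * h'
            · apply hc1.2.2
              linear_combination -h' - d * (h - h')
            · apply hc1.2.2
              linear_combination -h - (d - 1) * h'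
            · apply hc4
              linear_combination h' - d * (h + h')
          · intro h
            unfold Near at n1
            tauto
        by_cases n2 : Near d (1 - p) <;> simp [n1, n2, n3]

end CrMap
end

section


variable {E L L' : Type*} [Field L'] [Field L]

/-- A two-colouring of `E` with a ternary matrix and a matrix over `L`. -/
@[ext] structure Model (E L : Type*) where
  side : E → Bool
  A : E → E → ZMod 3
  B : E → E → L

/-- Exchange the sides of `x` and `y`. -/
noncomputable def flip (σ : E → Bool) (x y : E) : E → Bool := fun e =>
  open Classical in if e = x ∨ e = y then !σ e else σ e

/-- Pivot both matrices of a model. -/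
noncomputable def Model.piv (T : Model E L) (x y : E) : Model E L :=
  ⟨flip T.side x y, TernaryLift.piv T.A x y, TernaryLift.piv T.B x y⟩

@[simp] theorem Model.piv_A (T : Model E L) (x y : E) : (T.piv x y).A = TernaryLift.piv T.A x y := rfl

@[simp] theorem Model.piv_B (T : Model E L) (x y : E) : (T.piv x y).B = TernaryLift.piv T.B x y := rfl

@[simp] theorem Model.piv_side (T : Model E L) (x y : E) : (T.piv x y).side = flip T.side x y := rfl

theorem flip_of_ne {σ : E → Bool} {x y e : E} (hx : e ≠ x) (hy : e ≠ y) : flip σ x y e = σ e := by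
  simp [flip, hx, hy]

theorem flip_left (σ : E → Bool) (x y : E) : flip σ x y x = !σ x := by
  simp [flip]

theorem flip_right (σ : E → Bool) (x y : E) : flip σ x y y = !σ y := by
  simp [flip]

theorem flip_comm (σ : E → Bool) (x y : E) : flip σ x y = flip σ y x := by
  funext e
  by_cases h : e = x <;> by_cases h' : e = y <;> simp [h, h', flip]

/-- The two matrices are skew, bipartite on `F` and have the same support on `F`. -/
structure Compat (F : Set E) (T : Model E L) : Prop where
  skewA : Skew T.A
  skewB : Skew T.B
  bip : ∀ i ∈ F, ∀ j ∈ F, T.B i j ≠ 0 → T.side i ≠ T.side j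
  supp : ∀ i ∈ F, ∀ j ∈ F, (T.A i j = 0 ↔ T.B i j = 0)

/-- The two matrices stay compatible on `F` under all sequences of pivots in `F`. -/
def Rel (F : Set E) (T : Model E L) : Prop :=
  ∃ Q : Model E L → Prop, Q T ∧ ∀ T, Q T → Compat F T ∧
    ∀ x ∈ F, ∀ y ∈ F, T.B x y ≠ 0 → Q (T.piv x y)

theorem Rel.compat {F : Set E} {T : Model E L} (h : Rel F T) : Compat F T := by
  obtain ⟨Q, h1, h2⟩ := h
  exact (h2 T h1).1

theorem Rel.piv {F : Set E} {T : Model E L} (h : Rel F T) {x y : E} (hx : x ∈ F) (hy : y ∈ F)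
    (hxy : T.B x y ≠ 0) : Rel F (T.piv x y) := by
  obtain ⟨Q, h1, h2⟩ := h
  exact ⟨Q, (h2 T h1).2 x hx y hy hxy, h2⟩

theorem Compat.mono {F G : Set E} {T : Model E L} (h : Compat F T) (hG : G ⊆ F) : Compat G T :=
  ⟨h.skewA, h.skewB, fun i hi j hj => h.bip i (hG hi) j (hG hj),
    fun i hi j hj => h.supp i (hG hi) j (hG hj)⟩

theorem Rel.mono {F G : Set E} {T : Model E L} (h : Rel F T) (hG : G ⊆ F) : Rel G T :=
  ⟨Rel F, h, fun _ hT => ⟨hT.compat.mono hG, fun _ hx _ hy hxy => hT.piv (hG hx) (hG hy) hxy⟩⟩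

/-- The cross-ratio of a two by two submatrix. -/
def cr {K : Type*} [Field K] (N : E → E → K) (i k j l : E) : K := N i j * N k l / (N i l * N k j)

/-- The cross-ratios of `D` are the images under `f` of those of `B`. -/
def CrOk (f : L → L') (B : E → E → L) (D : E → E → L') (i k j l : E) : Prop :=
  f (cr B i k j l) = cr D i k j l

/-- All entries of a two by two submatrix are nonzero. -/
def Full (B : E → E → L) (i k j l : E) : Prop := B i j ≠ 0 ∧ B i l ≠ 0 ∧ B k j ≠ 0 ∧ B k l ≠ 0

/-- The matrix `D` has the support and the translated cross-ratios of `B` on `F`. -/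
structure Good (f : L → L') (F : Set E) (T : Model E L) (D : E → E → L') : Prop where
  rel : Rel F T
  skewD : Skew D
  supp : ∀ i ∈ F, ∀ j ∈ F, (T.B i j = 0 ↔ D i j = 0)
  ok : ∀ i ∈ F, ∀ k ∈ F, ∀ j ∈ F, ∀ l ∈ F, Full T.B i k j l → CrOk f T.B D i k j l

/-- `D` stays good on `F` under all sequences of pivots in `W`. -/
def Lift (f : L → L') (W F : Set E) (T : Model E L) (D : E → E → L') : Prop :=
  ∃ Q : Model E L → (E → E → L') → Prop, Q T D ∧ ∀ T D, Q T D → Good f F T D ∧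
    ∀ x ∈ W, ∀ y ∈ W, T.B x y ≠ 0 → Q (T.piv x y) (TernaryLift.piv D x y)

variable {f : L → L'} {W F G : Set E} {T : Model E L} {D : E → E → L'}

theorem Lift.good (h : Lift f W F T D) : Good f F T D := by
  obtain ⟨Q, h1, h2⟩ := h
  exact (h2 T D h1).1

theorem Lift.piv (h : Lift f W F T D) {x y : E} (hx : x ∈ W) (hy : y ∈ W)
    (hxy : T.B x y ≠ 0) : Lift f W F (T.piv x y) (TernaryLift.piv D x y) := by
  obtain ⟨Q, h1, h2⟩ := h
  exact ⟨Q, (h2 T D h1).2 x hx y hy hxy, h2⟩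

theorem Good.mono (h : Good f F T D) (hG : G ⊆ F) : Good f G T D :=
  ⟨h.rel.mono hG, h.skewD, fun i hi j hj => h.supp i (hG hi) j (hG hj),
    fun i hi k hk j hj l hl => h.ok i (hG hi) k (hG hk) j (hG hj) l (hG hl)⟩

theorem Lift.mono (h : Lift f W F T D) {V : Set E} (hV : V ⊆ W) (hG : G ⊆ F) : Lift f V G T D :=
  ⟨Lift f W F, h, fun _ _ hT => ⟨hT.good.mono hG,
    fun _ hx _ hy hxy => hT.piv (hV hx) (hV hy) hxy⟩⟩

theorem Compat.ne (h : Compat F T) {x y : E} (hxy : T.B x y ≠ 0) : x ≠ y := by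
  rintro rfl; exact hxy (h.skewB.2 _)

theorem Skew.comm_zero {K : Type*} [Field K] {N : E → E → K} (h : Skew N) {i j : E} :
    N i j = 0 ↔ N j i = 0 := by
  rw [h.1 j i, neg_eq_zero]

theorem Compat.zero (h : Compat F T) {i j : E} (hi : i ∈ F) (hj : j ∈ F)
    (hij : T.side i = T.side j) : T.B i j = 0 := by
  by_contra h'
  exact h.bip i hi j hj h' hij

theorem Compat.side_eq (h : Compat F T) {i j k : E} (hi : i ∈ F) (hj : j ∈ F) (hk : k ∈ F)
    (hij : T.B i j ≠ 0) (hkj : T.B k j ≠ 0) : T.side i = T.side k := by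
  have h1 := h.bip i hi j hj hij
  have h2 := h.bip k hk j hj hkj
  revert h1 h2
  cases T.side i <;> cases T.side j <;> cases T.side k <;> simp

section Piv

variable {K : Type*} [Field K] {N : E → E → K}

theorem piv_of_left {x y k l : E} (hkx : k ≠ x) (hky : k ≠ y) (hlx : l ≠ x) (hly : l ≠ y)
    (h : N k x = 0) : piv N x y k l = N k l - N k y * N x l / N x y := by
  rw [piv_of_ne hkx hky hlx hly, h]
  ring

theorem piv_unchanged {x y k l : E} (hkx : k ≠ x) (hky : k ≠ y) (hlx : l ≠ x) (hly : l ≠ y)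
    (h1 : N k x * N y l = 0) (h2 : N k y * N x l = 0) : piv N x y k l = N k l := by
  rw [piv_of_ne hkx hky hlx hly, h1, h2]
  simp

theorem piv_left' (hN : Skew N) {x y j : E} (hxy : N x y ≠ 0) (hjx : j ≠ x)
    (hjy : j ≠ y) : piv N x y j x = N j y / N x y := by
  rw [(hN.piv x y).1 x j, piv_left hN hxy hjx hjy, hN.1 j y]
  ring

theorem piv_right' (hN : Skew N) {x y j : E} (hxy : N x y ≠ 0) (hjx : j ≠ x)
    (hjy : j ≠ y) : piv N x y j y = -N j x / N x y := by
  rw [(hN.piv x y).1 y j, piv_right hN hxy hjx hjy, hN.1 j x]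
  ring

theorem piv_self' (hN : Skew N) {x y : E} (hxy : N x y ≠ 0) : piv N x y y x = (N x y)⁻¹ := by
  rw [(hN.piv x y).1 x y, piv_self hN hxy, neg_neg]

theorem cr_inv_rows (i k j l : E) : cr N k i j l = (cr N i k j l)⁻¹ := by
  simp only [cr, inv_div]; ring

theorem cr_inv_cols (i k j l : E) : cr N i k l j = (cr N i k j l)⁻¹ := by
  simp only [cr, inv_div]

theorem cr_transpose (hN : Skew N) (i k j l : E) : cr N j l i k = cr N i k j l := by
  simp only [cr]
  rw [hN.1 i j, hN.1 k l, hN.1 i l, hN.1 k j]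
  ring

theorem cr_mul {i k j l m : E} (h1 : N i l ≠ 0) (h2 : N k l ≠ 0) :
    cr N i k j m = cr N i k j l * cr N i k l m := by
  simp only [cr]; field_simp

theorem cr_piv (hN : Skew N) {x y k l : E} (hxy : N x y ≠ 0) (hkx : k ≠ x)
    (hky : k ≠ y) (hlx : l ≠ x) (hly : l ≠ y) (h : N k x = 0) (hxl : N x l ≠ 0)
    (hk : N k y ≠ 0) : cr (piv N x y) y k x l = 1 - cr N x k y l := by
  simp only [cr]
  rw [piv_self' hN hxy, piv_of_left hkx hky hlx hly h, piv_right hN hxy hlx hly,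
    piv_left' hN hxy hkx hky]
  field_simp
  ring

theorem piv_eq_mul_cr {x y k l : E} (hxy : N x y ≠ 0) (hkx : k ≠ x)
    (hky : k ≠ y) (hlx : l ≠ x) (hly : l ≠ y) (h : N k x = 0) (hkl : N k l ≠ 0) :
    piv N x y k l = N k l * (1 - cr N k x y l) := by
  simp only [cr]
  rw [piv_of_left hkx hky hlx hly h]
  field_simp

end Piv

theorem Rel.cr_eq_one_iff_of_full (h : Rel F T) {i k j l : E} (hi : i ∈ F) (hk : k ∈ F) (hj : j ∈ F)
    (hl : l ∈ F) (hf : Full T.B i k j l) : cr T.A i k j l = 1 ↔ cr T.B i k j l = 1 := by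
  have hc := h.compat
  obtain ⟨hij, hil, hkj, hkl⟩ := hf
  have aij : T.A i j ≠ 0 := fun h' => hij ((hc.supp i hi j hj).1 h')
  have ail : T.A i l ≠ 0 := fun h' => hil ((hc.supp i hi l hl).1 h')
  have akj : T.A k j ≠ 0 := fun h' => hkj ((hc.supp k hk j hj).1 h')
  have akl : T.A k l ≠ 0 := fun h' => hkl ((hc.supp k hk l hl).1 h')
  by_cases hik : i = k
  · subst hik
    simp only [cr]
    rw [mul_comm (T.B i j), mul_comm (T.A i j)]
    simp [*]
  by_cases hjl : j = l
  · subst hjl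
    simp only [cr]
    simp [*]
  have bki := hc.zero hk hi (hc.side_eq hk hj hi hkj hij)
  have aki := (hc.supp k hk i hi).2 bki
  have hnil := hc.ne hil
  have hnkl := hc.ne hkl
  have hnij := hc.ne hij
  have h2 := (h.piv hi hl hil).compat.supp k hk j hj
  rw [Model.piv_A, Model.piv_B, piv_eq_mul_cr ail (Ne.symm hik) hnkl hnij.symm hjl aki akj,
    piv_eq_mul_cr hil (Ne.symm hik) hnkl hnij.symm hjl bki hkj] at h2
  simp only [mul_eq_zero, akj, hkj, false_or, sub_eq_zero] at h2
  rw [cr_inv_cols, cr_inv_cols k i j l, cr_inv_rows, cr_inv_rows i k, inv_inv, inv_inv] at h2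
  rw [eq_comm, h2, eq_comm]

/-- Corresponding cross-ratios of a compatible pair are simultaneously equal to one. -/
theorem Rel.cr_eq_one_iff (h : Rel F T) {i k j l : E} (hi : i ∈ F) (hk : k ∈ F) (hj : j ∈ F)
    (hl : l ∈ F) : cr T.A i k j l = 1 ↔ cr T.B i k j l = 1 := by
  by_cases hf : Full T.B i k j l
  · exact h.cr_eq_one_iff_of_full hi hk hj hl hf
  · have h1 := h.compat.supp i hi j hj
    have h2 := h.compat.supp i hi l hl
    have h3 := h.compat.supp k hk j hj
    have h4 := h.compat.supp k hk l hl
    have : T.B i j = 0 ∨ T.B i l = 0 ∨ T.B k j = 0 ∨ T.B k l = 0 := by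
      unfold Full at hf; tauto
    rcases this with h | h | h | h
    · simp [cr, h, h1.2 h]
    · simp [cr, h, h2.2 h]
    · simp [cr, h, h3.2 h]
    · simp [cr, h, h4.2 h]

theorem Rel.cr_ne_zero (h : Rel F T) {i k j l : E} (hi : i ∈ F) (hk : k ∈ F) (hj : j ∈ F)
    (hl : l ∈ F) (hf : Full T.B i k j l) : cr T.A i k j l ≠ 0 := by
  have hc := h.compat
  obtain ⟨hij, hil, hkj, hkl⟩ := hf
  have aij : T.A i j ≠ 0 := fun h' => hij ((hc.supp i hi j hj).1 h')
  have ail : T.A i l ≠ 0 := fun h' => hil ((hc.supp i hi l hl).1 h')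
  have akj : T.A k j ≠ 0 := fun h' => hkj ((hc.supp k hk j hj).1 h')
  have akl : T.A k l ≠ 0 := fun h' => hkl ((hc.supp k hk l hl).1 h')
  exact div_ne_zero (mul_ne_zero aij akl) (mul_ne_zero ail akj)

section CrOk

variable {B : E → E → L} {i k j l m : E}

theorem Full.rows (h : Full B i k j l) : Full B k i j l := ⟨h.2.2.1, h.2.2.2, h.1, h.2.1⟩

theorem Full.cols (h : Full B i k j l) : Full B i k l j := ⟨h.2.1, h.1, h.2.2.2, h.2.2.1⟩

theorem Full.transpose (hB : Skew B) (h : Full B i k j l) : Full B j l i k := by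
  refine ⟨?_, ?_, ?_, ?_⟩
  · rw [Ne, hB.comm_zero]; exact h.1
  · rw [Ne, hB.comm_zero]; exact h.2.2.1
  · rw [Ne, hB.comm_zero]; exact h.2.1
  · rw [Ne, hB.comm_zero]; exact h.2.2.2

theorem CrOk.rows (hf : CrMap f) (h : CrOk f B D i k j l) : CrOk f B D k i j l := by
  rw [CrOk, cr_inv_rows, hf.inv, h, ← cr_inv_rows]

theorem CrOk.cols (hf : CrMap f) (h : CrOk f B D i k j l) : CrOk f B D i k l j := by
  rw [CrOk, cr_inv_cols, hf.inv, h, ← cr_inv_cols]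

theorem CrOk.transpose (hB : Skew B) (hD : Skew D) (h : CrOk f B D i k j l) :
    CrOk f B D j l i k := by
  rw [CrOk, cr_transpose hB, cr_transpose hD]; exact h

/-- The ternary principle for three columns. -/
theorem CrOk.trans (hf : CrMap f) (hT : Rel F T) (hs : ∀ i ∈ F, ∀ j ∈ F, T.B i j ≠ 0 → D i j ≠ 0)
    (hi : i ∈ F) (hk : k ∈ F) (hj : j ∈ F)
    (hl : l ∈ F) (hm : m ∈ F) (h1 : Full T.B i k j l) (h2 : Full T.B i k l m)
    (h3 : CrOk f T.B D i k j l) (h4 : CrOk f T.B D i k l m) : CrOk f T.B D i k j m := by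
  have hc := hT.compat
  have ail : T.A i l ≠ 0 := fun h' => h1.2.1 ((hc.supp i hi l hl).1 h')
  have akl : T.A k l ≠ 0 := fun h' => h2.2.2.1 ((hc.supp k hk l hl).1 h')
  have key := hf.map_mul (hT.cr_ne_zero hi hk hj hl h1) (hT.cr_ne_zero hi hk hl hm h2)
    (hT.cr_eq_one_iff hi hk hj hl) (hT.cr_eq_one_iff hi hk hl hm)
    (by rw [← cr_mul ail akl, ← cr_mul h1.2.1 h2.2.2.1]
        exact hT.cr_eq_one_iff hi hk hj hm)
  rw [CrOk, cr_mul h1.2.1 h2.2.2.1, key, h3, h4,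
    ← cr_mul (hs i hi l hl h1.2.1) (hs k hk l hl h2.2.2.1)]

/-- The ternary principle for three rows. -/
theorem CrOk.trans_rows (hf : CrMap f) (hT : Rel F T) (hD : Skew D)
    (hs : ∀ i ∈ F, ∀ j ∈ F, T.B i j ≠ 0 → D i j ≠ 0)
    (hi : i ∈ F) (hk : k ∈ F) (hj : j ∈ F)
    (hl : l ∈ F) (hm : m ∈ F) (h1 : Full T.B i k j l) (h2 : Full T.B k m j l)
    (h3 : CrOk f T.B D i k j l) (h4 : CrOk f T.B D k m j l) : CrOk f T.B D i m j l := by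
  have hB := hT.compat.skewB
  exact (CrOk.trans hf hT hs hj hl hi hk hm (h1.transpose hB) (h2.transpose hB)
    (h3.transpose hB hD) (h4.transpose hB hD)).transpose hB hD

theorem Full.crOk_of_row_eq (hf : CrMap f) (h : Full B i i j l) (h1 : D i j ≠ 0) (h2 : D i l ≠ 0) :
    CrOk f B D i i j l := by
  obtain ⟨h3, h4, -, -⟩ := h
  have e1 : cr B i i j l = 1 := by simp only [cr]; field_simp
  have e2 : cr D i i j l = 1 := by simp only [cr]; field_simp
  rw [CrOk, e1, e2, hf.map_one]

theorem Full.crOk_of_col_eq (hf : CrMap f) (h : Full B i k j j) (h1 : D i j ≠ 0) (h2 : D k j ≠ 0) :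
    CrOk f B D i k j j := by
  obtain ⟨h3, -, h4, -⟩ := h
  have e1 : cr B i k j j = 1 := by simp only [cr]; field_simp
  have e2 : cr D i k j j = 1 := by simp only [cr]; field_simp
  rw [CrOk, e1, e2, hf.map_one]

end CrOk

theorem Good.ne (h : Good f F T D) {i j : E} (hi : i ∈ F) (hj : j ∈ F) (hij : T.B i j ≠ 0) :
    D i j ≠ 0 := fun h' => hij ((h.supp i hi j hj).2 h')

end

section


variable {E L L' : Type*} [Field L] [Field L'] {f : L → L'} {W F G : Set E} {T : Model E L}
  {D : E → E → L'}

section Skew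

variable {K : Type*} [Field K] {N : E → E → K}

theorem piv_left_eq_zero_iff (hN : Skew N) {x y j : E} (hxy : N x y ≠ 0) (hjx : j ≠ x)
    (hjy : j ≠ y) : piv N x y x j = 0 ↔ N y j = 0 := by
  rw [piv_left hN hxy hjx hjy, div_eq_zero_iff]; simp [hxy]

theorem piv_right_eq_zero_iff (hN : Skew N) {x y j : E} (hxy : N x y ≠ 0) (hjx : j ≠ x)
    (hjy : j ≠ y) : piv N x y y j = 0 ↔ N x j = 0 := by
  rw [piv_right hN hxy hjx hjy, div_eq_zero_iff]; simp [hxy]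

theorem piv_self_ne (hN : Skew N) {x y : E} (hxy : N x y ≠ 0) : piv N x y x y ≠ 0 := by
  rw [piv_self hN hxy]; simpa using hxy

theorem piv_self_ne' (hN : Skew N) {x y : E} (hxy : N x y ≠ 0) : piv N x y y x ≠ 0 := by
  rw [piv_self' hN hxy]; simpa using hxy

end Skew

theorem Good.supp_piv_of_zero (hf : CrMap f) (h : Good f F T D) {x y k l : E} (hx : x ∈ F)
    (hy : y ∈ F) (hk : k ∈ F) (hl : l ∈ F) (hxy : T.B x y ≠ 0) (hkx : k ≠ x) (hky : k ≠ y)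
    (hlx : l ≠ x) (hly : l ≠ y) (h0 : T.B k x = 0) :
    piv T.B x y k l = 0 ↔ piv D x y k l = 0 := by
  have dxy := h.ne hx hy hxy
  have d0 := (h.supp k hk x hx).1 h0
  by_cases h1 : T.B k y = 0
  · have h1' := (h.supp k hk y hy).1 h1
    rw [piv_unchanged hkx hky hlx hly (by simp [h0]) (by simp [h1]),
      piv_unchanged hkx hky hlx hly (by simp [d0]) (by simp [h1'])]
    exact h.supp k hk l hl
  by_cases h2 : T.B x l = 0
  · have h2' := (h.supp x hx l hl).1 h2
    rw [piv_unchanged hkx hky hlx hly (by simp [h0]) (by simp [h2]),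
      piv_unchanged hkx hky hlx hly (by simp [d0]) (by simp [h2'])]
    exact h.supp k hk l hl
  by_cases h3 : T.B k l = 0
  · have h3' := (h.supp k hk l hl).1 h3
    have h1' := h.ne hk hy h1
    have h2' := h.ne hx hl h2
    rw [piv_of_left hkx hky hlx hly h0, piv_of_left hkx hky hlx hly d0, h3, h3']
    simp [h1, h2, hxy, h1', h2', dxy]
  · have h3' := h.ne hk hl h3
    have hok := h.ok k hk x hx y hy l hl ⟨h1, h3, hxy, h2⟩
    rw [piv_eq_mul_cr hxy hkx hky hlx hly h0 h3, piv_eq_mul_cr dxy hkx hky hlx hly d0 h3', ← hok,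
      ← hf.one_sub, mul_eq_zero, mul_eq_zero, hf.eq_zero_iff]
    simp [h3', h3]

/-- Supports still agree after one pivot. -/
theorem Good.supp_piv (hf : CrMap f) (h : Good f F T D) {x y k l : E} (hx : x ∈ F)
    (hy : y ∈ F) (hk : k ∈ F) (hl : l ∈ F) (hxy : T.B x y ≠ 0) :
    piv T.B x y k l = 0 ↔ piv D x y k l = 0 := by
  have dxy := h.ne hx hy hxy
  have hc := h.rel.compat
  have sB := hc.skewB
  have sD := h.skewD
  have hne := hc.ne hxy
  have aux : ∀ m ∈ F, (piv T.B x y x m = 0 ↔ piv D x y x m = 0) ∧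
      (piv T.B x y y m = 0 ↔ piv D x y y m = 0) := by
    intro m hm
    by_cases hmx : m = x
    · subst hmx
      simp [(sB.piv m y).2, (sD.piv m y).2, piv_self_ne' sB hxy, piv_self_ne' sD dxy]
    by_cases hmy : m = y
    · subst hmy
      simp [(sB.piv x m).2, (sD.piv x m).2, piv_self_ne sB hxy, piv_self_ne sD dxy]
    rw [piv_left_eq_zero_iff sB hxy hmx hmy, piv_left_eq_zero_iff sD dxy hmx hmy,
      piv_right_eq_zero_iff sB hxy hmx hmy, piv_right_eq_zero_iff sD dxy hmx hmy]
    exact ⟨h.supp y hy m hm, h.supp x hx m hm⟩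
  by_cases hkx : k = x
  · subst hkx; exact (aux l hl).1
  by_cases hky : k = y
  · subst hky; exact (aux l hl).2
  by_cases hlx : l = x
  · subst hlx
    rw [(sB.piv l y).comm_zero, (sD.piv l y).comm_zero]; exact (aux k hk).1
  by_cases hly : l = y
  · subst hly
    rw [(sB.piv x l).comm_zero, (sD.piv x l).comm_zero]; exact (aux k hk).2
  by_cases h0 : T.B k x = 0
  · exact h.supp_piv_of_zero hf hx hy hk hl hxy hkx hky hlx hly h0
  · rw [piv_comm sB, piv_comm sD]
    rw [Ne, sB.comm_zero] at hxy
    refine h.supp_piv_of_zero hf hy hx hk hl hxy hky hkx hly hlx ?_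
    exact hc.zero hk hy (hc.side_eq hk hx hy h0 hxy)

/-- A two by two submatrix containing both pivot elements keeps a good cross-ratio. -/
theorem Good.ok_piv (hf : CrMap f) (h : Good f F T D) {x y k l : E} (hx : x ∈ F)
    (hy : y ∈ F) (hk : k ∈ F) (hl : l ∈ F) (hxy : T.B x y ≠ 0)
    (hF : Full (piv T.B x y) y k x l) :
    CrOk f (piv T.B x y) (piv D x y) y k x l := by
  have dxy := h.ne hx hy hxy
  have hc := h.rel.compat
  have sB := hc.skewB
  have sD := h.skewD
  have sp := fun i hi j hj => h.supp_piv hf hx hy (k := i) (l := j) hi hj hxy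
  obtain ⟨-, hyl, hkx, hkl⟩ := id hF
  have e1 : piv D x y y x ≠ 0 := piv_self_ne' sD dxy
  have e2 : piv D x y k x ≠ 0 := fun h => hkx ((sp k hk x hx).2 h)
  have e3 : piv D x y y l ≠ 0 := fun h => hyl ((sp y hy l hl).2 h)
  by_cases nky : k = y
  · subst nky
    exact hF.crOk_of_row_eq hf e1 e3
  by_cases nlx : l = x
  · subst nlx
    exact hF.crOk_of_col_eq hf e1 e2
  have nkx : k ≠ x := by rintro rfl; exact hkx ((sB.piv _ _).2 _)
  have nly : l ≠ y := by rintro rfl; exact hyl ((sB.piv _ _).2 _)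
  rw [Ne, (sB.piv x y).comm_zero, piv_left_eq_zero_iff sB hxy nkx nky, sB.comm_zero] at hkx
  rw [Ne, piv_right_eq_zero_iff sB hxy nlx nly] at hyl
  have h0 : T.B k x = 0 := hc.zero hk hx (hc.side_eq hk hy hx hkx hxy)
  have d0 := (h.supp k hk x hx).1 h0
  rw [CrOk, cr_piv sB hxy nkx nky nlx nly h0 hyl hkx,
    cr_piv sD dxy nkx nky nlx nly d0 (h.ne hx hl hyl) (h.ne hk hy hkx), hf.one_sub]
  congr 1
  by_cases hz : T.B k l = 0
  · have := (h.supp k hk l hl).1 hz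
    simp [cr, hz, this, hf.map_zero]
  · exact h.ok x hx k hk y hy l hl ⟨hxy, hyl, hkx, hz⟩

/-- Version of `Good.ok_piv` that is insensitive to the order of rows and columns. -/
theorem Good.ok_piv' (hf : CrMap f) (h : Good f F T D) {x y i k j l : E} (hx : x ∈ F)
    (hy : y ∈ F) (hi : i ∈ F) (hk : k ∈ F) (hj : j ∈ F) (hl : l ∈ F) (hxy : T.B x y ≠ 0)
    (hF : Full (piv T.B x y) i k j l)
    (hq : ((x = i ∨ x = k) ∧ (y = j ∨ y = l)) ∨ ((y = i ∨ y = k) ∧ (x = j ∨ x = l))) :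
    CrOk f (piv T.B x y) (piv D x y) i k j l := by
  have sB := h.rel.compat.skewB
  have sD := h.skewD
  have main : ∀ x ∈ F, ∀ y ∈ F, T.B x y ≠ 0 → ∀ i ∈ F, ∀ k ∈ F, ∀ j ∈ F, ∀ l ∈ F,
      Full (piv T.B x y) i k j l → (y = i ∨ y = k) → (x = j ∨ x = l) →
      CrOk f (piv T.B x y) (piv D x y) i k j l := by
    rintro x hx y hy hxy i hi k hk j hj l hl hF (rfl | rfl) (rfl | rfl)
    · exact h.ok_piv hf hj hi hk hl hxy hF
    · exact (h.ok_piv hf hl hi hk hj hxy hF.cols).cols hf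
    · exact (h.ok_piv hf hj hk hi hl hxy hF.rows).rows hf
    · exact ((h.ok_piv hf hl hk hi hj hxy hF.rows.cols).cols hf).rows hf
  rcases hq with ⟨h1, h2⟩ | ⟨h1, h2⟩
  · rw [piv_comm sB] at hF ⊢
    rw [piv_comm sD]
    rw [Ne, sB.comm_zero] at hxy
    exact main y hy x hx hxy i hi k hk j hj l hl hF h1 h2
  · exact main x hx y hy hxy i hi k hk j hj l hl hF h1 h2

end

section


variable {E L : Type*} [Field L] {W : Set E} {N : E → E → L}

/-- Walks in `W` made of `n` double steps along nonzero entries. -/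
inductive DWalk (W : Set E) (N : E → E → L) : ℕ → E → E → Prop
  | nil (a : E) : DWalk W N 0 a a
  | cons {a w c b : E} {n : ℕ} (hw : w ∈ W) (hc : c ∈ W) (haw : N a w ≠ 0) (hwc : N w c ≠ 0)
      (h : DWalk W N n c b) : DWalk W N (n + 1) a b

/-- Connectivity in `W` along nonzero entries. -/
def Conn (W : Set E) (N : E → E → L) : E → E → Prop :=
  Relation.ReflTransGen fun i j => i ∈ W ∧ j ∈ W ∧ N i j ≠ 0

theorem Conn.symm (hN : Skew N) {a b : E} (h : Conn W N a b) : Conn W N b a := by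
  induction h with
  | refl => exact .refl
  | tail _ h ih =>
    exact .head ⟨h.2.1, h.1, by rw [Ne, hN.comm_zero]; exact h.2.2⟩ ih

theorem Conn.mono {V : Set E} (hV : V ⊆ W) {a b : E} (h : Conn V N a b) : Conn W N a b := by
  induction h with
  | refl => exact .refl
  | tail _ h ih => exact ih.tail ⟨hV h.1, hV h.2.1, h.2.2⟩

theorem Conn.single {a b : E} (ha : a ∈ W) (hb : b ∈ W) (h : N a b ≠ 0) : Conn W N a b :=
  Relation.ReflTransGen.single ⟨ha, hb, h⟩

theorem bool_side {a b c : Bool} (h1 : a ≠ b) (h2 : b ≠ c) : a = c := by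
  revert h1 h2; cases a <;> cases b <;> cases c <;> simp

/-- Connectivity is preserved by pivoting. -/
theorem Conn.piv (hN : Skew N) {x y : E} (hx : x ∈ W) (hy : y ∈ W) (hxy : N x y ≠ 0) {a b : E}
    (h : Conn W N a b) : Conn W (piv N x y) a b := by
  have hP := hN.piv x y
  have eyx : Conn W (TernaryLift.piv N x y) y x := .single hy hx (piv_self_ne' hN hxy)
  have exy : Conn W (TernaryLift.piv N x y) x y := .single hx hy (piv_self_ne hN hxy)
  have eix : ∀ i ∈ W, N i y ≠ 0 → i ≠ x → i ≠ y → Conn W (TernaryLift.piv N x y) i x := by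
    intro i hi h1 h2 h3
    refine .single hi hx ?_
    rwa [Ne, hP.comm_zero, piv_left_eq_zero_iff hN hxy h2 h3, hN.comm_zero]
  have eiy : ∀ i ∈ W, N i x ≠ 0 → i ≠ x → i ≠ y → Conn W (TernaryLift.piv N x y) i y := by
    intro i hi h1 h2 h3
    refine .single hi hy ?_
    rwa [Ne, hP.comm_zero, piv_right_eq_zero_iff hN hxy h2 h3, hN.comm_zero]
  have edge : ∀ i j, i ∈ W → j ∈ W → N i j ≠ 0 → Conn W (TernaryLift.piv N x y) i j := by
    intro i j hi hj hij
    have hji : N j i ≠ 0 := by rwa [Ne, hN.comm_zero]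
    have hne : i ≠ j := by rintro rfl; exact hij (hN.2 _)
    by_cases hix : i = x
    · subst hix
      by_cases hjy : j = y
      · subst hjy; exact exy
      · exact exy.trans ((eiy j hj hji hne.symm hjy).symm hP)
    by_cases hiy : i = y
    · subst hiy
      by_cases hjx : j = x
      · subst hjx; exact eyx
      · exact eyx.trans ((eix j hj hji hjx hne.symm).symm hP)
    by_cases hjx : j = x
    · subst hjx; exact (eiy i hi hij hix hiy).trans eyx
    by_cases hjy : j = y
    · subst hjy; exact (eix i hi hij hix hiy).trans exy
    by_cases h1 : N i x = 0 ∨ N y j = 0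
    · by_cases h2 : N i y = 0 ∨ N x j = 0
      · refine .single hi hj ?_
        rwa [piv_unchanged hix hiy hjx hjy (mul_eq_zero.2 h1) (mul_eq_zero.2 h2)]
      · push Not at h2
        exact (eix i hi h2.1 hix hiy).trans (exy.trans ((eiy j hj
          (by rw [Ne, hN.comm_zero]; exact h2.2) hjx hjy).symm hP))
    · push Not at h1
      exact (eiy i hi h1.1 hix hiy).trans (eyx.trans ((eix j hj
        (by rw [Ne, hN.comm_zero]; exact h1.2) hjx hjy).symm hP))
  induction h with
  | refl => exact .refl
  | tail _ h ih => exact ih.trans (edge _ _ h.1 h.2.1 h.2.2)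

theorem Conn.exists_dwalk {σ : E → Bool} (hσ : ∀ i ∈ W, ∀ j ∈ W, N i j ≠ 0 → σ i ≠ σ j) {a b : E}
    (h : Conn W N a b) : (σ a = σ b → ∃ n, DWalk W N n a b) ∧
      (σ a ≠ σ b → ∃ w ∈ W, N a w ≠ 0 ∧ ∃ n, DWalk W N n w b) := by
  induction h using Relation.ReflTransGen.head_induction_on with
  | refl => exact ⟨fun _ => ⟨0, .nil _⟩, fun h => (h rfl).elim⟩
  | head h' h'' ih =>
    rename_i a c
    have h1 := hσ _ h'.1 _ h'.2.1 h'.2.2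
    constructor
    · intro h2
      obtain ⟨w, hw, hcw, n, hn⟩ := ih.2 (h2 ▸ h1.symm)
      exact ⟨n + 1, .cons h'.2.1 hw h'.2.2 hcw hn⟩
    · intro h2
      exact ⟨c, h'.2.1, h'.2.2, ih.1 (bool_side h1.symm h2)⟩

/-- A walk survives a pivot at `x y` if `x` is further away from its end than its start. -/
theorem DWalk.piv (hN : Skew N) {σ : E → Bool} (hσ : ∀ i ∈ W, ∀ j ∈ W, N i j ≠ 0 → σ i ≠ σ j)
    {x y : E} (hx : x ∈ W) (hy : y ∈ W) (hxy : N x y ≠ 0) {n : ℕ} {c b : E} (hc : c ∈ W)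
    (hcx : σ c = σ x) (h : DWalk W N n c b) (hno : ∀ k ≤ n, ¬ DWalk W N k x b) :
    DWalk W (piv N x y) n c b := by
  induction h with
  | nil => exact .nil _
  | cons hw hc' hcw hwc h ih =>
    rename_i c w c' b n
    have zero : ∀ i ∈ W, ∀ j ∈ W, σ i = σ j → N i j = 0 := by
      intro i hi j hj hij
      by_contra h'
      exact hσ i hi j hj h' hij
    have sxy := hσ _ hx _ hy hxy
    have scw := hσ _ hc _ hw hcw
    have swc := hσ _ hw _ hc' hwc
    have ncx : c ≠ x := by
      rintro rfl; exact hno (n + 1) le_rfl (.cons hw hc' hcw hwc h)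
    have xw : N x w = 0 := by
      by_contra h'
      exact hno (n + 1) le_rfl (.cons hw hc' h' hwc h)
    have wx : N w x = 0 := hN.comm_zero.1 xw
    have ncx' : c' ≠ x := by
      rintro rfl; exact hno n (by omega) h
    have nwy : w ≠ y := by rintro rfl; exact hxy xw
    have ncy : c ≠ y := by rintro rfl; exact sxy hcx.symm
    have nwx : w ≠ x := by rintro rfl; exact scw hcx
    have scc' := bool_side scw swc
    have ncy' : c' ≠ y := by rintro rfl; exact sxy (hcx ▸ scc')
    refine .cons hw hc' ?_ ?_ (ih hc' (scc' ▸ hcx) fun k hk => hno k (by omega))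
    · rwa [piv_unchanged ncx ncy nwx nwy (by simp [zero c hc x hx hcx]) (by simp [xw])]
    · have wy : N w y = 0 := zero w hw y hy (bool_side scw.symm (hcx ▸ sxy))
      rwa [piv_unchanged nwx nwy ncx' ncy' (by simp [wx]) (by simp [wy])]

/-- Induction along walks that get shortened by pivoting. -/
theorem walk_induction {X : Type*} (B : X → E → E → L) (σ : X → E → Bool) (pv : X → E → E → X)
    (I P : X → Prop) (u v : E) {a b : E} (hB : ∀ t x y, B (pv t x y) = piv (B t) x y)
    (skew : ∀ t, I t → Skew (B t))
    (bip : ∀ t, I t → ∀ i ∈ W, ∀ j ∈ W, B t i j ≠ 0 → σ t i ≠ σ t j)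
    (ha : a ∈ W) (hb : b ∈ W) (zero : a = b → ∀ t, I t → P t)
    (one : ∀ t, I t → ∀ w ∈ W, B t a w ≠ 0 → B t w b ≠ 0 → P t)
    (two : ∀ t, I t → ∀ w₁ ∈ W, ∀ c ∈ W, ∀ w₂ ∈ W, B t a w₁ ≠ 0 → B t w₁ c ≠ 0 → B t c w₂ ≠ 0 →
      B t w₂ b ≠ 0 → B t a w₂ = 0 → B t b w₁ = 0 → (B t u c ≠ 0 ∨ B t v c ≠ 0) → P t)
    (red : ∀ t, I t → ∀ x ∈ W, ∀ y ∈ W, B t x y ≠ 0 → x ≠ a → x ≠ b → σ t x = σ t a →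
      ((B t a y = 0 ∧ B t b y = 0) ∨ (B t u x = 0 ∧ B t v x = 0)) →
      I (pv t x y) ∧ (P (pv t x y) → P t)) (n : ℕ) :
    ∀ t, I t → DWalk W (B t) n a b → P t := by
  induction n using Nat.strong_induction_on with
  | _ n ih =>
    intro t ht hw
    by_cases hshort : ∃ k < n, DWalk W (B t) k a b
    · obtain ⟨k, hk, hk'⟩ := hshort
      exact ih k hk t ht hk'
    push Not at hshort
    have hN := skew t ht
    have hσ := bip t ht
    have hz : ∀ i ∈ W, ∀ j ∈ W, σ t i = σ t j → B t i j = 0 := by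
      intro i hi j hj hij
      by_contra h'
      exact hσ i hi j hj h' hij
    cases hw with
    | nil => exact zero rfl t ht
    | cons hw₁ hc₁ e1 e2 h =>
    rename_i w₁ c₁ n
    have s1 := hσ _ ha _ hw₁ e1
    have s2 := hσ _ hw₁ _ hc₁ e2
    have sac := bool_side s1 s2
    have w1c1 : w₁ ≠ c₁ := fun h => s2 (by rw [h])
    have aw1 : a ≠ w₁ := fun h => s1 (by rw [← h])
    have e2' : B t c₁ w₁ ≠ 0 := by rwa [Ne, hN.comm_zero]
    cases h with
    | nil => exact one t ht w₁ hw₁ e1 e2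
    | cons hw₂ hc₂ e3 e4 h =>
    rename_i w₂ c₂ n
    have s3 := hσ _ hc₁ _ hw₂ e3
    have s4 := hσ _ hw₂ _ hc₂ e4
    have c1w2 : c₁ ≠ w₂ := fun h => s3 (by rw [← h])
    have w2c2 : w₂ ≠ c₂ := fun h => s4 (by rw [← h])
    have aw2 : a ≠ w₂ := fun h => s3 (by rw [← h, ← sac])
    have ac1 : c₁ ≠ a := by
      rintro rfl
      exact hshort (n + 1) (by omega) (.cons hw₂ hc₂ e3 e4 h)
    have w2a : B t a w₂ = 0 := by
      by_contra h'
      exact hshort (n + 1) (by omega) (.cons hw₂ hc₂ h' e4 h)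
    have w1w2 : w₁ ≠ w₂ := by rintro rfl; exact e1 w2a
    have c1b : c₁ ≠ b := by
      rintro rfl
      exact hshort 1 (by omega) (.cons hw₁ hc₁ e1 e2 (.nil _))
    have sww : σ t w₁ = σ t w₂ := bool_side s2 s3
    have scc : σ t c₁ = σ t c₂ := bool_side s3 s4
    have w1c2 : w₁ ≠ c₂ := fun h => s2 (by rw [h, ← scc])
    have c1c2 : c₂ ≠ c₁ := by
      rintro rfl
      exact hshort (n + 1) (by omega) (.cons hw₁ hc₁ e1 e2 h)
    have w1c2' : B t w₁ c₂ = 0 := by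
      by_contra h'
      exact hshort (n + 1) (by omega) (.cons hw₁ hc₂ e1 h' h)
    cases h with
    | nil =>
      have w1b : B t b w₁ = 0 := hN.comm_zero.1 w1c2'
      by_cases huv : B t u c₁ ≠ 0 ∨ B t v c₁ ≠ 0
      · exact two t ht w₁ hw₁ c₁ hc₁ w₂ hw₂ e1 e2 e3 e4 w2a w1b huv
      · push Not at huv
        obtain ⟨hI, hP⟩ := red t ht c₁ hc₁ w₁ hw₁ e2' ac1 c1b sac.symm (.inr huv)
        refine hP (ih 1 (by omega) _ hI (.cons hw₂ hc₂ ?_ ?_ (.nil _)))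
        · rw [hB, piv_of_left ac1.symm aw1 c1w2.symm w1w2.symm (hz a ha c₁ hc₁ sac), w2a]
          simp [e1, e3, e2']
        · rwa [hB, piv_unchanged c1w2.symm w1w2.symm c1c2 w1c2.symm (by simp [w1c2'])
            (by simp [hz w₂ hw₂ w₁ hw₁ sww.symm])]
    | cons hw₃ hc₃ e5 e6 h =>
      rename_i w₃ c₃ n
      have hbw : B t b w₂ = 0 := by
        by_contra h'
        refine hshort 2 (by omega) (.cons hw₁ hc₁ e1 e2 (.cons hw₂ hb e3 ?_ (.nil _)))
        rwa [Ne, hN.comm_zero]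
      obtain ⟨hI, hP⟩ := red t ht c₁ hc₁ w₂ hw₂ e3 ac1 c1b sac.symm (.inl ⟨w2a, hbw⟩)
      refine hP (ih (n + 1 + 1) (by omega) _ hI (.cons hw₁ hc₂ ?_ ?_ ?_))
      · rwa [hB, piv_unchanged ac1.symm aw2 w1c1 w1w2 (by simp [hz a ha c₁ hc₁ sac])
          (by simp [w2a])]
      · rw [hB, piv_of_ne w1c1 w1w2 c1c2 w2c2.symm, w1c2', hz w₁ hw₁ w₂ hw₂ sww]
        simp [e2, e3, e4]
      · rw [hB]
        refine DWalk.piv hN hσ hc₁ hw₂ e3 hc₂ scc.symm (.cons hw₃ hc₃ e5 e6 h) fun k hk hk' => ?_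
        exact hshort (k + 1) (by omega) (.cons hw₁ hc₁ e1 e2 hk')

end

section


variable {E L L' : Type*} [Field L] [Field L'] {f : L → L'} {W : Set E} {T : Model E L}
  {D : E → E → L'} {u v : E}

section Hexagon

variable {K : Type*} [Field K] {N : E → E → K} {a b c x y u v : E}

theorem cr_piv_hexagon (hba : b ≠ a) (hbx : b ≠ x) (hca : c ≠ a) (hcx : c ≠ x) (hya : y ≠ a)
    (hyx : y ≠ x) (hua : u ≠ a) (hux : u ≠ x) (h1 : N b a = 0) (h2 : N c a = 0) (h3 : N a y = 0)
    (h4 : N b x = 0) (n1 : N a x ≠ 0) (n2 : N c u ≠ 0) :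
    cr (piv N a x) b c y u = (1 - cr N c a x u) * cr N b c y u := by
  simp only [cr]
  rw [piv_of_left hba hbx hya hyx h1, piv_of_left hba hbx hua hux h1,
    piv_of_left hca hcx hya hyx h2, piv_of_left hca hcx hua hux h2, h3, h4]
  have : (1 - N c x * N a u / (N c u * N a x)) * (N b y * N c u / (N b u * N c y)) =
    ((1 - N c x * N a u / (N c u * N a x)) * N c u) * N b y / (N b u * N c y) := by ring
  rw [this]
  have : (1 - N c x * N a u / (N c u * N a x)) * N c u = N c u - N c x * N a u / N a x := by
    field_simp
  rw [this]
  ring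

theorem cr_piv_hexagon_opposite (hba : b ≠ a) (hbx : b ≠ x) (hca : c ≠ a) (hcx : c ≠ x)
    (hya : y ≠ a) (hyx : y ≠ x) (hva : v ≠ a) (hvx : v ≠ x) (h1 : N b a = 0) (h2 : N c a = 0)
    (h3 : N a y = 0) (h4 : N b x = 0) (h5 : N c v = 0) (n1 : N a x ≠ 0) (n2 : N c u ≠ 0)
    (n3 : N b u ≠ 0) (n4 : N a u ≠ 0) :
    cr (piv N a x) b c y v = -(cr N c a x u * cr N b c y u * cr N a b v u) := by
  simp only [cr]
  rw [piv_of_left hba hbx hya hyx h1, piv_of_left hba hbx hva hvx h1,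
    piv_of_left hca hcx hya hyx h2, piv_of_left hca hcx hva hvx h2, h3, h4, h5]
  by_cases h6 : N b v = 0
  · simp [h6]
  by_cases h7 : N c y = 0
  · simp [h7]
  by_cases h8 : N c x = 0
  · simp [h8]
  by_cases h9 : N a v = 0
  · simp [h9]
  simp only [zero_mul, mul_zero, zero_div, sub_zero, zero_sub]
  field_simp

end Hexagon

/-- The situation in which lifts on `W ∪ {u}` and `W ∪ {v}` are glued. -/
structure Glue (f : L → L') (W : Set E) (u v : E) (T : Model E L) (D : E → E → L') : Prop where
  hu : u ∉ W
  hv : v ∉ W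
  rel : Rel (insert u (insert v W)) T
  lu : Lift f (insert u W) (insert u W) T D
  lv : Lift f (insert v W) (insert v W) T D
  conn : ∀ a ∈ W, ∀ b ∈ W, Conn W T.B a b
  side : T.side u = T.side v
  zero : D u v = 0

namespace Glue

theorem mem_u (_ : Glue f W u v T D) : u ∈ insert u (insert v W) := Set.mem_insert _ _

theorem mem_v (_ : Glue f W u v T D) : v ∈ insert u (insert v W) :=
  Set.mem_insert_of_mem _ (Set.mem_insert _ _)

theorem mem (_ : Glue f W u v T D) {a : E} (ha : a ∈ W) : a ∈ insert u (insert v W) :=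
  Set.mem_insert_of_mem _ (Set.mem_insert_of_mem _ ha)

theorem skewD (h : Glue f W u v T D) : Skew D := h.lu.good.skewD

theorem symm (h : Glue f W u v T D) : Glue f W v u T D where
  hu := h.hv
  hv := h.hu
  rel := by rw [Set.insert_comm]; exact h.rel
  lu := h.lv
  lv := h.lu
  conn := h.conn
  side := h.side.symm
  zero := by rw [h.skewD.1 u v, h.zero, neg_zero]

theorem supp (h : Glue f W u v T D) : ∀ i ∈ insert u (insert v W), ∀ j ∈ insert u (insert v W),
    (T.B i j = 0 ↔ D i j = 0) := by
  have hc := h.rel.compat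
  have huv := hc.zero h.mem_u h.mem_v h.side
  have hvu := hc.zero h.mem_v h.mem_u h.side.symm
  have hu := h.lu.good.supp
  have hv := h.lv.good.supp
  have h0 := h.zero
  have h0' := h.symm.zero
  intro i hi j hj
  by_cases hiv : i ∈ insert u W
  · by_cases hjv : j ∈ insert u W
    · exact hu i hiv j hjv
    · have hj' : j = v := by
        simp only [Set.mem_insert_iff] at hj hjv; tauto
      subst hj'
      by_cases hiu : i = u
      · subst hiu; simp [huv, h0]
      · exact hv i (by simp only [Set.mem_insert_iff] at hiv ⊢; tauto) j (Set.mem_insert _ _)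
  · have hi' : i = v := by
      simp only [Set.mem_insert_iff] at hi hiv; tauto
    subst hi'
    by_cases hju : j = u
    · subst hju; simp [hvu, h0']
    · exact hv i (Set.mem_insert _ _) j (by simp only [Set.mem_insert_iff] at hj ⊢; tauto)

theorem supp_ne (h : Glue f W u v T D) : ∀ i ∈ insert u (insert v W), ∀ j ∈ insert u (insert v W),
    T.B i j ≠ 0 → D i j ≠ 0 :=
  fun i hi j hj h1 h2 => h1 ((h.supp i hi j hj).2 h2)

theorem piv (h : Glue f W u v T D) {x y : E} (hx : x ∈ W) (hy : y ∈ W) (hxy : T.B x y ≠ 0) :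
    Glue f W u v (T.piv x y) (TernaryLift.piv D x y) := by
  have hc := h.rel.compat
  have hux : u ≠ x := by rintro rfl; exact h.hu hx
  have huy : u ≠ y := by rintro rfl; exact h.hu hy
  have hvx : v ≠ x := by rintro rfl; exact h.hv hx
  have hvy : v ≠ y := by rintro rfl; exact h.hv hy
  refine ⟨h.hu, h.hv, h.rel.piv (h.mem hx) (h.mem hy) hxy,
    h.lu.piv (Set.mem_insert_of_mem _ hx) (Set.mem_insert_of_mem _ hy) hxy,
    h.lv.piv (Set.mem_insert_of_mem _ hx) (Set.mem_insert_of_mem _ hy) hxy,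
    fun a ha b hb => (h.conn a ha b hb).piv hc.skewB hx hy hxy, ?_, ?_⟩
  · simp [flip_of_ne hux huy, flip_of_ne hvx hvy, h.side]
  · have s := hc.bip x (h.mem hx) y (h.mem hy) hxy
    have key : ∀ i ∈ W, T.side u = T.side i → D u i = 0 ∧ D i v = 0 := by
      intro i hi hs
      exact ⟨(h.supp u h.mem_u i (h.mem hi)).1 (hc.zero h.mem_u (h.mem hi) hs),
        (h.supp i (h.mem hi) v h.mem_v).1 (hc.zero (h.mem hi) h.mem_v (hs ▸ h.side))⟩
    rw [piv_unchanged hux huy hvx hvy, h.zero]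
    · by_cases hs : T.side u = T.side x
      · simp [(key x hx hs).1]
      · simp [(key y hy (bool_side hs s)).2]
    · by_cases hs : T.side u = T.side x
      · simp [(key x hx hs).2]
      · simp [(key y hy (bool_side hs s)).1]

theorem ok_one (h : Glue f W u v T D) (hf : CrMap f) {a b w : E} (ha : a ∈ W)
    (hb : b ∈ W) (hw : w ∈ W)
    (hF : Full T.B a b u v) (haw : T.B a w ≠ 0) (hbw : T.B b w ≠ 0) : CrOk f T.B D a b u v := by
  have h1 : Full T.B a b u w := ⟨hF.1, haw, hF.2.2.1, hbw⟩
  have h2 : Full T.B a b w v := ⟨haw, hF.2.1, hbw, hF.2.2.2⟩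
  refine CrOk.trans hf h.rel h.supp_ne (h.mem ha) (h.mem hb) h.mem_u (h.mem hw) h.mem_v h1 h2 ?_ ?_
  · exact h.lu.good.ok _ (Set.mem_insert_of_mem _ ha) _ (Set.mem_insert_of_mem _ hb) _
      (Set.mem_insert _ _) _ (Set.mem_insert_of_mem _ hw) h1
  · exact h.lv.good.ok _ (Set.mem_insert_of_mem _ ha) _ (Set.mem_insert_of_mem _ hb) _
      (Set.mem_insert_of_mem _ hw) _ (Set.mem_insert _ _) h2

theorem ok_hexagon (h : Glue f W u v T D) (hf : CrMap f) {a b c x y : E}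
    (ha : a ∈ W) (hb : b ∈ W) (hc : c ∈ W)
    (hx : x ∈ W) (hy : y ∈ W) (hF : Full T.B a b u v) (hax : T.B a x ≠ 0) (hcx : T.B c x ≠ 0)
    (hcy : T.B c y ≠ 0) (hby : T.B b y ≠ 0) (hay : T.B a y = 0) (hbx : T.B b x = 0)
    (hcu : T.B c u ≠ 0) (hcv : T.B c v = 0) : CrOk f T.B D a b u v := by
  have hC := h.rel.compat
  have hsA : ∀ i ∈ insert u (insert v W), ∀ j ∈ insert u (insert v W), T.B i j = 0 → T.A i j = 0 :=
    fun i hi j hj => (hC.supp i hi j hj).2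
  have hsA' : ∀ i ∈ insert u (insert v W), ∀ j ∈ insert u (insert v W), T.B i j ≠ 0 →
      T.A i j ≠ 0 := fun i hi j hj h1 h2 => h1 ((hC.supp i hi j hj).1 h2)
  have hsD : ∀ i ∈ insert u (insert v W), ∀ j ∈ insert u (insert v W), T.B i j = 0 → D i j = 0 :=
    fun i hi j hj => (h.supp i hi j hj).1
  have hsD' := h.supp_ne
  have hu := h.mem_u
  have hv := h.mem_v
  have ha' := h.mem ha
  have hb' := h.mem hb
  have hc' := h.mem hc
  have hx' := h.mem hx
  have hy' := h.mem hy
  obtain ⟨hau, hav, hbu, hbv⟩ := id hF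
  have sab := hC.side_eq ha' hu hb' hau hbu
  have sca := hC.side_eq hc' hu ha' hcu hau
  have sax := hC.bip a ha' x hx' hax
  have say : T.side a ≠ T.side y := sca ▸ hC.bip c hc' y hy' hcy
  have sau := hC.bip a ha' u hu hau
  have sav := hC.bip a ha' v hv hav
  have nba : b ≠ a := by rintro rfl; exact hax hbx
  have nca : c ≠ a := by rintro rfl; exact hav hcv
  have ncb : c ≠ b := by rintro rfl; exact hbv hcv
  have nyx : y ≠ x := by rintro rfl; exact hax hay
  have nxu : u ≠ x := by rintro rfl; exact h.hu hx
  have nxv : v ≠ x := by rintro rfl; exact h.hv hx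
  have nyu : u ≠ y := by rintro rfl; exact h.hu hy
  have nyv : v ≠ y := by rintro rfl; exact h.hv hy
  have nuv : u ≠ v := by rintro rfl; exact hcu hcv
  have nax : a ≠ x := fun h => sax (by rw [h])
  have nay : a ≠ y := fun h => say (by rw [h])
  have nau : a ≠ u := fun h => sau (by rw [h])
  have nav : a ≠ v := fun h => sav (by rw [h])
  have nbx : b ≠ x := fun h => sax (by rw [sab, h])
  have nby : b ≠ y := fun h => say (by rw [sab, h])
  have nbu : b ≠ u := fun h => sau (by rw [sab, h])
  have nbv : b ≠ v := fun h => sav (by rw [sab, h])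
  have ncx : c ≠ x := fun h => sax (by rw [← sca, h])
  have ncy : c ≠ y := fun h => say (by rw [← sca, h])
  have ncu : c ≠ u := fun h => sau (by rw [← sca, h])
  have ncv : c ≠ v := fun h => sav (by rw [← sca, h])
  have zba := hC.zero hb' ha' sab.symm
  have zab := hC.zero ha' hb' sab
  have zca := hC.zero hc' ha' sca
  have zac := hC.zero ha' hc' sca.symm
  have zbc := hC.zero hb' hc' (sab.symm.trans sca.symm)
  have zcb := hC.zero hc' hb' (sca.trans sab)
  have hbv' : T.B b v ≠ 0 := hbv
  -- the three cyclically related conditions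
  have c1 := (h.rel.piv ha' hx' hax).cr_eq_one_iff hb' hc' hy' hu
  rw [Model.piv_A, Model.piv_B,
    cr_piv_hexagon nba nbx nca ncx nay.symm nyx nau.symm nxu (hsA _ hb' _ ha' zba)
      (hsA _ hc' _ ha' zca) (hsA _ ha' _ hy' hay) (hsA _ hb' _ hx' hbx) (hsA' _ ha' _ hx' hax)
      (hsA' _ hc' _ hu hcu),
    cr_piv_hexagon nba nbx nca ncx nay.symm nyx nau.symm nxu zba zca hay hbx hax hcu] at c1
  have c2 := (h.rel.piv hc' hy' hcy).cr_eq_one_iff ha' hb' hv hu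
  rw [Model.piv_A, Model.piv_B,
    cr_piv_hexagon nca.symm nay ncb.symm nby ncv.symm nyv ncu.symm nyu (hsA _ ha' _ hc' zac)
      (hsA _ hb' _ hc' zbc) (hsA _ hc' _ hv hcv) (hsA _ ha' _ hy' hay) (hsA' _ hc' _ hy' hcy)
      (hsA' _ hb' _ hu hbu),
    cr_piv_hexagon nca.symm nay ncb.symm nby ncv.symm nyv ncu.symm nyu zac zbc hcv hay hcy hbu] at c2
  have c3 := (h.rel.piv hb' hv hbv).cr_eq_one_iff hc' ha' hx' hu
  rw [Model.piv_A, Model.piv_B,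
    cr_piv_hexagon ncb ncv nba.symm nav nbx.symm nxv.symm nbu.symm nuv (hsA _ hc' _ hb' zcb)
      (hsA _ ha' _ hb' zab) (hsA _ hb' _ hx' hbx) (hsA _ hc' _ hv hcv) (hsA' _ hb' _ hv hbv)
      (hsA' _ ha' _ hu hau),
    cr_piv_hexagon ncb ncv nba.symm nav nbx.symm nxv.symm nbu.symm nuv zcb zab hbx hcv hbv hau] at c3
  have c4 := (h.rel.piv ha' hx' hax).cr_eq_one_iff hb' hc' hy' hv
  have e4 := cr_piv_hexagon_opposite (N := T.B) (u := u) nba nbx nca ncx nay.symm nyx nav.symm nxv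
    zba zca hay hbx hcv hax hcu hbu hau
  rw [Model.piv_A, Model.piv_B,
    cr_piv_hexagon_opposite (u := u) nba nbx nca ncx nay.symm nyx nav.symm nxv
      (hsA _ hb' _ ha' zba) (hsA _ hc' _ ha' zca) (hsA _ ha' _ hy' hay) (hsA _ hb' _ hx' hbx)
      (hsA _ hc' _ hv hcv) (hsA' _ ha' _ hx' hax) (hsA' _ hc' _ hu hcu) (hsA' _ hb' _ hu hbu)
      (hsA' _ ha' _ hu hau), e4] at c4
  have f1 : Full T.B c a x u := ⟨hcx, hcu, hax, hau⟩
  have f2 : Full T.B b c y u := ⟨hby, hbu, hcy, hcu⟩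
  have f3 : Full T.B a b v u := hF.cols
  have key := hf.map_neg_mul_mul (h.rel.cr_ne_zero hc' ha' hx' hu f1)
    (h.rel.cr_ne_zero hb' hc' hy' hu f2) (h.rel.cr_ne_zero ha' hb' hv hu f3)
    (h.rel.cr_eq_one_iff hc' ha' hx' hu) (h.rel.cr_eq_one_iff hb' hc' hy' hu)
    (h.rel.cr_eq_one_iff ha' hb' hv hu) c4 c1 c2 c3
  have k1 : CrOk f T.B D c a x u := h.lu.good.ok _ (Set.mem_insert_of_mem _ hc) _
    (Set.mem_insert_of_mem _ ha) _ (Set.mem_insert_of_mem _ hx) _ (Set.mem_insert _ _) f1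
  have k2 : CrOk f T.B D b c y u := h.lu.good.ok _ (Set.mem_insert_of_mem _ hb) _
    (Set.mem_insert_of_mem _ hc) _ (Set.mem_insert_of_mem _ hy) _ (Set.mem_insert _ _) f2
  have f4 : Full (TernaryLift.piv T.B a x) b c y v := by
    refine ⟨?_, ?_, ?_, ?_⟩
    · rwa [piv_unchanged nba nbx nay.symm nyx (by simp [zba]) (by simp [hbx])]
    · rwa [piv_unchanged nba nbx nav.symm nxv (by simp [zba]) (by simp [hbx])]
    · rwa [piv_unchanged nca ncx nay.symm nyx (by simp [zca]) (by simp [hay])]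
    · rw [piv_of_left nca ncx nav.symm nxv zca, hcv]
      simp [hcx, hav, hax]
  have k4 : CrOk f (TernaryLift.piv T.B a x) (TernaryLift.piv D a x) b c y v :=
    (h.lv.piv (Set.mem_insert_of_mem _ ha) (Set.mem_insert_of_mem _ hx) hax).good.ok _
      (Set.mem_insert_of_mem _ hb) _ (Set.mem_insert_of_mem _ hc) _ (Set.mem_insert_of_mem _ hy) _
      (Set.mem_insert _ _) f4
  rw [CrOk, e4, cr_piv_hexagon_opposite (u := u) nba nbx nca ncx nay.symm nyx nav.symm nxv
      (hsD _ hb' _ ha' zba) (hsD _ hc' _ ha' zca) (hsD _ ha' _ hy' hay) (hsD _ hb' _ hx' hbx)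
      (hsD _ hc' _ hv hcv) (hsD' _ ha' _ hx' hax) (hsD' _ hc' _ hu hcu) (hsD' _ hb' _ hu hbu)
      (hsD' _ ha' _ hu hau), key, k1, k2] at k4
  have d1 : cr D c a x u ≠ 0 := div_ne_zero
    (mul_ne_zero (hsD' _ hc' _ hx' hcx) (hsD' _ ha' _ hu hau))
    (mul_ne_zero (hsD' _ hc' _ hu hcu) (hsD' _ ha' _ hx' hax))
  have d2 : cr D b c y u ≠ 0 := div_ne_zero
    (mul_ne_zero (hsD' _ hb' _ hy' hby) (hsD' _ hc' _ hu hcu))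
    (mul_ne_zero (hsD' _ hb' _ hu hbu) (hsD' _ hc' _ hy' hcy))
  have k3 : CrOk f T.B D a b v u := mul_left_cancel₀ (mul_ne_zero d1 d2) (neg_injective k4)
  exact k3.cols hf

end Glue

end

section


variable {E L L' : Type*} [Field L] [Field L'] {f : L → L'} {W : Set E} {T : Model E L}
  {D : E → E → L'} {u v : E}

namespace Glue

/-- Entries in rows which a pivot at `x y` does not touch. -/
theorem unchanged (h : Glue f W u v T D) {a x y : E} (ha : a ∈ W) (hx : x ∈ W) (hy : y ∈ W)
    (hxy : T.B x y ≠ 0) (hxa : x ≠ a) (hs : T.side x = T.side a)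
    (hz : T.B a y = 0 ∨ (T.B u x = 0 ∧ T.B v x = 0)) :
    (TernaryLift.piv T.B x y a u = T.B a u ∧ TernaryLift.piv T.B x y a v = T.B a v) ∧
    (TernaryLift.piv D x y a u = D a u ∧ TernaryLift.piv D x y a v = D a v) := by
  have hc := h.rel.compat
  have hux : u ≠ x := by rintro rfl; exact h.hu hx
  have huy : u ≠ y := by rintro rfl; exact h.hu hy
  have hvx : v ≠ x := by rintro rfl; exact h.hv hx
  have hvy : v ≠ y := by rintro rfl; exact h.hv hy
  have hay : a ≠ y := by
    rintro rfl
    exact hc.bip x (h.mem hx) a (h.mem ha) hxy hs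
  have z := hc.zero (h.mem ha) (h.mem hx) hs.symm
  have z' := (h.supp a (h.mem ha) x (h.mem hx)).1 z
  have zu : T.B a y * T.B x u = 0 := by
    rcases hz with hz | hz
    · simp [hz]
    · simp [hc.skewB.comm_zero.1 hz.1]
  have zv : T.B a y * T.B x v = 0 := by
    rcases hz with hz | hz
    · simp [hz]
    · simp [hc.skewB.comm_zero.1 hz.2]
  have tr : ∀ w ∈ insert u (insert v W), T.B a y * T.B x w = 0 → D a y * D x w = 0 := by
    intro w hw hz
    rcases mul_eq_zero.1 hz with hz | hz
    · simp [(h.supp a (h.mem ha) y (h.mem hy)).1 hz]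
    · simp [(h.supp x (h.mem hx) w hw).1 hz]
  refine ⟨⟨?_, ?_⟩, ⟨?_, ?_⟩⟩
  · exact piv_unchanged hxa.symm hay hux huy (by simp [z]) zu
  · exact piv_unchanged hxa.symm hay hvx hvy (by simp [z]) zv
  · exact piv_unchanged hxa.symm hay hux huy (by simp [z']) (tr u h.mem_u zu)
  · exact piv_unchanged hxa.symm hay hvx hvy (by simp [z']) (tr v h.mem_v zv)

theorem ok (hf : CrMap f) (h : Glue f W u v T D) {a b : E} (ha : a ∈ W) (hb : b ∈ W)
    (hF : Full T.B a b u v) : CrOk f T.B D a b u v := by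
  have hbip : ∀ i ∈ W, ∀ j ∈ W, T.B i j ≠ 0 → T.side i ≠ T.side j :=
    fun i hi j hj => h.rel.compat.bip i (h.mem hi) j (h.mem hj)
  have hside := h.rel.compat.side_eq (h.mem ha) h.mem_u (h.mem hb) hF.1 hF.2.2.1
  obtain ⟨n, hn⟩ := ((h.conn a ha b hb).exists_dwalk hbip).1 hside
  refine walk_induction (X := Model E L × (E → E → L')) (fun t => t.1.B) (fun t => t.1.side)
    (fun t x y => (t.1.piv x y, TernaryLift.piv t.2 x y))
    (fun t => Glue f W u v t.1 t.2 ∧ Full t.1.B a b u v) (fun t => CrOk f t.1.B t.2 a b u v) u v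
    (fun _ _ _ => rfl) (fun t ht => ht.1.rel.compat.skewB)
    (fun t ht i hi j hj => ht.1.rel.compat.bip i (ht.1.mem hi) j (ht.1.mem hj)) ha hb ?_ ?_ ?_ ?_
    n (T, D) ⟨h, hF⟩ hn
  · rintro rfl ⟨T, D⟩ ⟨h, hF⟩
    exact hF.crOk_of_row_eq hf (h.supp_ne _ (h.mem ha) _ h.mem_u hF.1)
      (h.supp_ne _ (h.mem ha) _ h.mem_v hF.2.1)
  · rintro ⟨T, D⟩ ⟨h, hF⟩ w hw h1 h2
    exact h.ok_one hf ha hb hw hF h1 (by rwa [Ne, h.rel.compat.skewB.comm_zero])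
  · rintro ⟨T, D⟩ ⟨h, hF⟩ w₁ hw₁ c hc w₂ hw₂ h1 h2 h3 h4 h5 h6 h7
    have hB := h.rel.compat.skewB
    have h2' : T.B c w₁ ≠ 0 := by rwa [Ne, hB.comm_zero]
    have h4' : T.B b w₂ ≠ 0 := by rwa [Ne, hB.comm_zero]
    have h7' : T.B c u ≠ 0 ∨ T.B c v ≠ 0 := by
      rcases h7 with h7 | h7
      · left; rwa [Ne, hB.comm_zero]
      · right; rwa [Ne, hB.comm_zero]
    by_cases hcu : T.B c u = 0
    · exact CrOk.cols hf (h.symm.ok_hexagon hf ha hb hc hw₁ hw₂ hF.cols h1 h2' h3 h4' h5 h6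
        (h7'.resolve_left (not_not.2 hcu)) hcu)
    by_cases hcv : T.B c v = 0
    · exact h.ok_hexagon hf ha hb hc hw₁ hw₂ hF h1 h2' h3 h4' h5 h6 hcu hcv
    have f1 : Full T.B a c u v := ⟨hF.1, hF.2.1, hcu, hcv⟩
    have f2 : Full T.B c b u v := ⟨hcu, hcv, hF.2.2.1, hF.2.2.2⟩
    exact CrOk.trans_rows hf h.rel h.skewD h.supp_ne (h.mem ha) (h.mem hc) h.mem_u h.mem_v
      (h.mem hb) f1 f2 (h.ok_one hf ha hc hw₁ f1 h1 h2') (h.ok_one hf hc hb hw₂ f2 h3 h4')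
  · rintro ⟨T, D⟩ ⟨h, hF⟩ x hx y hy hxy hxa hxb hs hz
    have hsab := h.rel.compat.side_eq (h.mem ha) h.mem_u (h.mem hb) hF.1 hF.2.2.1
    obtain ⟨⟨e1, e2⟩, e3, e4⟩ := h.unchanged ha hx hy hxy hxa hs (hz.imp_left And.left)
    obtain ⟨⟨e5, e6⟩, e7, e8⟩ := h.unchanged hb hx hy hxy hxb (hs.trans hsab)
      (hz.imp_left And.right)
    refine ⟨⟨h.piv hx hy hxy, ?_⟩, ?_⟩
    · simp only [Full, Model.piv_B]
      rw [e1, e2, e5, e6]; exact hF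
    · simp only [CrOk, cr, Model.piv_B]
      rw [e1, e2, e3, e4, e5, e6, e7, e8]; exact id

theorem good (hf : CrMap f) (h : Glue f W u v T D) : Good f (insert u (insert v W)) T D := by
  have hc := h.rel.compat
  have hB := hc.skewB
  have hD := h.skewD
  by_cases hne : u = v
  · subst hne
    have := h.lu.good
    rwa [Set.insert_idem]
  have key : ∀ i ∈ insert u (insert v W), ∀ k ∈ insert u (insert v W), Full T.B i k u v →
      CrOk f T.B D i k u v := by
    intro i hi k hk hF
    have huv := hc.zero h.mem_u h.mem_v h.side
    have hvu := hc.zero h.mem_v h.mem_u h.side.symm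
    have mem : ∀ i ∈ insert u (insert v W), T.B i u ≠ 0 → T.B i v ≠ 0 → i ∈ W := by
      intro i hi h1 h2
      rcases hi with rfl | rfl | hi
      · exact (h1 (hB.2 _)).elim
      · exact (h2 (hB.2 _)).elim
      · exact hi
    exact h.ok hf (mem i hi hF.1 hF.2.1) (mem k hk hF.2.2.1 hF.2.2.2) hF
  have key2 : ∀ i ∈ insert u (insert v W), ∀ k ∈ insert u (insert v W),
      ∀ j ∈ insert u (insert v W), ∀ l ∈ insert u (insert v W), Full T.B i k j l →
      (j = u ∨ l = u) → (j = v ∨ l = v) → CrOk f T.B D i k j l := by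
    intro i hi k hk j hj l hl hF h1 h2
    have huv : u ≠ v := hne
    by_cases hjl : j = l
    · subst hjl
      exact hF.crOk_of_col_eq hf (h.supp_ne i hi j hj hF.1) (h.supp_ne k hk j hj hF.2.2.1)
    rcases h1 with rfl | rfl
    · rcases h2 with rfl | rfl
      · exact (huv rfl).elim
      · exact key i hi k hk hF
    · rcases h2 with rfl | rfl
      · exact CrOk.cols hf (key i hi k hk hF.cols)
      · exact (huv rfl).elim
  refine ⟨h.rel, hD, h.supp, fun i hi k hk j hj l hl hF => ?_⟩
  by_cases hv : i ≠ v ∧ k ≠ v ∧ j ≠ v ∧ l ≠ v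
  · have : ∀ w ∈ insert u (insert v W), w ≠ v → w ∈ insert u W := by
      intro w hw hwv
      simp only [Set.mem_insert_iff] at hw ⊢; tauto
    exact h.lu.good.ok i (this i hi hv.1) k (this k hk hv.2.1) j (this j hj hv.2.2.1) l
      (this l hl hv.2.2.2) hF
  by_cases hu : i ≠ u ∧ k ≠ u ∧ j ≠ u ∧ l ≠ u
  · have : ∀ w ∈ insert u (insert v W), w ≠ u → w ∈ insert v W := by
      intro w hw hwv
      simp only [Set.mem_insert_iff] at hw ⊢; tauto
    exact h.lv.good.ok i (this i hi hu.1) k (this k hk hu.2.1) j (this j hj hu.2.2.1) l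
      (this l hl hu.2.2.2) hF
  have hcol : (j = u ∨ l = u) ∧ (j = v ∨ l = v) ∨ (i = u ∨ k = u) ∧ (i = v ∨ k = v) := by
    have s1 := hc.bip i hi j hj hF.1
    have s2 := hc.bip i hi l hl hF.2.1
    have s3 := hc.bip k hk j hj hF.2.2.1
    have s4 := hc.bip k hk l hl hF.2.2.2
    have su := h.side
    have hu' : i = u ∨ k = u ∨ j = u ∨ l = u := by
      by_contra h'; push Not at h'; exact hu h'
    have hv' : i = v ∨ k = v ∨ j = v ∨ l = v := by
      by_contra h'; push Not at h'; exact hv h'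
    clear hu hv key key2
    grind
  rcases hcol with ⟨h1, h2⟩ | ⟨h1, h2⟩
  · exact key2 i hi k hk j hj l hl hF h1 h2
  · exact (key2 j hj l hl i hi k hk (hF.transpose hB) h1 h2).transpose hB hD

theorem lift (hf : CrMap f) (h : Glue f W u v T D) : Lift f W (insert u (insert v W)) T D :=
  ⟨Glue f W u v, h, fun _ _ h => ⟨h.good hf, fun _ hx _ hy hxy => h.piv hx hy hxy⟩⟩

end Glue

end

section


variable {E L L' : Type*} [Field L] [Field L'] {f : L → L'} {W F : Set E} {T : Model E L}
  {D : E → E → L'}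

theorem flip_flip (σ : E → Bool) (x y : E) : flip (flip σ x y) x y = σ := by
  funext e
  by_cases h : e = x ∨ e = y <;> simp [flip, h]

theorem flip_flip_shift (σ : E → Bool) {x u j : E} (hxu : x ≠ u) (hxj : x ≠ j) (huj : u ≠ j) :
    flip (flip σ x u) u j = flip σ x j := by
  funext e
  by_cases h1 : e = x <;> by_cases h2 : e = u <;> by_cases h3 : e = j <;> simp_all [flip]

theorem flip_flip_comm (σ : E → Bool) (x u i j : E) :
    flip (flip σ x u) i j = flip (flip σ i j) x u := by
  funext e
  by_cases h1 : e = x ∨ e = u <;> by_cases h2 : e = i ∨ e = j <;> simp [flip, h1, h2]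

theorem ne_of_piv_ne {K : Type*} [Field K] {N : E → E → K} {x y : E}
    (h : piv N x y x y ≠ 0) : N x y ≠ 0 := by
  intro h'
  exact h (by rw [piv_def, h']; simp)

theorem Compat.A_ne (h : Compat F T) {x y : E} (hx : x ∈ F) (hy : y ∈ F) (hxy : T.B x y ≠ 0) :
    T.A x y ≠ 0 := fun h' => hxy ((h.supp x hx y hy).1 h')

theorem Compat.piv_piv (h : Compat F T) {x y : E} (hx : x ∈ F) (hy : y ∈ F)
    (hxy : T.B x y ≠ 0) : (T.piv x y).piv x y = T :=
  Model.ext (flip_flip _ _ _) (TernaryLift.piv_piv h.skewA (h.A_ne hx hy hxy))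
    (TernaryLift.piv_piv h.skewB hxy)

theorem Compat.piv_comm (h : Compat F T) (x y : E) : T.piv x y = T.piv y x :=
  Model.ext (flip_comm _ _ _) (TernaryLift.piv_comm h.skewA _ _)
    (TernaryLift.piv_comm h.skewB _ _)

theorem Compat.piv_piv_shift (h : Compat F T) {x u j : E} (hx : x ∈ F) (hu : u ∈ F) (hj : j ∈ F)
    (hxu : T.B x u ≠ 0) (hxj : T.B x j ≠ 0) (huj : u ≠ j) :
    (T.piv x u).piv u j = T.piv x j :=
  Model.ext (flip_flip_shift _ (h.ne hxu) (h.ne hxj) huj)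
    (TernaryLift.piv_piv_shift h.skewA (h.A_ne hx hu hxu) (h.A_ne hx hj hxj) huj)
    (TernaryLift.piv_piv_shift h.skewB hxu hxj huj)

theorem Compat.piv_piv_comm (h : Compat F T) {x u i j : E} (hx : x ∈ F) (hu : u ∈ F) (hi : i ∈ F)
    (hj : j ∈ F) (hxu : T.B x u ≠ 0) (hij : T.B i j ≠ 0) (hA : TernaryLift.piv T.A x u i j ≠ 0)
    (hB : TernaryLift.piv T.B x u i j ≠ 0) (hxi : x ≠ i) (hxj : x ≠ j) (hui : u ≠ i)
    (huj : u ≠ j) : (T.piv x u).piv i j = (T.piv i j).piv x u :=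
  Model.ext (flip_flip_comm _ _ _ _ _)
    (TernaryLift.piv_piv_comm h.skewA (h.A_ne hx hu hxu) (h.A_ne hi hj hij) hA hxi hxj hui huj)
    (TernaryLift.piv_piv_comm h.skewB hxu hij hB hxi hxj hui huj)

/-- The pairs which become lifts with respect to `W` after exchanging `u` with one of its
neighbours in `W`. -/
structure Ext (f : L → L') (W F : Set E) (u : E) (T : Model E L) (D : E → E → L') : Prop where
  rel : Rel F T
  skewD : Skew D
  nbr : ∃ x ∈ W, T.B u x ≠ 0
  lift : ∀ x ∈ W, T.B u x ≠ 0 → Lift f W F (T.piv u x) (TernaryLift.piv D u x)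

variable {u : E}

theorem Ext.of_lift (hW : W ⊆ F) (hu : u ∈ F) (hr : Rel F T) (hD : Skew D)
    (hs : ∀ i ∈ W, T.B u i ≠ 0 → D u i ≠ 0) {x : E} (hx : x ∈ W)
    (hux : T.B u x ≠ 0) (h : Lift f W F (T.piv u x) (TernaryLift.piv D u x)) :
    Ext f W F u T D := by
  have hc := hr.compat
  refine ⟨hr, hD, ⟨x, hx, hux⟩, fun y hy huy => ?_⟩
  by_cases hxy : x = y
  · subst hxy; exact h
  have := h.piv hx hy (by
    rw [Model.piv_B, piv_right hc.skewB hux (hc.ne huy).symm (Ne.symm hxy)]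
    exact div_ne_zero (neg_ne_zero.2 huy) hux)
  rwa [hc.piv_piv_shift hu (hW hx) (hW hy) hux huy hxy,
    piv_piv_shift hD (hs x hx hux) (hs y hy huy) hxy] at this

theorem Ext.ne (h : Ext f W F u T D) (hW : W ⊆ F) (hu : u ∈ F) {x : E} (hx : x ∈ W)
    (hux : T.B u x ≠ 0) : D u x ≠ 0 :=
  ne_of_piv_ne ((h.lift x hx hux).good.ne hu (hW hx) (piv_self_ne h.rel.compat.skewB hux))

theorem Lift.ext_piv (h : Lift f W F T D) (hW : W ⊆ F) (hu : u ∈ F) {x : E} (hx : x ∈ W)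
    (hux : T.B u x ≠ 0) (hs : ∀ i ∈ W, (T.piv u x).B u i ≠ 0 → TernaryLift.piv D u x u i ≠ 0) :
    Ext f W F u (T.piv u x) (TernaryLift.piv D u x) := by
  have hc := h.good.rel.compat
  refine .of_lift hW hu (h.good.rel.piv hu (hW hx) hux) (h.good.skewD.piv _ _) hs hx
    (piv_self_ne hc.skewB hux) ?_
  rwa [hc.piv_piv hu (hW hx) hux, piv_piv h.good.skewD (h.good.ne hu (hW hx) hux)]

theorem Lift.ext (hf : CrMap f) (h : Lift f W F T D) (hW : W ⊆ F) (hu : u ∈ F) {x : E} (hx : x ∈ W)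
    (hux : T.B u x ≠ 0) : Ext f W F u (T.piv u x) (TernaryLift.piv D u x) :=
  h.ext_piv hW hu hx hux fun _ hi hn hn' =>
    hn ((h.good.supp_piv hf hu (hW hx) hu (hW hi) hux).2 hn')

theorem Ext.supp (hf : CrMap f) (h : Ext f W F u T D) (hW : W ⊆ F) (hu : u ∈ F) :
    ∀ i ∈ F, ∀ j ∈ F, (T.B i j = 0 ↔ D i j = 0) := by
  intro i hi j hj
  obtain ⟨x, hx, hux⟩ := h.nbr
  have hB := h.rel.compat.skewB
  have := (h.lift x hx hux).good.supp_piv hf hu (hW hx) hi hj (piv_self_ne hB hux)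
  rwa [Model.piv_B, piv_piv hB hux, piv_piv h.skewD (h.ne hW hu hx hux)] at this

/-- Pivots in `W ∪ {u}` preserve the extended class. -/
theorem Ext.piv (hf : CrMap f) (h : Ext f W F u T D) (hW : W ⊆ F) (hu : u ∈ F) (huW : u ∉ W)
    {i j : E} (hi : i ∈ W) (hj : j ∈ W) (hij : T.B i j ≠ 0) :
    Ext f W F u (T.piv i j) (TernaryLift.piv D i j) := by
  have hc := h.rel.compat
  have hB := hc.skewB
  have hD := h.skewD
  have hsup := h.supp hf hW hu
  have hui : u ≠ i := by rintro rfl; exact huW hi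
  have huj : u ≠ j := by rintro rfl; exact huW hj
  have step : ∀ i ∈ W, ∀ j ∈ W, T.B i j ≠ 0 → T.B u i ≠ 0 → u ≠ i → u ≠ j →
      Ext f W F u (T.piv i j) (TernaryLift.piv D i j) := by
    intro i hi j hj hij h1 hui huj
    have h2 : T.B i u ≠ 0 := by rwa [Ne, hB.comm_zero]
    have d1 : D i j ≠ 0 := fun h' => hij ((hsup i (hW hi) j (hW hj)).2 h')
    have d2 : D i u ≠ 0 := fun h' => h2 ((hsup i (hW hi) u hu).2 h')
    have hl := h.lift i hi h1
    have := hl.ext hf hW hu hj (by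
      rw [Model.piv_B, piv_left hB h1 huj.symm (hc.ne hij).symm]
      exact div_ne_zero hij h1)
    rwa [hc.piv_comm u i, hc.piv_piv_shift (hW hi) hu (hW hj) h2 hij huj,
      piv_comm hD u i, piv_piv_shift hD d2 d1 huj] at this
  by_cases h1 : T.B u i = 0
  · by_cases h2 : T.B u j = 0
    · obtain ⟨x, hx, hux⟩ := h.nbr
      have hxi : x ≠ i := by rintro rfl; exact hux h1
      have hxj : x ≠ j := by rintro rfl; exact hux h2
      have dux := h.ne hW hu hx hux
      have dij : D i j ≠ 0 := fun h' => hij ((hsup i (hW hi) j (hW hj)).2 h')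
      have dui := (hsup u hu i (hW hi)).1 h1
      have duj := (hsup u hu j (hW hj)).1 h2
      have aui := (hc.supp u hu i (hW hi)).2 h1
      have auj := (hc.supp u hu j (hW hj)).2 h2
      have eB : TernaryLift.piv T.B u x i j = T.B i j :=
        piv_unchanged hui.symm hxi.symm huj.symm hxj.symm (by simp [hB.comm_zero.1 h1]) (by simp [h2])
      have eA : TernaryLift.piv T.A u x i j = T.A i j :=
        piv_unchanged hui.symm hxi.symm huj.symm hxj.symm (by simp [hc.skewA.comm_zero.1 aui])
          (by simp [auj])
      have eD : TernaryLift.piv D u x i j = D i j :=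
        piv_unchanged hui.symm hxi.symm huj.symm hxj.symm (by simp [hD.comm_zero.1 dui])
          (by simp [duj])
      have eB' : TernaryLift.piv T.B i j u x = T.B u x :=
        piv_unchanged hui huj hxi hxj (by simp [h1]) (by simp [h2])
      have eD' : TernaryLift.piv D i j u x = D u x :=
        piv_unchanged hui huj hxi hxj (by simp [dui]) (by simp [duj])
      have hl := (h.lift x hx hux).piv hi hj (by rw [Model.piv_B, eB]; exact hij)
      rw [hc.piv_piv_comm hu (hW hx) (hW hi) (hW hj) hux hij
        (by rw [eA]; exact hc.A_ne (hW hi) (hW hj) hij) (by rw [eB]; exact hij) hui huj hxi hxj,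
        piv_piv_comm hD dux dij (by rw [eD]; exact dij) hui huj hxi hxj] at hl
      refine .of_lift hW hu (h.rel.piv (hW hi) (hW hj) hij) (hD.piv _ _) ?_ hx
        (by rw [Model.piv_B, eB']; exact hux) hl
      intro k hk huk hk'
      apply huk
      by_cases hki : k = i
      · subst hki
        rw [Model.piv_B, hB.piv _ _ |>.comm_zero, piv_left hB hij hui huj, hB.comm_zero.1 h2]
        simp
      by_cases hkj : k = j
      · subst hkj
        rw [Model.piv_B, hB.piv _ _ |>.comm_zero, piv_right hB hij hui huj, hB.comm_zero.1 h1]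
        simp
      rw [piv_unchanged hui huj hki hkj (by simp [dui]) (by simp [duj])] at hk'
      rw [Model.piv_B, piv_unchanged hui huj hki hkj (by simp [h1]) (by simp [h2])]
      exact (hsup u hu k (hW hk)).2 hk'
    · have := step j hj i hi (by rwa [Ne, hB.comm_zero]) h2 huj hui
      rwa [hc.piv_comm, piv_comm hD] at this
  · exact step i hi j hj hij h1 hui huj

end

section


variable {E L L' : Type*} [Field L] [Field L'] {f : L → L'} {W F : Set E} {T : Model E L}
  {D : E → E → L'} {u : E}

section Algebra

variable {K : Type*} [Field K] {N : E → E → K} {a b s t x : E}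

theorem cr_piv_exchange (hN : Skew N) (hus : N u s ≠ 0) (hau : a ≠ u) (has : a ≠ s) (hbu : b ≠ u)
    (hbs : b ≠ s) (htu : t ≠ u) (hts : t ≠ s) (h1 : N a u = 0) (h2 : N b u = 0)
    (h3 : N u t = 0) : cr (piv N u s) a b u t = cr N a b s t := by
  simp only [cr]
  rw [piv_left' hN hus hau has, piv_left' hN hus hbu hbs, piv_of_left hau has htu hts h1,
    piv_of_left hbu hbs htu hts h2, h3]
  by_cases h4 : N a t = 0
  · simp [h4]
  by_cases h5 : N b s = 0
  · simp [h5]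
  simp only [mul_zero, zero_div, sub_zero]
  field_simp

theorem cr_piv_single (hux : N u x ≠ 0) (hau : a ≠ u) (hax : a ≠ x)
    (hbu : b ≠ u) (hbx : b ≠ x) (hsu : s ≠ u) (hsx : s ≠ x) (htu : t ≠ u) (htx : t ≠ x)
    (h1 : N a u = 0) (h2 : N b u = 0) (h3 : N u t = 0) (h4 : N b x = 0) (n1 : N a s ≠ 0) :
    cr (piv N u x) a b s t = cr N a b s t * (1 - cr N a u x s) := by
  simp only [cr]
  rw [piv_of_left hau hax hsu hsx h1, piv_of_left hbu hbx hsu hsx h2,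
    piv_of_left hau hax htu htx h1, piv_of_left hbu hbx htu htx h2, h3, h4]
  simp only [zero_mul, mul_zero, zero_div, sub_zero]
  by_cases h5 : N a t = 0
  · simp [h5]
  by_cases h6 : N b s = 0
  · simp [h6]
  field_simp

theorem cr_piv_degenerate (hN : Skew N) (hux : N u x ≠ 0) (hau : a ≠ u) (hax : a ≠ x)
    (hbu : b ≠ u) (hbx : b ≠ x) (hsu : s ≠ u) (hsx : s ≠ x) (htu : t ≠ u) (htx : t ≠ x)
    (hab : a ≠ b) (hat : a ≠ t) (hsb : s ≠ b) (hst : s ≠ t) (hxb : x ≠ b) (hxt : x ≠ t)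
    (hub : u ≠ b) (hut : u ≠ t)
    (h1 : N a u = 0) (h2 : N b u = 0) (h3 : N u t = 0) (h4 : N b x = 0) (h5 : N a b = 0)
    (h6 : piv N u x a s = 0)
    (hF : Full N a b s t) (n1 : N a x ≠ 0) (n2 : N u s ≠ 0) :
    Full (piv (piv N u x) b t) a x s u ∧
      cr (piv (piv N u x) b t) a x s u = (cr N a b s t)⁻¹ := by
  have hP := hN.piv u x
  obtain ⟨m1, m2, m3, m4⟩ := hF
  have e1 : piv N u x a b = 0 := by
    rw [piv_of_left hau hax hbu hbx h1, hN.comm_zero.1 h2, h5]; simp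
  have e2 : piv N u x x b = 0 := by
    rw [piv_right hN hux hbu hbx, hN.comm_zero.1 h2]; simp
  have e3 : piv N u x b t = N b t := by
    rw [piv_of_left hbu hbx htu htx h2, h4]; simp
  have e4 : piv N u x a t = N a t := by
    rw [piv_of_left hau hax htu htx h1, h3]; simp
  have e5 : piv N u x b s = N b s := by
    rw [piv_of_left hbu hbx hsu hsx h2, h4]; simp
  have e6 : piv N u x a u = N a x / N u x := piv_left' hN hux hau hax
  have e7 : piv N u x b u = 0 := by rw [piv_left' hN hux hbu hbx, h4]; simp
  have e8 : piv N u x x s = - N u s / N u x := piv_right hN hux hsu hsx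
  have e9 : piv N u x x t = 0 := by rw [piv_right hN hux htu htx, h3]; simp
  have e10 : piv N u x x u = (N u x)⁻¹ := piv_self' hN hux
  have c1 : piv (piv N u x) b t a s = -(N a t * N b s / N b t) := by
    rw [piv_of_left hab hat hsb hst e1, h6, e3, e4, e5]; ring
  have c2 : piv (piv N u x) b t a u = N a x / N u x := by
    rw [piv_of_left hab hat hub hut e1, e3, e6, e4, e7]; simp
  have c3 : piv (piv N u x) b t x s = - N u s / N u x := by
    rw [piv_of_left hxb hxt hsb hst e2, e8, e9]; simp
  have c4 : piv (piv N u x) b t x u = (N u x)⁻¹ := by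
    rw [piv_of_left hxb hxt hub hut e2, e9, e10]; simp
  have h8 : N a s = N a x * N u s / N u x := by
    rw [piv_of_left hau hax hsu hsx h1, sub_eq_zero] at h6; exact h6
  refine ⟨⟨?_, ?_, ?_, ?_⟩, ?_⟩
  · rw [c1]; exact neg_ne_zero.2 (div_ne_zero (mul_ne_zero m2 m3) m4)
  · rw [c2]; exact div_ne_zero n1 hux
  · rw [c3]; exact div_ne_zero (neg_ne_zero.2 n2) hux
  · rw [c4]; exact inv_ne_zero hux
  · simp only [cr]
    rw [c1, c2, c3, c4, h8]
    field_simp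

end Algebra

namespace Ext

theorem ok_through (hf : CrMap f) (h : Ext f W F u T D) (hW : W ⊆ F) (hu : u ∈ F)
    {b s t : E} (hb : b ∈ F) (ht : t ∈ F) (hs : s ∈ W) (hF : Full T.B u b s t) :
    CrOk f T.B D u b s t := by
  have hB := h.rel.compat.skewB
  have := (h.lift s hs hF.1).good.ok_piv' hf (x := u) (y := s) (i := u) (k := b) (j := s) (l := t)
    hu (hW hs) hu hb (hW hs) ht (piv_self_ne hB hF.1)
  rw [Model.piv_B, piv_piv hB hF.1, piv_piv h.skewD (h.ne hW hu hs hF.1)] at this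
  exact this hF (.inl ⟨.inl rfl, .inl rfl⟩)

theorem ok_row (hf : CrMap f) (h : Ext f W F u T D) (hW : W ⊆ F) (hu : u ∈ F)
    (hst : ∀ s ∈ F, ∀ t ∈ F, s ≠ u → t ≠ u → s ≠ t → s ∈ W ∨ t ∈ W)
    {b s t : E} (hb : b ∈ F) (hs : s ∈ F) (ht : t ∈ F) (hF : Full T.B u b s t) :
    CrOk f T.B D u b s t := by
  have hc := h.rel.compat
  have hsup := h.supp hf hW hu
  have hne : ∀ i ∈ F, ∀ j ∈ F, T.B i j ≠ 0 → D i j ≠ 0 :=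
    fun i hi j hj h1 h2 => h1 ((hsup i hi j hj).2 h2)
  by_cases hstn : s = t
  · subst hstn
    exact hF.crOk_of_col_eq hf (hne _ hu _ hs hF.1) (hne _ hb _ hs hF.2.2.1)
  rcases hst s hs t ht (hc.ne hF.1).symm (hc.ne hF.2.1).symm hstn with h1 | h1
  · exact h.ok_through hf hW hu hb ht h1 hF
  · exact (h.ok_through hf hW hu hb hs h1 hF.cols).cols hf

/-- A quadruple with a row outside, one of whose columns is adjacent to `u`. -/
theorem ok_exchange (hf : CrMap f) (h : Ext f W F u T D) (hW : W ⊆ F) (hu : u ∈ F)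
    (hst : ∀ s ∈ F, ∀ t ∈ F, s ≠ u → t ≠ u → s ≠ t → s ∈ W ∨ t ∈ W)
    {a b s t : E} (ha : a ∈ F) (hb : b ∈ F) (hs : s ∈ W) (ht : t ∈ F)
    (hau : a ≠ u) (hbu : b ≠ u) (hsa : T.side a = T.side u) (hF : Full T.B a b s t)
    (h1 : T.B u s ≠ 0) (h2 : T.B u t = 0) : CrOk f T.B D a b s t := by
  have hc := h.rel.compat
  have hB := hc.skewB
  have hsup := h.supp hf hW hu
  have hsb := hc.side_eq hb (hW hs) ha hF.2.2.1 hF.1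
  have z1 := hc.zero ha hu hsa
  have z2 := hc.zero hb hu (hsb.trans hsa)
  have hts : t ≠ s := by rintro rfl; exact h1 h2
  have htu : t ≠ u := by
    rintro rfl; exact hF.2.1 z1
  have ht0 := (hc.ne hF.1)
  have du := h.ne hW hu hs h1
  have d1 := (hsup a ha u hu).1 z1
  have d2 := (hsup b hb u hu).1 z2
  have d3 := (hsup u hu t ht).1 h2
  have eB := cr_piv_exchange hB h1 hau (hc.ne hF.1) hbu (hc.ne hF.2.2.1) htu hts z1 z2 h2
  have eD := cr_piv_exchange h.skewD du hau (hc.ne hF.1) hbu (hc.ne hF.2.2.1) htu hts d1 d2 d3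
  have := (h.lift s hs h1).good.ok a ha b hb u hu t ht ?_
  · rwa [CrOk, Model.piv_B, eB, eD] at this
  · simp only [Full, Model.piv_B]
    rw [piv_left' hB h1 hau (hc.ne hF.1), piv_left' hB h1 hbu (hc.ne hF.2.2.1),
      piv_of_left hau (hc.ne hF.1) htu hts z1, piv_of_left hbu (hc.ne hF.2.2.1) htu hts z2, h2]
    refine ⟨div_ne_zero hF.1 h1, ?_, div_ne_zero hF.2.2.1 h1, ?_⟩
    · simpa using hF.2.1
    · simpa using hF.2.2.2

/-- A quadruple with one column outside `W`, one of whose rows is adjacent to the exchanged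
element `x`. -/
theorem ok_outside (hf : CrMap f) (h : Ext f W F u T D) (hW : W ⊆ F) (hu : u ∈ F)
    (hst : ∀ s ∈ F, ∀ t ∈ F, s ≠ u → t ≠ u → s ≠ t → s ∈ W ∨ t ∈ W)
    {a b s t x : E} (ha : a ∈ F) (hb : b ∈ F) (hs : s ∈ F) (hsW : s ∉ W)
    (ht : t ∈ W) (hau : a ≠ u) (hbu : b ≠ u) (hsa : T.side a = T.side u)
    (hF : Full T.B a b s t) (h1 : T.B u s ≠ 0) (h2 : T.B u t = 0) (hx : x ∈ W)
    (hux : T.B u x ≠ 0) (hax : T.B a x ≠ 0) (hbx : T.B b x = 0) : CrOk f T.B D a b s t := by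
  have hc := h.rel.compat
  have hB := hc.skewB
  have hD := h.skewD
  have hsup := h.supp hf hW hu
  have ht' := hW ht
  have hx' := hW hx
  have hne : ∀ i ∈ F, ∀ j ∈ F, T.B i j ≠ 0 → D i j ≠ 0 :=
    fun i hi j hj h1 h2 => h1 ((hsup i hi j hj).2 h2)
  obtain ⟨m1, m2, m3, m4⟩ := id hF
  have hsb := hc.side_eq hb hs ha m3 m1
  have sxa := hc.bip a ha x hx' hax
  have ssa := hc.bip a ha s hs m1
  have sta := hc.bip a ha t ht' m2
  have z1 := hc.zero ha hu hsa
  have z2 := hc.zero hb hu (hsb.trans hsa)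
  have z3 := hc.zero ha hb hsb.symm
  have nax : a ≠ x := hc.ne hax
  have nbx : b ≠ x := fun h => sxa (by rw [← h, hsb])
  have nsu : s ≠ u := (hc.ne h1).symm
  have nxu : x ≠ u := (hc.ne hux).symm
  have ntu : t ≠ u := fun h => sta (by rw [h, hsa])
  have nsx : s ≠ x := by rintro rfl; exact hsW hx
  have ntx : t ≠ x := by rintro rfl; exact hux h2
  have nab : a ≠ b := by rintro rfl; exact hax hbx
  have nat : a ≠ t := hc.ne m2
  have nsb : s ≠ b := (hc.ne m3).symm
  have nst : s ≠ t := by rintro rfl; exact h1 h2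
  have nbt : b ≠ t := hc.ne m4
  have dux := h.ne hW hu hx hux
  have dau := (hsup a ha u hu).1 z1
  have dbu := (hsup b hb u hu).1 z2
  have dut := (hsup u hu t ht').1 h2
  have dbx := (hsup b hb x hx').1 hbx
  have dab := (hsup a ha b hb).1 z3
  have g := (h.lift x hx hux).good
  have gs := g.supp a ha s hs
  rw [Model.piv_B] at gs
  by_cases h6 : TernaryLift.piv T.B u x a s = 0
  · have d6 := gs.1 h6
    obtain ⟨fB, eB⟩ := cr_piv_degenerate hB hux hau nax hbu nbx nsu nsx ntu ntx nab nat nsb nst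
      nbx.symm ntx.symm hbu.symm ntu.symm z1 z2 h2 hbx z3 h6 hF hax h1
    obtain ⟨-, eD⟩ := cr_piv_degenerate hD dux hau nax hbu nbx nsu nsx ntu ntx nab nat nsb nst
      nbx.symm ntx.symm hbu.symm ntu.symm dau dbu dut dbx dab d6
      ⟨hne a ha s hs m1, hne a ha t ht' m2, hne b hb s hs m3, hne b hb t ht' m4⟩
      (hne a ha x hx' hax) (hne u hu s hs h1)
    have hbW : b ∈ W := (hst b hb s hs hbu nsu nsb.symm).resolve_right hsW
    have hbt : (T.piv u x).B b t ≠ 0 := by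
      rw [Model.piv_B, piv_of_left hbu nbx ntu ntx z2, hbx]; simpa using m4
    have := ((h.lift x hx hux).piv hbW ht hbt).good.ok a ha x hx' s hs u hu fB
    rw [CrOk, Model.piv_B, Model.piv_B, eB, eD, hf.inv] at this
    exact inv_injective this
  · have eB := cr_piv_single hux hau nax hbu nbx nsu nsx ntu ntx z1 z2 h2 hbx m1
    have eD := cr_piv_single dux hau nax hbu nbx nsu nsx ntu ntx dau dbu dut dbx
      (hne a ha s hs m1)
    have eA := cr_piv_single (hc.A_ne hu hx' hux) hau nax hbu nbx nsu nsx ntu ntx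
      ((hc.supp a ha u hu).2 z1) ((hc.supp b hb u hu).2 z2) ((hc.supp u hu t ht').2 h2)
      ((hc.supp b hb x hx').2 hbx) (hc.A_ne ha hs m1)
    have f0 : Full (TernaryLift.piv T.B u x) a b s t := by
      refine ⟨h6, ?_, ?_, ?_⟩
      · rw [piv_of_left hau nax ntu ntx z1, h2]; simpa using m2
      · rw [piv_of_left hbu nbx nsu nsx z2, hbx]; simpa using m3
      · rw [piv_of_left hbu nbx ntu ntx z2, hbx]; simpa using m4
    have k0 : CrOk f _ _ a b s t := g.ok a ha b hb s hs t ht' f0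
    have f1 : Full T.B a u x s := ⟨hax, m1, hux, h1⟩
    have f1' : Full T.B u a x s := ⟨hux, h1, hax, m1⟩
    have k1 : CrOk f T.B D a u x s := (h.ok_through hf hW hu ha hs hx f1').rows hf
    have r0 := g.rel.cr_eq_one_iff ha hb hs ht'
    have n0 := g.rel.cr_ne_zero ha hb hs ht' f0
    rw [Model.piv_A, eA] at n0
    rw [Model.piv_A, Model.piv_B, eA, eB] at r0
    rw [CrOk, Model.piv_B, eB, eD, hf.map_mul (h.rel.cr_ne_zero ha hb hs ht' hF)
      (right_ne_zero_of_mul n0) (h.rel.cr_eq_one_iff ha hb hs ht') ?_ r0, hf.one_sub, k1] at k0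
    · refine mul_right_cancel₀ ?_ k0
      have := (g.supp a ha s hs).not.1 h6
      intro h'
      apply this
      have n1 := hne a ha s hs m1
      rw [piv_eq_mul_cr dux hau nax nsu nsx dau n1, h', mul_zero]
    · have a1 := h.rel.cr_ne_zero ha hu hx' hs f1
      have b1 : cr T.B a u x s ≠ 0 :=
        div_ne_zero (mul_ne_zero hax h1) (mul_ne_zero m1 hux)
      simp [a1, b1]

theorem ok_side (hf : CrMap f) (h : Ext f W F u T D) (hW : W ⊆ F) (hu : u ∈ F)
    (hst : ∀ s ∈ F, ∀ t ∈ F, s ≠ u → t ≠ u → s ≠ t → s ∈ W ∨ t ∈ W)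
    {a b s t : E} (ha : a ∈ F) (hb : b ∈ F) (hs : s ∈ F) (ht : t ∈ F)
    (hau : a ≠ u) (hbu : b ≠ u) (hsa : T.side a = T.side u) (hF : Full T.B a b s t) :
    CrOk f T.B D a b s t := by
  have hc := h.rel.compat
  have hB := hc.skewB
  have hD := h.skewD
  have hsup := h.supp hf hW hu
  have hne : ∀ i ∈ F, ∀ j ∈ F, T.B i j ≠ 0 → D i j ≠ 0 :=
    fun i hi j hj h1 h2 => h1 ((hsup i hi j hj).2 h2)
  have hsb := hc.side_eq hb hs ha hF.2.2.1 hF.1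
  have z1 := hc.zero ha hu hsa
  have z2 := hc.zero hb hu (hsb.trans hsa)
  have d1 := (hsup a ha u hu).1 z1
  have d2 := (hsup b hb u hu).1 z2
  have both : ∀ s ∈ F, ∀ t ∈ F, Full T.B a b s t → T.B u s ≠ 0 → T.B u t ≠ 0 →
      CrOk f T.B D a b s t := by
    intro s hs t ht hF h1 h2
    have f1 : Full T.B u a s t := ⟨h1, h2, hF.1, hF.2.1⟩
    have f2 : Full T.B u b s t := ⟨h1, h2, hF.2.2.1, hF.2.2.2⟩
    exact CrOk.trans_rows hf h.rel hD hne ha hu hs ht hb f1.rows f2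
      ((h.ok_row hf hW hu hst ha hs ht f1).rows hf) (h.ok_row hf hW hu hst hb hs ht f2)
  have same : ∀ s ∈ F, ∀ t ∈ F, Full T.B a b s t → ∀ x ∈ W, T.B u x ≠ 0 → s ≠ x → t ≠ x →
      (∀ i, i = a ∨ i = b → ∀ j, j = s ∨ j = t → T.B i x * T.B u j = 0) → CrOk f T.B D a b s t := by
    intro s hs t ht hF x hx hux hsx htx hz
    have hx' := hW hx
    have dux := h.ne hW hu hx hux
    have ssu : T.side s ≠ T.side u := hsa ▸ (hc.bip a ha s hs hF.1).symm
    have stu : T.side t ≠ T.side u := hsa ▸ (hc.bip a ha t ht hF.2.1).symm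
    have sxu := hc.bip u hu x hx' hux
    have nax : a ≠ x := fun h => sxu (by rw [← h, hsa])
    have nbx : b ≠ x := fun h => sxu (by rw [← h, hsb, hsa])
    have nsu : s ≠ u := fun h => ssu (by rw [h])
    have ntu : t ≠ u := fun h => stu (by rw [h])
    have tr : ∀ i ∈ F, ∀ j ∈ F, T.B i x * T.B u j = 0 → D i x * D u j = 0 := by
      intro i hi j hj hz
      rcases mul_eq_zero.1 hz with hz | hz
      · simp [(hsup i hi x hx').1 hz]
      · simp [(hsup u hu j hj).1 hz]
    have e1 : TernaryLift.piv T.B u x a s = T.B a s :=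
      piv_unchanged hau nax nsu hsx (by simp [z1]) (hz a (.inl rfl) s (.inl rfl))
    have e2 : TernaryLift.piv T.B u x a t = T.B a t :=
      piv_unchanged hau nax ntu htx (by simp [z1]) (hz a (.inl rfl) t (.inr rfl))
    have e3 : TernaryLift.piv T.B u x b s = T.B b s :=
      piv_unchanged hbu nbx nsu hsx (by simp [z2]) (hz b (.inr rfl) s (.inl rfl))
    have e4 : TernaryLift.piv T.B u x b t = T.B b t :=
      piv_unchanged hbu nbx ntu htx (by simp [z2]) (hz b (.inr rfl) t (.inr rfl))
    have e5 : TernaryLift.piv D u x a s = D a s := piv_unchanged hau nax nsu hsx (by simp [d1])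
      (tr a ha s hs (hz a (.inl rfl) s (.inl rfl)))
    have e6 : TernaryLift.piv D u x a t = D a t := piv_unchanged hau nax ntu htx (by simp [d1])
      (tr a ha t ht (hz a (.inl rfl) t (.inr rfl)))
    have e7 : TernaryLift.piv D u x b s = D b s := piv_unchanged hbu nbx nsu hsx (by simp [d2])
      (tr b hb s hs (hz b (.inr rfl) s (.inl rfl)))
    have e8 : TernaryLift.piv D u x b t = D b t := piv_unchanged hbu nbx ntu htx (by simp [d2])
      (tr b hb t ht (hz b (.inr rfl) t (.inr rfl)))
    have := (h.lift x hx hux).good.ok a ha b hb s hs t ht ?_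
    · simpa only [CrOk, cr, Model.piv_B, e1, e2, e3, e4, e5, e6, e7, e8] using this
    · simpa only [Full, Model.piv_B, e1, e2, e3, e4] using hF
  have single : ∀ s ∈ F, ∀ t ∈ F, Full T.B a b s t → T.B u s ≠ 0 → T.B u t = 0 →
      CrOk f T.B D a b s t := by
    intro s hs t ht hF h1 h2
    by_cases hsW : s ∈ W
    · exact h.ok_exchange hf hW hu hst ha hb hsW ht hau hbu hsa hF h1 h2
    have stu : T.side t ≠ T.side u := hsa ▸ (hc.bip a ha t ht hF.2.1).symm
    have ntu : t ≠ u := fun h => stu (by rw [h])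
    have nst : s ≠ t := by rintro rfl; exact h1 h2
    have htW : t ∈ W := (hst s hs t ht (hc.ne h1).symm ntu nst).resolve_left hsW
    obtain ⟨x, hx, hux⟩ := h.nbr
    have hx' := hW hx
    have hsx : s ≠ x := by rintro rfl; exact hsW hx
    have htx : t ≠ x := by rintro rfl; exact hux h2
    by_cases hax : T.B a x = 0
    · by_cases hbx : T.B b x = 0
      · refine same s hs t ht hF x hx hux hsx htx ?_
        rintro i (rfl | rfl) j -
        · simp [hax]
        · simp [hbx]
      · have hF' : Full T.B b a s t := hF.rows
        exact (h.ok_outside hf hW hu hst hb ha hs hsW htW hbu hau (hsb.trans hsa) hF' h1 h2 hx hux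
          hbx hax).rows hf
    · by_cases hbx : T.B b x = 0
      · exact h.ok_outside hf hW hu hst ha hb hs hsW htW hau hbu hsa hF h1 h2 hx hux hax hbx
      · have f1 : Full T.B a b s x := ⟨hF.1, hax, hF.2.2.1, hbx⟩
        have f2 : Full T.B a b x t := ⟨hax, hF.2.1, hbx, hF.2.2.2⟩
        exact CrOk.trans hf h.rel hne ha hb hs hx' ht f1 f2 (both s hs x hx' f1 h1 hux)
          (h.ok_exchange hf hW hu hst ha hb hx ht hau hbu hsa f2 hux h2)
  by_cases h1 : T.B u s = 0
  · by_cases h2 : T.B u t = 0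
    · obtain ⟨x, hx, hux⟩ := h.nbr
      refine same s hs t ht hF x hx hux ?_ ?_ ?_
      · rintro rfl; exact hux h1
      · rintro rfl; exact hux h2
      · rintro i - j (rfl | rfl)
        · simp [h1]
        · simp [h2]
    · exact (single t ht s hs hF.cols h2 h1).cols hf
  · by_cases h2 : T.B u t = 0
    · exact single s hs t ht hF h1 h2
    · exact both s hs t ht hF h1 h2

theorem good (hf : CrMap f) (h : Ext f W F u T D) (hW : W ⊆ F) (hu : u ∈ F)
    (hst : ∀ s ∈ F, ∀ t ∈ F, s ≠ u → t ≠ u → s ≠ t → s ∈ W ∨ t ∈ W)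
    : Good f F T D := by
  have hc := h.rel.compat
  have hB := hc.skewB
  have hD := h.skewD
  refine ⟨h.rel, hD, h.supp hf hW hu, fun i hi k hk j hj l hl hF => ?_⟩
  by_cases h1 : i = u
  · subst h1; exact h.ok_row hf hW hu hst hk hj hl hF
  by_cases h2 : k = u
  · subst h2; exact (h.ok_row hf hW hu hst hi hj hl hF.rows).rows hf
  by_cases h3 : j = u
  · subst h3
    exact (h.ok_row hf hW hu hst hl hi hk (hF.transpose hB)).transpose hB hD
  by_cases h4 : l = u
  · subst h4
    exact ((h.ok_row hf hW hu hst hj hi hk (hF.transpose hB).rows).rows hf).transpose hB hD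
  by_cases h5 : T.side i = T.side u
  · exact h.ok_side hf hW hu hst hi hk hj hl h1 h2 h5 hF
  · exact (h.ok_side hf hW hu hst hj hl hi hk h3 h4
      (bool_side (hc.bip i hi j hj hF.1).symm h5) (hF.transpose hB)).transpose hB hD

end Ext

/-- Pivots in one further element may be allowed. -/
theorem Lift.extend (hf : CrMap f) (h : Lift f W F T D) (hW : W ⊆ F) (hu : u ∈ F)
    (hst : ∀ s ∈ F, ∀ t ∈ F, s ≠ u → t ≠ u → s ≠ t → s ∈ W ∨ t ∈ W) :
    Lift f (insert u W) F T D := by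
  by_cases huW : u ∈ W
  · rwa [Set.insert_eq_of_mem huW]
  refine ⟨fun T D => Lift f W F T D ∨ Ext f W F u T D, .inl h, ?_⟩
  rintro T D (h | h)
  · have hc := h.good.rel.compat
    refine ⟨h.good, ?_⟩
    rintro x (rfl | hx) y (rfl | hy) hxy
    · exact (hxy (hc.skewB.2 _)).elim
    · exact .inr (h.ext hf hW hu hy hxy)
    · rw [hc.piv_comm, piv_comm h.good.skewD]
      exact .inr (h.ext hf hW hu hx (by rwa [Ne, hc.skewB.comm_zero]))
    · exact .inl (h.piv hx hy hxy)
  · have hc := h.rel.compat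
    refine ⟨h.good hf hW hu hst, ?_⟩
    rintro x (rfl | hx) y (rfl | hy) hxy
    · exact (hxy (hc.skewB.2 _)).elim
    · exact .inl (h.lift y hy hxy)
    · rw [hc.piv_comm, piv_comm h.skewD]
      exact .inl (h.lift x hx (by rwa [Ne, hc.skewB.comm_zero]))
    · exact .inr (h.piv hf hW hu huW hx hy hxy)

end

section


variable {E L L' : Type*} [Field L] [Field L'] {f : L → L'} {W F : Set E}
  {D D₁ D₂ : E → E → L'} {T : Model E L}

/-- Rescale a matrix symmetrically. -/
def scale {K : Type*} [Field K] (r : E → K) (N : E → E → K) : E → E → K :=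
  fun i j => r i * r j * N i j

section Scale

variable {K : Type*} [Field K] {N N' : E → E → K} {r : E → K}

theorem Skew.scale (hN : Skew N) (r : E → K) : Skew (scale r N) :=
  ⟨fun i j => by simp only [TernaryLift.scale]; rw [hN.1 i j]; ring,
    fun i => by simp [TernaryLift.scale, hN.2]⟩

theorem scale_eq_zero (hr : ∀ i, r i ≠ 0) {i j : E} : scale r N i j = 0 ↔ N i j = 0 := by
  simp [scale, hr]

theorem cr_scale (hr : ∀ i, r i ≠ 0) (i k j l : E) : cr (scale r N) i k j l = cr N i k j l := by
  have h1 := hr i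
  have h2 := hr j
  have h3 := hr k
  have h4 := hr l
  simp only [cr, scale]
  by_cases h5 : N i l = 0
  · simp [h5]
  by_cases h6 : N k j = 0
  · simp [h6]
  field_simp

/-- The scaling factors after a pivot. -/
noncomputable def scalePiv (r : E → K) (x y : E) : E → K := fun i =>
  open Classical in if i = x ∨ i = y then (r i)⁻¹ else r i

theorem scalePiv_ne (hr : ∀ i, r i ≠ 0) (x y i : E) : scalePiv r x y i ≠ 0 := by
  simp only [scalePiv]
  split_ifs
  · exact inv_ne_zero (hr i)
  · exact hr i

theorem piv_scale (hN : Skew N) (hr : ∀ i, r i ≠ 0) {x y : E} (hxy : N x y ≠ 0) :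
    piv (scale r N) x y = scale (scalePiv r x y) (piv N x y) := by
  have hS := hN.scale r
  have hP := hN.piv x y
  have hxy' : scale r N x y ≠ 0 := by rwa [Ne, scale_eq_zero hr]
  have hne : x ≠ y := by rintro rfl; exact hxy (hN.2 _)
  have rx := hr x
  have ry := hr y
  have key : ∀ i j, (i = x ∨ i = y → j ≠ x → j ≠ y →
      piv (scale r N) x y i j = scale (scalePiv r x y) (piv N x y) i j) := by
    rintro i j (rfl | rfl) h1 h2
    · rw [piv_left hS hxy' h1 h2]
      simp only [scale, scalePiv]
      rw [piv_left hN hxy h1 h2]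
      simp only [h1, h2, true_or, or_self, if_true, if_false]
      field_simp
    · rw [piv_right hS hxy' h1 h2]
      simp only [scale, scalePiv]
      rw [piv_right hN hxy h1 h2]
      simp only [h1, h2, or_true, or_self, if_true, if_false]
      field_simp
  have skew : ∀ i j, piv (scale r N) x y j i = scale (scalePiv r x y) (piv N x y) j i →
      piv (scale r N) x y i j = scale (scalePiv r x y) (piv N x y) i j := by
    intro i j h
    rw [(hS.piv x y).1 j i, h, (hP.scale _).1 j i]
  have kxy : piv (scale r N) x y x y = scale (scalePiv r x y) (piv N x y) x y := by
    rw [piv_self hS hxy']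
    simp only [scale, scalePiv]
    rw [piv_self hN hxy]
    simp only [true_or, or_true, if_true]
    field_simp
  funext i j
  by_cases hi : i = x ∨ i = y
  · by_cases hj : j = x ∨ j = y
    · rcases hi with rfl | rfl <;> rcases hj with rfl | rfl
      · rw [(hS.piv _ _).2, (hP.scale _).2]
      · exact kxy
      · exact skew _ _ kxy
      · rw [(hS.piv _ _).2, (hP.scale _).2]
    · push Not at hj
      exact key i j hi hj.1 hj.2
  · have hi' := hi
    push Not at hi
    by_cases hj : j = x ∨ j = y
    · exact skew _ _ (key j i hj hi.1 hi.2)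
    · have hj' := hj
      push Not at hj
      rw [piv_of_ne hi.1 hi.2 hj.1 hj.2]
      simp only [scale, scalePiv]
      rw [piv_of_ne hi.1 hi.2 hj.1 hj.2]
      simp only [hi', hj', if_false]
      field_simp

theorem scale_scale (r s : E → K) : scale r (scale s N) = scale (fun i => r i * s i) N := by
  funext i j; simp only [scale]; ring

theorem piv_congr (h : ∀ i ∈ F, ∀ j ∈ F, N i j = N' i j) {x y : E} (hx : x ∈ F) (hy : y ∈ F) :
    ∀ i ∈ F, ∀ j ∈ F, piv N x y i j = piv N' x y i j := by
  intro i hi j hj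
  simp only [piv_def]
  rw [h i hi j hj, h i hi x hx, h y hy j hj, h i hi y hy, h x hx j hj, h x hx y hy]

end Scale

theorem Good.scale (h : Good f F T D) {r : E → L'} (hr : ∀ i, r i ≠ 0) :
    Good f F T (scale r D) :=
  ⟨h.rel, h.skewD.scale r, fun i hi j hj => (h.supp i hi j hj).trans (scale_eq_zero hr).symm,
    fun i hi k hk j hj l hl hF => by
      rw [CrOk, cr_scale hr]; exact h.ok i hi k hk j hj l hl hF⟩

theorem Lift.scale (h : Lift f W F T D) (hW : W ⊆ F) {r : E → L'} (hr : ∀ i, r i ≠ 0) :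
    Lift f W F T (scale r D) := by
  refine ⟨fun T D' => ∃ D r, Lift f W F T D ∧ (∀ i, r i ≠ 0) ∧ D' = TernaryLift.scale r D,
    ⟨D, r, h, hr, rfl⟩, ?_⟩
  rintro T _ ⟨D, r, h, hr, rfl⟩
  refine ⟨h.good.scale hr, fun x hx y hy hxy => ?_⟩
  exact ⟨_, _, h.piv hx hy hxy, scalePiv_ne hr x y,
    piv_scale h.good.skewD hr (h.good.ne (hW hx) (hW hy) hxy)⟩

theorem Good.congr (h : Good f F T D) (hD : Skew D₁) (he : ∀ i ∈ F, ∀ j ∈ F, D i j = D₁ i j) :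
    Good f F T D₁ := by
  refine ⟨h.rel, hD, fun i hi j hj => ?_, fun i hi k hk j hj l hl hF => ?_⟩
  · rw [← he i hi j hj]; exact h.supp i hi j hj
  · have := h.ok i hi k hk j hj l hl hF
    rw [CrOk] at this ⊢
    rw [this, cr, cr, he i hi j hj, he k hk l hl, he i hi l hl, he k hk j hj]

theorem Lift.congr (h : Lift f W F T D) (hW : W ⊆ F) (hD : Skew D₁)
    (he : ∀ i ∈ F, ∀ j ∈ F, D i j = D₁ i j) : Lift f W F T D₁ := by
  refine ⟨fun T D' => ∃ D, Lift f W F T D ∧ Skew D' ∧ ∀ i ∈ F, ∀ j ∈ F, D i j = D' i j,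
    ⟨D, h, hD, he⟩, ?_⟩
  rintro T D' ⟨D, h, hD, he⟩
  exact ⟨h.good.congr hD he, fun x hx y hy hxy =>
    ⟨_, h.piv hx hy hxy, hD.piv _ _, piv_congr he (hW hx) (hW hy)⟩⟩

/-- Two lifts that agree on `W`, together with two neighbours in `W` of a further element. -/
structure Pair (f : L → L') (W : Set E) (v a b : E) (T : Model E L) (D₁ D₂ : E → E → L') :
    Prop where
  lift₁ : Lift f (insert v W) (insert v W) T D₁
  lift₂ : Lift f (insert v W) (insert v W) T D₂
  eq : ∀ i ∈ W, ∀ j ∈ W, D₁ i j = D₂ i j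
  left : T.B v a ≠ 0
  right : T.B v b ≠ 0

variable {v a b : E}

theorem Pair.ratio_of_common (h : Pair f W v a b T D₁ D₂) (ha : a ∈ W) (hb : b ∈ W) {w : E}
    (hw : w ∈ W) (h1 : T.B a w ≠ 0) (h2 : T.B b w ≠ 0) : D₂ v a * D₁ v b = D₂ v b * D₁ v a := by
  have g1 := h.lift₁.good
  have g2 := h.lift₂.good
  have hB := g1.rel.compat.skewB
  have ha' : a ∈ insert v W := Set.mem_insert_of_mem _ ha
  have hb' : b ∈ insert v W := Set.mem_insert_of_mem _ hb
  have hw' : w ∈ insert v W := Set.mem_insert_of_mem _ hw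
  have hv' : v ∈ insert v W := Set.mem_insert _ _
  have hva := g1.ne hv' ha' h.left
  have hvb := g1.ne hv' hb' h.right
  have hva' := g2.ne hv' ha' h.left
  have hvb' := g2.ne hv' hb' h.right
  have hF : Full T.B a b v w := by
    refine ⟨?_, h1, ?_, h2⟩
    · rw [Ne, hB.comm_zero]; exact h.left
    · rw [Ne, hB.comm_zero]; exact h.right
  have k1 := g1.ok a ha' b hb' v hv' w hw' hF
  have k2 := g2.ok a ha' b hb' v hv' w hw' hF
  rw [CrOk] at k1 k2
  rw [k1, cr, cr, ← h.eq b hb w hw, ← h.eq a ha w hw, g1.skewD.1 v a, g1.skewD.1 v b,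
    g2.skewD.1 v a, g2.skewD.1 v b] at k2
  have n1 := g1.ne ha' hw' h1
  have n2 := g1.ne hb' hw' h2
  field_simp at k2
  linear_combination -k2

theorem Pair.ratio (h : Pair f W v a b T D₁ D₂) (hv : v ∉ W) (ha : a ∈ W) (hb : b ∈ W)
    (hab : Conn W T.B a b) : D₂ v a * D₁ v b = D₂ v b * D₁ v a := by
  have mem : ∀ {i}, i ∈ W → i ∈ insert v W := fun h => Set.mem_insert_of_mem _ h
  have hv' : v ∈ insert v W := Set.mem_insert _ _
  have hc := h.lift₁.good.rel.compat
  have hside : T.side a = T.side b := hc.side_eq (mem ha) hv' (mem hb)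
    (by rw [Ne, hc.skewB.comm_zero]; exact h.left) (by rw [Ne, hc.skewB.comm_zero]; exact h.right)
  obtain ⟨n, hn⟩ := (hab.exists_dwalk fun i hi j hj => hc.bip i (mem hi) j (mem hj)).1 hside
  refine walk_induction (X := Model E L × (E → E → L') × (E → E → L')) (fun t => t.1.B)
    (fun t => t.1.side)
    (fun t x y => (t.1.piv x y, piv t.2.1 x y, piv t.2.2 x y))
    (fun t => Pair f W v a b t.1 t.2.1 t.2.2)
    (fun t => t.2.2 v a * t.2.1 v b = t.2.2 v b * t.2.1 v a) v v
    (fun _ _ _ => rfl) (fun t ht => ht.lift₁.good.rel.compat.skewB)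
    (fun t ht i hi j hj => ht.lift₁.good.rel.compat.bip i (mem hi) j (mem hj)) ha hb ?_ ?_ ?_ ?_
    n (T, D₁, D₂) h hn
  · rintro rfl ⟨T, D₁, D₂⟩ -; rfl
  · rintro ⟨T, D₁, D₂⟩ h w hw h1 h2
    exact h.ratio_of_common ha hb hw h1 (by rwa [Ne, h.lift₁.good.rel.compat.skewB.comm_zero])
  · rintro ⟨T, D₁, D₂⟩ h w₁ hw₁ c hc w₂ hw₂ h1 h2 h3 h4 - - h7
    have hB := h.lift₁.good.rel.compat.skewB
    have hvc : T.B v c ≠ 0 := h7.elim id id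
    have p1 : Pair f W v a c T D₁ D₂ := ⟨h.lift₁, h.lift₂, h.eq, h.left, hvc⟩
    have p2 : Pair f W v c b T D₁ D₂ := ⟨h.lift₁, h.lift₂, h.eq, hvc, h.right⟩
    have e1 := p1.ratio_of_common ha hc hw₁ h1 (by rwa [Ne, hB.comm_zero])
    have e2 := p2.ratio_of_common hc hb hw₂ h3 (by rwa [Ne, hB.comm_zero])
    have n1 := h.lift₁.good.ne hv' (mem hc) hvc
    have n2 := h.lift₂.good.ne hv' (mem hc) hvc
    refine mul_left_cancel₀ (mul_ne_zero n1 n2) ?_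
    simp only
    linear_combination (D₂ v c * D₁ v b) * e1 + (D₂ v c * D₁ v a) * e2
  · rintro ⟨T, D₁, D₂⟩ h x hx y hy hxy hxa hxb hs hz
    have hc := h.lift₁.good.rel.compat
    have hvx : v ≠ x := by rintro rfl; exact hv hx
    have hvy : v ≠ y := by rintro rfl; exact hv hy
    have s1 := hc.bip v hv' a (mem ha) h.left
    have s2 := hc.bip v hv' b (mem hb) h.right
    have hsab := bool_side s1.symm s2
    have zero : ∀ c ∈ W, x ≠ c → T.side x = T.side c → (T.B c y = 0 ∨ T.B v x = 0) →
        (piv T.B x y v c = T.B v c ∧ piv D₁ x y v c = D₁ v c) ∧ piv D₂ x y v c = D₂ v c := by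
      intro c hcW hxc hs hz
      have hcy : c ≠ y := by
        rintro rfl
        exact hc.bip x (mem hx) c (mem hcW) hxy hs
      have z1 := hc.zero (mem hx) (mem hcW) hs
      have z2 : T.B v x * T.B y c = 0 := by
        rcases hz with hz | hz
        · rw [hc.skewB.comm_zero.1 hz, mul_zero]
        · rw [hz, zero_mul]
      have tr : ∀ {D}, Lift f (insert v W) (insert v W) T D → D v x * D y c = 0 ∧ D x c = 0 := by
        intro D hD
        refine ⟨?_, (hD.good.supp x (mem hx) c (mem hcW)).1 z1⟩
        rcases mul_eq_zero.1 z2 with hz | hz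
        · rw [(hD.good.supp v hv' x (mem hx)).1 hz, zero_mul]
        · rw [(hD.good.supp y (mem hy) c (mem hcW)).1 hz, mul_zero]
      refine ⟨⟨?_, ?_⟩, ?_⟩
      · exact piv_unchanged hvx hvy hxc.symm hcy z2 (by rw [show T.B x c = 0 from z1, mul_zero])
      · exact piv_unchanged hvx hvy hxc.symm hcy (tr h.lift₁).1 (mul_eq_zero_of_right _ (tr h.lift₁).2)
      · exact piv_unchanged hvx hvy hxc.symm hcy (tr h.lift₂).1 (mul_eq_zero_of_right _ (tr h.lift₂).2)
    obtain ⟨⟨a1, a2⟩, a3⟩ := zero a ha hxa hs (hz.imp And.left And.left)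
    obtain ⟨⟨b1, b2⟩, b3⟩ := zero b hb hxb (hs.trans hsab) (hz.imp And.right And.left)
    refine ⟨⟨h.lift₁.piv (mem hx) (mem hy) hxy, h.lift₂.piv (mem hx) (mem hy) hxy,
      piv_congr h.eq hx hy, ?_, ?_⟩, ?_⟩
    · rw [Model.piv_B, a1]; exact h.left
    · rw [Model.piv_B, b1]; exact h.right
    · simp only [a2, a3, b2, b3]; exact id

/-- Lifts on finite sets are unique up to scaling. -/
theorem Lift.unique (hF : F.Finite) : ∀ {D₁ D₂ : E → E → L'}, Lift f F F T D₁ → Lift f F F T D₂ →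
    ∃ r : E → L', (∀ i, r i ≠ 0) ∧ ∀ i ∈ F, ∀ j ∈ F, D₂ i j = TernaryLift.scale r D₁ i j := by
  classical
  induction F, hF using Set.Finite.induction_on with
  | empty => exact fun _ _ => ⟨fun _ => 1, fun _ => one_ne_zero, by simp⟩
  | @insert v W hv hW ih =>
    intro D₁ D₂ h1 h2
    have hsub : W ⊆ insert v W := Set.subset_insert _ _
    obtain ⟨r, hr, hrD⟩ := ih (h1.mono hsub hsub) (h2.mono hsub hsub)
    have h1' := h1.scale subset_rfl hr
    suffices ∃ s : E → L', (∀ i, s i ≠ 0) ∧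
        ∀ i ∈ insert v W, ∀ j ∈ insert v W, D₂ i j = TernaryLift.scale s (TernaryLift.scale r D₁) i j by
      obtain ⟨s, hs, hsD⟩ := this
      refine ⟨fun i => s i * r i, fun i => mul_ne_zero (hs i) (hr i), ?_⟩
      simpa only [scale_scale] using hsD
    generalize TernaryLift.scale r D₁ = D₁ at h1' hrD
    have mem : ∀ {i}, i ∈ W → i ∈ insert v W := fun h => hsub h
    have hv' : v ∈ insert v W := Set.mem_insert _ _
    have hc := h1'.good.rel.compat
    let g : E → L' := fun i =>
      if h : ∃ a ∈ W, T.B v a ≠ 0 ∧ Conn W T.B i a then D₂ v h.choose / D₁ v h.choose else 1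
    have hg : ∀ i, g i ≠ 0 := by
      intro i
      by_cases h : ∃ a ∈ W, T.B v a ≠ 0 ∧ Conn W T.B i a
      · simp only [g, dif_pos h]
        obtain ⟨h3, h4, -⟩ := h.choose_spec
        exact div_ne_zero (h2.good.ne hv' (mem h3) h4) (h1'.good.ne hv' (mem h3) h4)
      · simp [g, dif_neg h]
    have hg1 : ∀ a ∈ W, T.B v a ≠ 0 → D₂ v a = g a * D₁ v a := by
      intro a ha hva
      have h : ∃ b ∈ W, T.B v b ≠ 0 ∧ Conn W T.B a b := ⟨a, ha, hva, .refl⟩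
      obtain ⟨h3, h4, h5⟩ := h.choose_spec
      have := Pair.ratio ⟨h1', h2, fun i hi j hj => (hrD i hi j hj).symm, hva, h4⟩ hv ha h3 h5
      have n1 := h1'.good.ne hv' (mem h3) h4
      simp only [g, dif_pos h]
      field_simp
      linear_combination this
    have hg2 : ∀ a ∈ W, ∀ b ∈ W, T.B a b ≠ 0 → g a = g b := by
      intro a ha b hb hab
      have cab : Conn W T.B a b := .single ha hb hab
      have cba := cab.symm hc.skewB
      by_cases h : ∃ c ∈ W, T.B v c ≠ 0 ∧ Conn W T.B a c
      · obtain ⟨c, h3, h4, h5⟩ := id h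
        have h' : ∃ c ∈ W, T.B v c ≠ 0 ∧ Conn W T.B b c := ⟨c, h3, h4, cba.trans h5⟩
        obtain ⟨k3, k4, k5⟩ := h.choose_spec
        obtain ⟨l3, l4, l5⟩ := h'.choose_spec
        have := Pair.ratio ⟨h1', h2, fun i hi j hj => (hrD i hi j hj).symm, k4, l4⟩ hv k3 l3
          ((k5.symm hc.skewB).trans (cab.trans l5))
        have n1 := h1'.good.ne hv' (mem k3) k4
        have n2 := h1'.good.ne hv' (mem l3) l4
        simp only [g, dif_pos h, dif_pos h']
        rw [div_eq_div_iff n1 n2]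
        exact this
      · have h' : ¬ ∃ c ∈ W, T.B v c ≠ 0 ∧ Conn W T.B b c := by
          rintro ⟨c, h3, h4, h5⟩
          exact h ⟨c, h3, h4, cab.trans h5⟩
        simp only [g, dif_neg h, dif_neg h']
    let s : E → L' := fun i => if i = v then 1 else if T.side i = T.side v then (g i)⁻¹ else g i
    have hs : ∀ i, s i ≠ 0 := by
      intro i
      simp only [s]
      split_ifs
      · exact one_ne_zero
      · exact inv_ne_zero (hg i)
      · exact hg i
    have hs1 : ∀ a ∈ W, D₂ v a = TernaryLift.scale s D₁ v a := by
      intro a ha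
      by_cases hva : T.B v a = 0
      · simp [TernaryLift.scale, (h2.good.supp v hv' a (mem ha)).1 hva,
          (h1'.good.supp v hv' a (mem ha)).1 hva]
      · have hav : a ≠ v := by rintro rfl; exact hv ha
        have hsd := (hc.bip v hv' a (mem ha) hva).symm
        simp only [TernaryLift.scale, s, if_neg hav, if_true, if_neg hsd, one_mul]
        exact hg1 a ha hva
    refine ⟨s, hs, ?_⟩
    rintro i (rfl | hi) j (rfl | hj)
    · simp [TernaryLift.scale, h2.good.skewD.2, h1'.good.skewD.2]
    · exact hs1 j hj
    · rw [h2.good.skewD.1 _ i, (h1'.good.skewD.scale s).1 _ i, hs1 i hi]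
    · by_cases hij : T.B i j = 0
      · simp [TernaryLift.scale, (h2.good.supp i (mem hi) j (mem hj)).1 hij,
          (h1'.good.supp i (mem hi) j (mem hj)).1 hij]
      · have hiv : i ≠ v := by rintro rfl; exact hv hi
        have hjv : j ≠ v := by rintro rfl; exact hv hj
        have hsd := hc.bip i (mem hi) j (mem hj) hij
        have hgi := hg i
        have hgj := hg2 i hi j hj hij
        have : s i * s j = 1 := by
          simp only [s, if_neg hiv, if_neg hjv, ← hgj]
          by_cases h3 : T.side i = T.side v
          · rw [if_pos h3, if_neg (h3 ▸ hsd.symm), inv_mul_cancel₀ hgi]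
          · rw [if_neg h3, if_pos (bool_side hsd.symm h3), mul_inv_cancel₀ hgi]
        simp only [TernaryLift.scale]
        rw [this, one_mul, hrD i hi j hj]

end

section


variable {E L L' : Type*} [Field L] [Field L'] {f : L → L'} {W F : Set E} {T : Model E L}
  {D : E → E → L'}

section Small

theorem mem_of_ncard_le_four (hF : F.Finite) (h : F.ncard ≤ 4) {i k j l : E} (hi : i ∈ F)
    (hk : k ∈ F) (hj : j ∈ F) (hl : l ∈ F) (hik : i ≠ k) (hij : i ≠ j) (hil : i ≠ l) (hkj : k ≠ j)
    (hkl : k ≠ l) (hjl : j ≠ l) {x : E} (hx : x ∈ F) : x = i ∨ x = k ∨ x = j ∨ x = l := by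
  classical
  have hs : (({i, k, j, l} : Finset E) : Set E) ⊆ F := by
    intro y hy
    simp only [Finset.coe_insert, Finset.coe_singleton, Set.mem_insert_iff,
      Set.mem_singleton_iff] at hy
    rcases hy with rfl | rfl | rfl | rfl <;> assumption
  have hc : (({i, k, j, l} : Finset E) : Set E).ncard = 4 := by
    rw [Set.ncard_coe_finset]
    simp [Finset.card_insert_of_notMem, *]
  have := Set.eq_of_subset_of_ncard_le hs (by rw [hc]; exact h) hF
  rw [← this] at hx
  simpa using hx

theorem Full.distinct (hB : Skew T.B) {i k j l : E} (hF : Full T.B i k j l) :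
    i ≠ j ∧ i ≠ l ∧ k ≠ j ∧ k ≠ l := by
  obtain ⟨h1, h2, h3, h4⟩ := hF
  refine ⟨?_, ?_, ?_, ?_⟩ <;> rintro rfl
  · exact h1 (hB.2 _)
  · exact h2 (hB.2 _)
  · exact h3 (hB.2 _)
  · exact h4 (hB.2 _)

theorem Good.piv_of_small (hf : CrMap f) (hfin : F.Finite) (hF : F.ncard ≤ 4) (h : Good f F T D)
    {x y : E} (hx : x ∈ F) (hy : y ∈ F) (hxy : T.B x y ≠ 0) : Good f F (T.piv x y) (TernaryLift.piv D x y) := by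
  have hr := h.rel.piv hx hy hxy
  have hc := hr.compat
  have sup : ∀ i ∈ F, ∀ j ∈ F, ((T.piv x y).B i j = 0 ↔ piv D x y i j = 0) :=
    fun i hi j hj => h.supp_piv hf hx hy hi hj hxy
  refine ⟨hr, h.skewD.piv _ _, sup, ?_⟩
  intro i hi k hk j hj l hl hQ
  have ne : ∀ i ∈ F, ∀ j ∈ F, (T.piv x y).B i j ≠ 0 → piv D x y i j ≠ 0 :=
    fun i hi j hj h' h'' => h' ((sup i hi j hj).2 h'')
  obtain ⟨q1, q2, q3, q4⟩ := id hQ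
  by_cases hik : i = k
  · subst hik
    exact hQ.crOk_of_row_eq hf (ne i hi j hj q1) (ne i hi l hl q2)
  by_cases hjl : j = l
  · subst hjl
    exact hQ.crOk_of_col_eq hf (ne i hi j hj q1) (ne k hk j hj q3)
  obtain ⟨d1, d2, d3, d4⟩ := hQ.distinct hc.skewB
  have mx := mem_of_ncard_le_four hfin hF hi hk hj hl hik d1 d2 d3 d4 hjl hx
  have my := mem_of_ncard_le_four hfin hF hi hk hj hl hik d1 d2 d3 d4 hjl hy
  have sxy := hc.bip x hx y hy (piv_self_ne h.rel.compat.skewB hxy)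
  have s1 := hc.bip i hi j hj q1
  have s2 := hc.bip i hi l hl q2
  have s3 := hc.bip k hk j hj q3
  have sik := bool_side s1 s3.symm
  have sjl := bool_side s1.symm s2
  refine h.ok_piv' hf hx hy hi hk hj hl hxy hQ ?_
  rcases mx with rfl | rfl | rfl | rfl <;> rcases my with rfl | rfl | rfl | rfl <;>
    simp_all

theorem Good.lift_of_small (hf : CrMap f) (hfin : F.Finite) (hF : F.ncard ≤ 4)
    (h : Good f F T D) : Lift f F F T D :=
  ⟨Good f F, h, fun _ _ h => ⟨h, fun _ hx _ hy hxy => h.piv_of_small hf hfin hF hx hy hxy⟩⟩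

/-- The skew matrix with the support of `T.B` on `F` and symmetric weights. -/
noncomputable def weighted (F : Set E) (T : Model E L) (w : E → E → L') : E → E → L' := fun i j =>
  open Classical in
  if i ∈ F ∧ j ∈ F ∧ T.B i j ≠ 0 then (if T.side i then w i j else -w i j) else 0

theorem Compat.skew_weighted (hc : Compat F T) {w : E → E → L'} (hw : ∀ i j, w i j = w j i) :
    Skew (weighted F T w) := by
  constructor
  · intro i j
    simp only [weighted]
    by_cases h : i ∈ F ∧ j ∈ F ∧ T.B i j ≠ 0
    · have h' : j ∈ F ∧ i ∈ F ∧ T.B j i ≠ 0 :=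
        ⟨h.2.1, h.1, by rw [Ne, hc.skewB.comm_zero]; exact h.2.2⟩
      rw [if_pos h, if_pos h', hw j i]
      have := hc.bip i h.1 j h.2.1 h.2.2
      revert this
      cases T.side i <;> cases T.side j <;> simp
    · have h' : ¬ (j ∈ F ∧ i ∈ F ∧ T.B j i ≠ 0) := fun h' =>
        h ⟨h'.2.1, h'.1, by rw [Ne, hc.skewB.comm_zero]; exact h'.2.2⟩
      rw [if_neg h, if_neg h', neg_zero]
  · intro i
    simp [weighted, hc.skewB.2]

theorem weighted_eq_zero {w : E → E → L'} (hw : ∀ i j, w i j ≠ 0) {i j : E} (hi : i ∈ F)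
    (hj : j ∈ F) : T.B i j = 0 ↔ weighted F T w i j = 0 := by
  by_cases h : T.B i j = 0
  · simp [weighted, h]
  · simp only [h, weighted, hi, hj, Ne, not_false_eq_true, and_self, if_true]
    split_ifs <;> simp [hw]

theorem cr_weighted (hc : Compat F T) {w : E → E → L'} {i k j l : E} (hi : i ∈ F) (hk : k ∈ F)
    (hj : j ∈ F) (hl : l ∈ F) (hF : Full T.B i k j l) :
    cr (weighted F T w) i k j l = cr w i k j l := by
  obtain ⟨h1, h2, h3, h4⟩ := hF
  have s := bool_side (hc.bip i hi j hj h1) (hc.bip k hk j hj h3).symm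
  simp only [cr, weighted, hi, hj, hk, hl, h1, h2, h3, h4, s, Ne, not_false_eq_true, and_self,
    if_true]
  split_ifs <;> ring

theorem Rel.exists_good_of_small (hf : CrMap f) (hfin : F.Finite) (hF : F.ncard ≤ 4)
    (h : Rel F T) : ∃ D : E → E → L', Good f F T D := by
  classical
  have hc := h.compat
  suffices ∃ w : E → E → L', (∀ i j, w i j = w j i) ∧ (∀ i j, w i j ≠ 0) ∧
      ∀ i ∈ F, ∀ k ∈ F, ∀ j ∈ F, ∀ l ∈ F, Full T.B i k j l → i ≠ k → j ≠ l →
        CrOk f T.B (weighted F T w) i k j l by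
    obtain ⟨w, h1, h2, h3⟩ := this
    have ne : ∀ i ∈ F, ∀ j ∈ F, T.B i j ≠ 0 → weighted F T w i j ≠ 0 :=
      fun i hi j hj h' h'' => h' ((weighted_eq_zero h2 hi hj).2 h'')
    refine ⟨weighted F T w, h, hc.skew_weighted h1, fun i hi j hj => weighted_eq_zero h2 hi hj, ?_⟩
    intro i hi k hk j hj l hl hQ
    by_cases hik : i = k
    · subst hik
      exact hQ.crOk_of_row_eq hf (ne i hi j hj hQ.1) (ne i hi l hl hQ.2.1)
    by_cases hjl : j = l
    · subst hjl
      exact hQ.crOk_of_col_eq hf (ne i hi j hj hQ.1) (ne k hk j hj hQ.2.2.1)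
    exact h3 i hi k hk j hj l hl hQ hik hjl
  by_cases hex : ∃ i ∈ F, ∃ k ∈ F, ∃ j ∈ F, ∃ l ∈ F, Full T.B i k j l ∧ i ≠ k ∧ j ≠ l
  · obtain ⟨i₀, hi₀, k₀, hk₀, j₀, hj₀, l₀, hl₀, hQ₀, hik₀, hjl₀⟩ := hex
    obtain ⟨d1, d2, d3, d4⟩ := hQ₀.distinct hc.skewB
    set c := f (cr T.B i₀ k₀ j₀ l₀) with hcdef
    have hc0 : c ≠ 0 := by
      rw [hcdef, Ne, hf.eq_zero_iff]
      exact div_ne_zero (mul_ne_zero hQ₀.1 hQ₀.2.2.2) (mul_ne_zero hQ₀.2.1 hQ₀.2.2.1)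
    let w : E → E → L' := fun i j => if (i = i₀ ∧ j = j₀) ∨ (j = i₀ ∧ i = j₀) then c else 1
    have hw : ∀ i j, w i j = w j i := fun i j => by simp only [w, or_comm]
    have hsk := hc.skew_weighted (F := F) hw
    have main : CrOk f T.B (weighted F T w) i₀ k₀ j₀ l₀ := by
      rw [CrOk, cr_weighted hc hi₀ hk₀ hj₀ hl₀ hQ₀, ← hcdef]
      simp [cr, w, hjl₀.symm, hik₀.symm, d1, d3, d1.symm, d2.symm]
    refine ⟨w, hw, fun i j => ?_, ?_⟩
    · simp only [w]; split_ifs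
      · exact hc0
      · exact one_ne_zero
    · intro i hi k hk j hj l hl hQ hik hjl
      have key : ∀ i ∈ F, ∀ k ∈ F, ∀ j ∈ F, ∀ l ∈ F, Full T.B i k j l → i ≠ k → j ≠ l →
          T.side i = T.side i₀ → CrOk f T.B (weighted F T w) i k j l := by
        intro i hi k hk j hj l hl hQ hik hjl hs
        have s1 := hc.bip i hi j hj hQ.1
        have s2 := hc.bip i hi l hl hQ.2.1
        have s3 := hc.bip k hk j hj hQ.2.2.1
        have t1 := hc.bip i₀ hi₀ j₀ hj₀ hQ₀.1
        have t2 := hc.bip i₀ hi₀ l₀ hl₀ hQ₀.2.1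
        have t3 := hc.bip k₀ hk₀ j₀ hj₀ hQ₀.2.2.1
        have mem : ∀ {x}, x ∈ F → x = i₀ ∨ x = k₀ ∨ x = j₀ ∨ x = l₀ := fun hx =>
          mem_of_ncard_le_four hfin hF hi₀ hk₀ hj₀ hl₀ hik₀ d1 d2 d3 d4 hjl₀ hx
        have mi : i = i₀ ∨ i = k₀ := by
          rcases mem hi with rfl | rfl | rfl | rfl <;> simp_all
        have mk : k = i₀ ∨ k = k₀ := by
          have s := bool_side s1 s3.symm
          rcases mem hk with rfl | rfl | rfl | rfl <;> simp_all
        have mj : j = j₀ ∨ j = l₀ := by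
          have s := bool_side t1 t3.symm
          rcases mem hj with rfl | rfl | rfl | rfl <;> simp_all
        have ml : l = j₀ ∨ l = l₀ := by
          have s := bool_side t1 t3.symm
          rcases mem hl with rfl | rfl | rfl | rfl <;> simp_all
        rcases mi with rfl | rfl <;> rcases mk with rfl | rfl <;>
          first | exact absurd rfl hik | skip
        all_goals
          rcases mj with rfl | rfl <;> rcases ml with rfl | rfl <;>
            first | exact absurd rfl hjl | skip
        · exact main
        · exact main.cols hf
        · exact main.rows hf
        · exact (main.rows hf).cols hf
      by_cases hs : T.side i = T.side i₀
      · exact key i hi k hk j hj l hl hQ hik hjl hs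
      · have hs' : T.side j = T.side i₀ := bool_side (hc.bip i hi j hj hQ.1).symm hs
        exact (key j hj l hl i hi k hk (hQ.transpose hc.skewB) hjl hik hs').transpose
          hc.skewB hsk
  · refine ⟨fun _ _ => 1, fun _ _ => rfl, fun _ _ => one_ne_zero, ?_⟩
    intro i hi k hk j hj l hl hQ hik hjl
    exact (hex ⟨i, hi, k, hk, j, hj, l, hl, hQ, hik, hjl⟩).elim

end Small

section Blocks

theorem piv_eq_of_zero {K : Type*} [Field K] {N : E → E → K} {x y j : E} (hjx : j ≠ x)
    (hjy : j ≠ y) (h1 : N x j = 0) (h2 : N y j = 0) (i : E) : piv N x y i j = N i j := by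
  rw [piv_def, h1, h2, delta_ne hjx.symm, delta_ne hjy.symm]
  simp

theorem Lift.congr_model (h : Lift f W F T D) (hW : W ⊆ F) {T' : Model E L} {D' : E → E → L'}
    (hT : Rel F T') (hD : Skew D') (hB : ∀ i ∈ F, ∀ j ∈ F, T.B i j = T'.B i j)
    (he : ∀ i ∈ F, ∀ j ∈ F, D i j = D' i j) : Lift f W F T' D' := by
  refine ⟨fun T' D' => Rel F T' ∧ Skew D' ∧ ∃ T D, Lift f W F T D ∧
    (∀ i ∈ F, ∀ j ∈ F, T.B i j = T'.B i j) ∧ ∀ i ∈ F, ∀ j ∈ F, D i j = D' i j,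
    ⟨hT, hD, T, D, h, hB, he⟩, ?_⟩
  rintro T' D' ⟨hT, hD, T, D, h, hB, he⟩
  refine ⟨⟨hT, hD, ?_, ?_⟩, ?_⟩
  · intro i hi j hj
    rw [← hB i hi j hj, ← he i hi j hj]
    exact h.good.supp i hi j hj
  · intro i hi k hk j hj l hl hF
    have := h.good.ok i hi k hk j hj l hl (by
      simpa only [Full, hB i hi j hj, hB i hi l hl, hB k hk j hj, hB k hk l hl] using hF)
    simp only [CrOk, cr] at this ⊢
    rwa [hB i hi j hj, hB i hi l hl, hB k hk j hj, hB k hk l hl, he i hi j hj, he i hi l hl,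
      he k hk j hj, he k hk l hl] at this
  · intro x hx y hy hxy
    exact ⟨hT.piv (hW hx) (hW hy) hxy, hD.piv _ _, T.piv x y, TernaryLift.piv D x y,
      h.piv hx hy (by rwa [hB x (hW hx) y (hW hy)]), piv_congr hB (hW hx) (hW hy),
      piv_congr he (hW hx) (hW hy)⟩

/-- A lift made of two blocks. -/
structure Blocks (f : L → L') (F G : Set E) (T : Model E L) (D : E → E → L') : Prop where
  rel : Rel (F ∪ G) T
  skewD : Skew D
  left : Lift f F F T D
  right : Lift f G G T D
  disj : Disjoint F G
  zeroB : ∀ i ∈ F, ∀ j ∈ G, T.B i j = 0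
  zeroD : ∀ i ∈ F, ∀ j ∈ G, D i j = 0

variable {G : Set E}

theorem Blocks.symm (h : Blocks f F G T D) : Blocks f G F T D :=
  ⟨Set.union_comm F G ▸ h.rel, h.skewD, h.right, h.left, h.disj.symm,
    fun i hi j hj => h.rel.compat.skewB.comm_zero.1 (h.zeroB j hj i hi),
    fun i hi j hj => h.skewD.comm_zero.1 (h.zeroD j hj i hi)⟩

theorem Blocks.piv (h : Blocks f F G T D) {x y : E} (hx : x ∈ F) (hy : y ∈ F)
    (hxy : T.B x y ≠ 0) : Blocks f F G (T.piv x y) (TernaryLift.piv D x y) := by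
  have ne : ∀ {j}, j ∈ G → ∀ {z}, z ∈ F → j ≠ z := fun hj z hz h' =>
    Set.disjoint_left.1 h.disj hz (h' ▸ hj)
  have hB : ∀ i, ∀ j ∈ G, TernaryLift.piv T.B x y i j = T.B i j := fun i j hj =>
    piv_eq_of_zero (ne hj hx) (ne hj hy) (h.zeroB x hx j hj) (h.zeroB y hy j hj) i
  have hD : ∀ i, ∀ j ∈ G, TernaryLift.piv D x y i j = D i j := fun i j hj =>
    piv_eq_of_zero (ne hj hx) (ne hj hy) (h.zeroD x hx j hj) (h.zeroD y hy j hj) i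
  have hr := h.rel.piv (.inl hx) (.inl hy) hxy
  have hs := h.skewD.piv x y
  refine ⟨hr, hs, h.left.piv hx hy hxy, ?_, h.disj, ?_, ?_⟩
  · exact h.right.congr_model subset_rfl (hr.mono Set.subset_union_right) hs
      (fun i _ j hj => (hB i j hj).symm) fun i _ j hj => (hD i j hj).symm
  · intro i hi j hj
    rw [Model.piv_B, hB i j hj]
    exact h.zeroB i hi j hj
  · intro i hi j hj
    rw [hD i j hj]
    exact h.zeroD i hi j hj

theorem Blocks.good (h : Blocks f F G T D) : Good f (F ∪ G) T D := by
  have hB := h.rel.compat.skewB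
  have zB := h.zeroB
  have zB' := h.symm.zeroB
  refine ⟨h.rel, h.skewD, ?_, ?_⟩
  · rintro i (hi | hi) j (hj | hj)
    · exact h.left.good.supp i hi j hj
    · exact ⟨fun _ => h.zeroD i hi j hj, fun _ => h.zeroB i hi j hj⟩
    · exact ⟨fun _ => h.symm.zeroD i hi j hj, fun _ => h.symm.zeroB i hi j hj⟩
    · exact h.right.good.supp i hi j hj
  · rintro i (hi | hi) k hk j hj l hl ⟨h1, h2, h3, h4⟩
    · have hj' := hj.resolve_right fun hj => h1 (zB i hi j hj)
      have hl' := hl.resolve_right fun hl => h2 (zB i hi l hl)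
      have hk' := hk.resolve_right fun hk => h3 (zB' k hk j hj')
      exact h.left.good.ok i hi k hk' j hj' l hl' ⟨h1, h2, h3, h4⟩
    · have hj' := hj.resolve_left fun hj => h1 (zB' i hi j hj)
      have hl' := hl.resolve_left fun hl => h2 (zB' i hi l hl)
      have hk' := hk.resolve_left fun hk => h3 (zB k hk j hj')
      exact h.right.good.ok i hi k hk' j hj' l hl' ⟨h1, h2, h3, h4⟩

theorem Blocks.lift (h : Blocks f F G T D) : Lift f (F ∪ G) (F ∪ G) T D := by
  refine ⟨Blocks f F G, h, fun T D h => ⟨h.good, ?_⟩⟩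
  rintro x (hx | hx) y (hy | hy) hxy
  · exact h.piv hx hy hxy
  · exact (hxy (h.zeroB x hx y hy)).elim
  · exact (hxy (h.symm.zeroB x hx y hy)).elim
  · exact (h.symm.piv hx hy hxy).symm

theorem exists_lift_union (hT : Rel (F ∪ G) T) (hd : Disjoint F G)
    (hz : ∀ i ∈ F, ∀ j ∈ G, T.B i j = 0) {D₁ D₂ : E → E → L'} (h1 : Lift f F F T D₁)
    (h2 : Lift f G G T D₂) : ∃ D, Lift f (F ∪ G) (F ∪ G) T D := by
  classical
  let D : E → E → L' := fun i j =>
    if i ∈ F ∧ j ∈ F then D₁ i j else if i ∈ G ∧ j ∈ G then D₂ i j else 0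
  have e1 : ∀ i ∈ F, ∀ j ∈ F, D₁ i j = D i j := fun i hi j hj => by simp [D, hi, hj]
  have e2 : ∀ i ∈ G, ∀ j ∈ G, D₂ i j = D i j := fun i hi j hj => by
    simp [D, hi, hj, Set.disjoint_right.1 hd hi]
  have sD : Skew D := by
    refine ⟨fun i j => ?_, fun i => ?_⟩
    · simp only [D, and_comm (a := j ∈ F), and_comm (a := j ∈ G)]
      split_ifs
      · exact h1.good.skewD.1 i j
      · exact h2.good.skewD.1 i j
      · simp
    · simp [D, h1.good.skewD.2, h2.good.skewD.2]
  refine ⟨D, Blocks.lift ⟨hT, sD, h1.congr subset_rfl sD e1, h2.congr subset_rfl sD e2, hd, hz, ?_⟩⟩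
  intro i hi j hj
  simp [D, Set.disjoint_right.1 hd hj, Set.disjoint_left.1 hd hi]

end Blocks

end

section


variable {E L L' : Type*} [Field L] [Field L'] {f : L → L'} {W F : Set E} {T : Model E L}
  {D : E → E → L'} {N : E → E → L}

/-- All elements of `F` are connected to one another in `F`. -/
def IsConn (F : Set E) (N : E → E → L) : Prop := ∀ a ∈ F, ∀ b ∈ F, Conn F N a b

theorem IsConn.exists_edge (h : IsConn F N) {S : Set E} (hS : S ⊆ F) (hne : S.Nonempty)
    (hSF : ¬ F ⊆ S) : ∃ s ∈ S, ∃ t ∈ F, t ∉ S ∧ N s t ≠ 0 := by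
  obtain ⟨b, hbF, hbS⟩ := Set.not_subset.1 hSF
  obtain ⟨a, ha⟩ := hne
  by_contra hno
  push Not at hno
  have key : ∀ c, Conn F N a c → c ∈ S := by
    intro c hc
    induction hc with
    | refl => exact ha
    | tail _ h' ih =>
      by_contra h''
      exact h'.2.2 (hno _ ih _ h'.2.1 h'')
  exact hbS (key b (h a (hS ha) b hbF))

theorem IsConn.insert (hN : Skew N) {C : Set E} (h : IsConn C N) {s t : E} (hs : s ∈ C)
    (hst : N s t ≠ 0) : IsConn (insert t C) N := by
  have hsub := Set.subset_insert t C
  have e1 : ∀ a ∈ C, Conn (Insert.insert t C) N a t := fun a ha =>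
    ((h a ha s hs).mono hsub).trans (Conn.single (hsub hs) (Set.mem_insert _ _) hst)
  rintro a (rfl | ha) b (rfl | hb)
  · exact .refl
  · exact (e1 b hb).symm hN
  · exact e1 a ha
  · exact (h a ha b hb).mono hsub

/-- A connected core together with three pendant elements. -/
structure Tripod (F : Set E) (N : E → E → L) (C : Set E) (a b c : E) : Prop where
  sub : C ⊆ F
  conn : IsConn C N
  memF : a ∈ F ∧ b ∈ F ∧ c ∈ F
  notMem : a ∉ C ∧ b ∉ C ∧ c ∉ C
  ne : a ≠ b ∧ a ≠ c ∧ b ≠ c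
  na : ∃ s ∈ C, N s a ≠ 0
  nb : ∃ s ∈ C, N s b ≠ 0
  nc : ∃ s ∈ C, N s c ≠ 0

namespace Tripod

variable {C : Set E} {a b c : E}

theorem rotate (h : Tripod F N C a b c) : Tripod F N C b c a :=
  ⟨h.sub, h.conn, ⟨h.memF.2.1, h.memF.2.2, h.memF.1⟩, ⟨h.notMem.2.1, h.notMem.2.2, h.notMem.1⟩,
    ⟨h.ne.2.2, h.ne.1.symm, h.ne.2.1.symm⟩, h.nb, h.nc, h.na⟩

theorem shift (hN : Skew N) (h : Tripod F N C a b c) {t : E} (ht : t ∈ F) (htC : t ∉ C)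
    (hta : t ≠ a) (htb : t ≠ b) (htc : t ≠ c) (hat : N a t ≠ 0) :
    Tripod F N (insert a C) t b c := by
  obtain ⟨s, hs, hsa⟩ := h.na
  refine ⟨Set.insert_subset h.memF.1 h.sub, h.conn.insert hN hs hsa, ⟨ht, h.memF.2⟩, ⟨?_, ?_, ?_⟩,
    ⟨htb, htc, h.ne.2.2⟩, ⟨a, Set.mem_insert _ _, hat⟩, ?_, ?_⟩
  · simp [hta, htC]
  · simp [h.ne.1.symm, h.notMem.2.1]
  · simp [h.ne.2.1.symm, h.notMem.2.2]
  · obtain ⟨s, hs, h'⟩ := h.nb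
    exact ⟨s, Set.mem_insert_of_mem _ hs, h'⟩
  · obtain ⟨s, hs, hsc⟩ := h.nc
    exact ⟨s, Set.mem_insert_of_mem _ hs, hsc⟩

theorem grow (hN : Skew N) (h : Tripod F N C a b c) {s t : E} (ht : t ∈ F)
    (hta : t ≠ a) (htb : t ≠ b) (htc : t ≠ c) (hs : s ∈ C) (hst : N s t ≠ 0) :
    Tripod F N (insert t C) a b c := by
  refine ⟨Set.insert_subset ht h.sub, h.conn.insert hN hs hst, h.memF, ⟨?_, ?_, ?_⟩, h.ne, ?_, ?_,
    ?_⟩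
  · simp [hta.symm, h.notMem.1]
  · simp [htb.symm, h.notMem.2.1]
  · simp [htc.symm, h.notMem.2.2]
  · obtain ⟨s, hs, h'⟩ := h.na
    exact ⟨s, Set.mem_insert_of_mem _ hs, h'⟩
  · obtain ⟨s, hs, h'⟩ := h.nb
    exact ⟨s, Set.mem_insert_of_mem _ hs, h'⟩
  · obtain ⟨s, hs, hsc⟩ := h.nc
    exact ⟨s, Set.mem_insert_of_mem _ hs, hsc⟩

/-- A tripod in a connected set grows to one that covers the set. -/
theorem exists_cover (hN : Skew N) (hF : F.Finite) (hc : IsConn F N) (h : Tripod F N C a b c) :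
    ∃ C a b c, Tripod F N C a b c ∧ F ⊆ insert a (insert b (insert c C)) := by
  by_contra hno
  push Not at hno
  have key : ∀ n : ℕ, ∃ C a b c, Tripod F N C a b c ∧ n ≤ C.ncard := by
    intro n
    induction n with
    | zero => exact ⟨C, a, b, c, h, Nat.zero_le _⟩
    | succ n ih =>
      obtain ⟨C, a, b, c, h, hn⟩ := ih
      have hfin := hF.subset h.sub
      have hS : insert a (insert b (insert c C)) ⊆ F :=
        Set.insert_subset h.memF.1 (Set.insert_subset h.memF.2.1
          (Set.insert_subset h.memF.2.2 h.sub))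
      obtain ⟨s, hs, t, ht, htS, hst⟩ := hc.exists_edge hS ⟨a, Set.mem_insert _ _⟩
        (hno C a b c h)
      simp only [Set.mem_insert_iff, not_or] at htS
      obtain ⟨hta, htb, htc, htC⟩ := htS
      have card : ∀ {x}, x ∉ C → n + 1 ≤ (insert x C).ncard := fun hx => by
        rw [Set.ncard_insert_of_notMem hx hfin]; omega
      rcases hs with rfl | rfl | rfl | hs
      · exact ⟨_, _, _, _, h.shift hN ht htC hta htb htc hst, card h.notMem.1⟩
      · exact ⟨_, _, _, _, h.rotate.shift hN ht htC htb htc hta hst, card h.notMem.2.1⟩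
      · exact ⟨_, _, _, _, h.rotate.rotate.shift hN ht htC htc hta htb hst, card h.notMem.2.2⟩
      · exact ⟨_, _, _, _, h.grow hN ht hta htb htc hs hst, card htC⟩
  obtain ⟨C, a, b, c, h, hn⟩ := key (F.ncard + 1)
  have := Set.ncard_le_ncard h.sub hF
  omega

/-- Two elements on the same side whose removal leaves a connected set. -/
theorem exists_pair (hN : Skew N) (hF : F.Finite) (hc : IsConn F N) (h : Tripod F N C a b c)
    (σ : E → Bool) : ∃ W u v, u ∉ W ∧ v ∉ W ∧ u ≠ v ∧ σ u = σ v ∧ IsConn W N ∧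
      F = insert u (insert v W) := by
  obtain ⟨C, a, b, c, h, hcov⟩ := h.exists_cover hN hF hc
  have main : ∀ {a b c}, Tripod F N C a b c → σ a = σ b → F ⊆ insert a (insert b (insert c C)) →
      ∃ W u v, u ∉ W ∧ v ∉ W ∧ u ≠ v ∧ σ u = σ v ∧ IsConn W N ∧ F = insert u (insert v W) := by
    intro a b c h hs hcov
    obtain ⟨s, hsC, hsc⟩ := h.nc
    refine ⟨insert c C, a, b, ?_, ?_, h.ne.1, hs, h.conn.insert hN hsC hsc, hcov.antisymm ?_⟩
    · simp [h.ne.2.1, h.notMem.1]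
    · simp [h.ne.2.2, h.notMem.2.1]
    · exact Set.insert_subset h.memF.1 (Set.insert_subset h.memF.2.1
        (Set.insert_subset h.memF.2.2 h.sub))
  by_cases h1 : σ a = σ b
  · exact main h h1 hcov
  by_cases h2 : σ b = σ c
  · refine main h.rotate h2 (hcov.trans fun x hx => ?_)
    simp only [Set.mem_insert_iff] at hx ⊢
    tauto
  · refine main h.rotate.rotate (bool_side h1 h2).symm (hcov.trans fun x hx => ?_)
    simp only [Set.mem_insert_iff] at hx ⊢
    tauto

theorem of_nbrs (hN : Skew N) {w : E} (hw : w ∈ F) (ha : a ∈ F) (hb : b ∈ F) (hc : c ∈ F)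
    (hab : a ≠ b) (hac : a ≠ c) (hbc : b ≠ c) (h1 : N w a ≠ 0) (h2 : N w b ≠ 0) (h3 : N w c ≠ 0) :
    Tripod F N {w} a b c := by
  have ne : ∀ {x}, N w x ≠ 0 → x ∉ ({w} : Set E) := by
    rintro x hx rfl
    exact hx (hN.2 _)
  refine ⟨by simpa using hw, ?_, ⟨ha, hb, hc⟩, ⟨ne h1, ne h2, ne h3⟩, ⟨hab, hac, hbc⟩,
    ⟨w, rfl, h1⟩, ⟨w, rfl, h2⟩, ⟨w, rfl, h3⟩⟩
  rintro a rfl b rfl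
  exact .refl

end Tripod

/-- After at most one pivot there is an element with three neighbours. -/
theorem Compat.exists_tripod (hc : Compat F T) (hconn : IsConn F T.B) (hF : ¬ F.ncard ≤ 4) :
    (∃ C a b c, Tripod F T.B C a b c) ∨ ∃ x ∈ F, ∃ y ∈ F, T.B x y ≠ 0 ∧
      ∃ C a b c, Tripod F (T.piv x y).B C a b c := by
  classical
  have hB := hc.skewB
  by_cases hno : ∃ C a b c, Tripod F T.B C a b c
  · exact .inl hno
  refine .inr ?_
  have deg : ∀ {w a b c}, w ∈ F → a ∈ F → b ∈ F → c ∈ F → a ≠ b → a ≠ c → b ≠ c →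
      T.B w a ≠ 0 → T.B w b ≠ 0 → T.B w c = 0 := by
    intro w a b c hw ha hb hc hab hac hbc h1 h2
    by_contra h3
    exact hno ⟨_, _, _, _, .of_nbrs hB hw ha hb hc hab hac hbc h1 h2 h3⟩
  have big : ∀ S : Finset E, S.card ≤ 4 → ¬ F ⊆ S := by
    intro S hS hFS
    have := Set.ncard_le_ncard hFS S.finite_toSet
    rw [Set.ncard_coe_finset] at this
    omega
  have swap : ∀ {x y}, T.B x y ≠ 0 → T.B y x ≠ 0 := fun h => by rwa [Ne, hB.comm_zero]
  have path5 : ∀ p₀ ∈ F, ∀ p₁ ∈ F, ∀ p₂ ∈ F, ∀ p₃ ∈ F, ∀ p₄ ∈ F, p₀ ≠ p₂ → p₀ ≠ p₄ → p₂ ≠ p₄ →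
      p₁ ≠ p₃ → T.B p₀ p₁ ≠ 0 → T.B p₁ p₂ ≠ 0 → T.B p₂ p₃ ≠ 0 → T.B p₃ p₄ ≠ 0 →
      ∃ x ∈ F, ∃ y ∈ F, T.B x y ≠ 0 ∧ ∃ C a b c, Tripod F (T.piv x y).B C a b c := by
    intro p₀ m₀ p₁ m₁ p₂ m₂ p₃ m₃ p₄ m₄ n02 n04 n24 n13 b1 b2 b3 b4
    have s13 := hc.side_eq m₁ m₂ m₃ b2 (swap b3)
    have s02 := hc.side_eq m₀ m₁ m₂ b1 (swap b2)
    have z31 : T.B p₃ p₁ = 0 := hc.zero m₃ m₁ s13.symm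
    have z30 : T.B p₃ p₀ = 0 := deg m₃ m₂ m₄ m₀ n24 n02.symm n04.symm (swap b3) b4
    have z14 : T.B p₁ p₄ = 0 := deg m₁ m₀ m₂ m₄ n02 n04 n24 (swap b1) b2
    have n01 := hc.ne b1
    have n32 := (hc.ne b3).symm
    have n41 : p₄ ≠ p₁ := by
      rintro rfl
      exact b4 z31
    refine ⟨p₁, m₁, p₂, m₂, b2, {p₃}, p₀, p₄, p₁, .of_nbrs (hB.piv _ _) m₃ m₀ m₄ m₁ n04 n01 n41
      ?_ ?_ ?_⟩
    · rw [piv_of_ne n13.symm n32 n01 n02, z31, z30]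
      simp [b2, swap b3, swap b1]
    · rw [piv_of_ne n13.symm n32 n41 n24.symm, z31, z14]
      simpa using b4
    · rw [piv_left' hB b2 n13.symm n32]
      exact div_ne_zero (swap b3) b2
  obtain ⟨a, ha⟩ : F.Nonempty := by
    rw [Set.nonempty_iff_ne_empty]
    rintro rfl
    simp at hF
  obtain ⟨a', rfl, b, hb, hab', hab⟩ := hconn.exists_edge (S := {a}) (by simpa using ha) ⟨a, rfl⟩
    (by simpa using big {a} (by simp))
  obtain ⟨a, b, c, ha, hb, hc', hac, hab, hbc⟩ : ∃ a b c, a ∈ F ∧ b ∈ F ∧ c ∈ F ∧ a ≠ c ∧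
      T.B a b ≠ 0 ∧ T.B b c ≠ 0 := by
    obtain ⟨s, hs, t, ht, hts, hst⟩ := hconn.exists_edge (S := {a', b})
      (by simp [Set.insert_subset_iff, *]) ⟨a', by simp⟩
      (by simpa using big {a', b} (Finset.card_le_two.trans (by norm_num)))
    simp only [Set.mem_insert_iff, Set.mem_singleton_iff, not_or] at hts hs
    rcases hs with rfl | rfl
    · exact ⟨b, s, t, hb, ha, ht, Ne.symm hts.2, swap hab, hst⟩
    · exact ⟨a', s, t, ha, hb, ht, Ne.symm hts.1, hab, hst⟩
  obtain ⟨a, b, c, d, ha, hb, hc', hd, hac, hbd, hab, hbc, hcd⟩ : ∃ a b c d, a ∈ F ∧ b ∈ F ∧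
      c ∈ F ∧ d ∈ F ∧ a ≠ c ∧ b ≠ d ∧ T.B a b ≠ 0 ∧ T.B b c ≠ 0 ∧ T.B c d ≠ 0 := by
    obtain ⟨s, hs, t, ht, hts, hst⟩ := hconn.exists_edge (S := {a, b, c})
      (by simp [Set.insert_subset_iff, *]) ⟨a, by simp⟩
      (by simpa using big {a, b, c} (Finset.card_le_three.trans (by norm_num)))
    simp only [Set.mem_insert_iff, Set.mem_singleton_iff, not_or] at hts hs
    obtain ⟨ta, tb, tc⟩ := hts
    rcases hs with rfl | rfl | rfl
    · exact ⟨c, b, s, t, hc', hb, ha, ht, hac.symm, Ne.symm tb, swap hbc, swap hab, hst⟩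
    · exact (hst (deg hb ha hc' ht hac (Ne.symm ta) (Ne.symm tc) (swap hab) hbc)).elim
    · exact ⟨a, b, s, t, ha, hb, hc', ht, hac, Ne.symm tb, hab, hbc, hst⟩
  obtain ⟨s, hs, t, ht, hts, hst⟩ := hconn.exists_edge (S := {a, b, c, d})
      (by simp [Set.insert_subset_iff, *]) ⟨a, by simp⟩
      (by simpa using big {a, b, c, d} Finset.card_le_four)
  simp only [Set.mem_insert_iff, Set.mem_singleton_iff, not_or] at hts hs
  obtain ⟨ta, tb, tc, td⟩ := hts
  rcases hs with rfl | rfl | rfl | rfl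
  · exact path5 d hd c hc' b hb s ha t ht hbd.symm (Ne.symm td) (Ne.symm tb) hac.symm (swap hcd)
      (swap hbc) (swap hab) hst
  · exact (hst (deg hb ha hc' ht hac (Ne.symm ta) (Ne.symm tc) (swap hab) hbc)).elim
  · exact (hst (deg hc' hb hd ht hbd (Ne.symm tb) (Ne.symm td) (swap hbc) hcd)).elim
  · exact path5 a ha b hb c hc' s hd t ht hac (Ne.symm ta) (Ne.symm tc) hbd hab hbc hcd hst

/-- Lifts on `W ∪ {u}` and `W ∪ {v}` can be glued if `W` is connected. -/
theorem exists_lift_insert_insert (hf : CrMap f) {u v : E} (hfin : W.Finite) (hu : u ∉ W)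
    (hv : v ∉ W) (huv : u ≠ v) (hs : T.side u = T.side v) (hW : IsConn W T.B)
    (hT : Rel (insert u (insert v W)) T) {D₁ D₂ : E → E → L'}
    (h1 : Lift f (insert u W) (insert u W) T D₁) (h2 : Lift f (insert v W) (insert v W) T D₂) :
    ∃ D, Lift f (insert u (insert v W)) (insert u (insert v W)) T D := by
  classical
  have su := Set.subset_insert u W
  have sv := Set.subset_insert v W
  obtain ⟨r, hr, hrD⟩ := Lift.unique hfin (h1.mono su su) (h2.mono sv sv)
  replace h1 := h1.scale subset_rfl hr
  generalize scale r D₁ = D₁ at h1 hrD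
  let D : E → E → L' := fun i j =>
    if i ∈ insert u W ∧ j ∈ insert u W then D₁ i j
    else if i ∈ insert v W ∧ j ∈ insert v W then D₂ i j else 0
  have e1 : ∀ i ∈ insert u W, ∀ j ∈ insert u W, D₁ i j = D i j := fun i hi j hj => by
    simp only [D, hi, hj, and_self, if_true]
  have e2 : ∀ i ∈ insert v W, ∀ j ∈ insert v W, D₂ i j = D i j := fun i hi j hj => by
    by_cases h : i ∈ insert u W ∧ j ∈ insert u W
    · have m : ∀ x, x ∈ insert u W → x ∈ insert v W → x ∈ W := by
        rintro x (rfl | hx) (h' | hx')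
        exacts [(huv h').elim, hx', hx, hx]
      simp only [D, if_pos h]
      exact hrD i (m i h.1 hi) j (m j h.2 hj)
    · simp only [D, if_neg h, hi, hj, and_self, if_true]
  have sD : Skew D := by
    refine ⟨fun i j => ?_, fun i => ?_⟩
    · simp only [D, and_comm (a := j ∈ insert u W), and_comm (a := j ∈ insert v W)]
      split_ifs
      · exact h1.good.skewD.1 i j
      · exact h2.good.skewD.1 i j
      · simp
    · simp [D, h1.good.skewD.2, h2.good.skewD.2]
  have z : D u v = 0 := by
    have n1 : v ∉ insert u W := by simp [huv.symm, hv]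
    have n2 : u ∉ insert v W := by simp [huv, hu]
    simp only [D, n1, n2, and_false, false_and, if_false]
  have g : Glue f W u v T D := ⟨hu, hv, hT, h1.congr subset_rfl sD e1, h2.congr subset_rfl sD e2,
    hW, hs, z⟩
  have k1 := (g.lift hf).extend hf ((Set.subset_insert v W).trans (Set.subset_insert u _))
    (u := u) (Set.mem_insert _ _) (by
      rintro s (rfl | rfl | hsW) t (rfl | rfl | ht) h3 h4 h5
      all_goals first | exact (h3 rfl).elim | exact (h4 rfl).elim | exact (h5 rfl).elim | skip
      exacts [.inr ht, .inl hsW, .inl hsW])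
  have k2 := k1.extend hf (Set.insert_subset_insert (Set.subset_insert v W)) (u := v)
    (Set.mem_insert_of_mem _ (Set.mem_insert _ _)) (by
      rintro s (rfl | rfl | hsW) t - h3 - -
      exacts [.inl (Set.mem_insert _ _), (h3 rfl).elim, .inl (Set.mem_insert_of_mem _ hsW)])
  rw [Set.insert_comm v u] at k2
  exact ⟨D, k2⟩

/-- Compatible models on finite sets have lifts. -/
theorem Rel.exists_lift (hf : CrMap f) (hF : F.Finite) (hT : Rel F T) :
    ∃ D : E → E → L', Lift f F F T D := by
  induction h : F.ncard using Nat.strong_induction_on generalizing F T with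
  | _ n ih =>
    subst h
    have hc := hT.compat
    by_cases hsmall : F.ncard ≤ 4
    · obtain ⟨D, hD⟩ := hT.exists_good_of_small hf hF hsmall
      exact ⟨D, hD.lift_of_small hf hF hsmall⟩
    by_cases hconn : IsConn F T.B
    · have main : ∀ T : Model E L, Rel F T → IsConn F T.B → (∃ C a b c, Tripod F T.B C a b c) →
          ∃ D : E → E → L', Lift f F F T D := by
        rintro T hT hconn ⟨C, a, b, c, ht⟩
        obtain ⟨W, u, v, hu, hv, huv, hs, hW, rfl⟩ :=
          ht.exists_pair hT.compat.skewB hF hconn T.side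
        have fv := hF.subset (Set.subset_insert u (insert v W))
        have fW := fv.subset (Set.subset_insert v W)
        have c1 := Set.ncard_insert_of_notMem hu fW
        have c2 := Set.ncard_insert_of_notMem hv fW
        have c3 := Set.ncard_insert_of_notMem (a := u) (s := insert v W) (by simp [huv, hu]) fv
        obtain ⟨D₁, h1⟩ := ih (insert u W).ncard (by omega) (fW.insert u)
          (hT.mono (Set.insert_subset_insert (Set.subset_insert v W))) rfl
        obtain ⟨D₂, h2⟩ := ih (insert v W).ncard (by omega) fv
          (hT.mono (Set.subset_insert _ _)) rfl
        exact exists_lift_insert_insert hf fW hu hv huv hs hW hT h1 h2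
      rcases hc.exists_tripod hconn hsmall with h | ⟨x, hx, y, hy, hxy, h⟩
      · exact main T hT hconn h
      · obtain ⟨D, hD⟩ := main (T.piv x y) (hT.piv hx hy hxy)
          (fun a ha b hb => (hconn a ha b hb).piv hc.skewB hx hy hxy) h
        have := hD.piv hx hy (piv_self_ne hc.skewB hxy)
        rw [hc.piv_piv hx hy hxy] at this
        exact ⟨_, this⟩
    · simp only [IsConn, not_forall] at hconn
      obtain ⟨a, ha, b, hb, hab⟩ := hconn
      let F₁ := {x ∈ F | Conn F T.B a x}
      let F₂ := {x ∈ F | ¬ Conn F T.B a x}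
      have hU : F = F₁ ∪ F₂ := by
        ext x
        simp only [F₁, F₂, Set.mem_union, Set.mem_ofPred_eq]
        tauto
      have hd : Disjoint F₁ F₂ := Set.disjoint_left.2 fun x h1 h2 => h2.2 h1.2
      have s1 : F₁ ⊂ F := ⟨fun x hx => hx.1, fun h => hab (h hb).2⟩
      have s2 : F₂ ⊂ F := ⟨fun x hx => hx.1, fun h => (h ha).2 .refl⟩
      obtain ⟨D₁, h1⟩ := ih F₁.ncard (Set.ncard_lt_ncard s1 hF) (hF.subset s1.1)
        (hT.mono s1.1) rfl
      obtain ⟨D₂, h2⟩ := ih F₂.ncard (Set.ncard_lt_ncard s2 hF) (hF.subset s2.1)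
        (hT.mono s2.1) rfl
      have := exists_lift_union (hU ▸ hT) hd (fun i hi j hj => by
        by_contra h'
        exact hj.2 (hi.2.tail ⟨hi.1, hj.1, h'⟩)) h1 h2
      rwa [← hU] at this

end

section


variable {E L L' : Type*} [Field L] [Field L'] {f : L → L'} {F G : Set E} {T : Model E L}
  {D : E → E → L'}

theorem Rel.lift_of_finite (hT : Rel F T) (hD : Skew D)
    (h : ∀ S ⊆ F, S.Finite → Lift f S S T D) : Lift f F F T D := by
  refine ⟨fun T D => Rel F T ∧ Skew D ∧ ∀ S ⊆ F, S.Finite → Lift f S S T D, ⟨hT, hD, h⟩, ?_⟩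
  rintro T D ⟨hT, hD, h⟩
  refine ⟨⟨hT, hD, fun i hi j hj => ?_, fun i hi k hk j hj l hl hF => ?_⟩, ?_⟩
  · exact (h {i, j} (by simp [Set.insert_subset_iff, hi, hj]) (Set.toFinite _)).good.supp i
      (by simp) j (by simp)
  · exact (h {i, k, j, l} (by simp [Set.insert_subset_iff, *]) (Set.toFinite _)).good.ok i
      (by simp) k (by simp) j (by simp) l (by simp) hF
  · intro x hx y hy hxy
    refine ⟨hT.piv hx hy hxy, hD.piv _ _, fun S hS hfin => ?_⟩
    have := (h (insert x (insert y S)) (Set.insert_subset hx (Set.insert_subset hy hS))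
      ((hfin.insert y).insert x)).piv (x := x) (y := y) (by simp) (by simp) hxy
    have hsub := (Set.subset_insert y S).trans (Set.subset_insert x _)
    exact this.mono hsub hsub

theorem Conn.exists_finite {N : E → E → L} {a b : E} (h : Conn F N a b) :
    ∃ S ⊆ F, S.Finite ∧ Conn S N a b := by
  induction h with
  | refl => exact ⟨∅, Set.empty_subset _, Set.finite_empty, .refl⟩
  | tail _ h' ih =>
    rename_i b c _
    obtain ⟨S, hS, hfin, hab⟩ := ih
    refine ⟨insert b (insert c S), Set.insert_subset h'.1 (Set.insert_subset h'.2.1 hS),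
      (hfin.insert _).insert _, ?_⟩
    exact (hab.mono ((Set.subset_insert _ _).trans (Set.subset_insert _ _))).tail
      ⟨by simp, by simp, h'.2.2⟩

/-- Compatible models on `insert v G` have lifts that extend a given lift on `G`. -/
theorem Lift.exists_insert (hf : CrMap f) {v : E} (hv : v ∉ G) (hT : Rel (insert v G) T)
    (h : Lift f G G T D) : ∃ D', Lift f (insert v G) (insert v G) T D' ∧
      ∀ i ∈ G, ∀ j ∈ G, D i j = D' i j := by
  classical
  have hc := hT.compat
  have hv' : v ∈ insert v G := Set.mem_insert _ _
  have mem : ∀ {i}, i ∈ G → i ∈ insert v G := fun h => Set.mem_insert_of_mem _ h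
  have ex : ∀ S ⊆ G, S.Finite → ∃ D₁, Lift f (insert v S) (insert v S) T D₁ ∧
      ∀ i ∈ S, ∀ j ∈ S, D i j = D₁ i j := by
    intro S hS hfin
    obtain ⟨D₁, h1⟩ := Rel.exists_lift hf (hfin.insert v) (hT.mono (Set.insert_subset_insert hS))
    obtain ⟨r, hr, hrD⟩ := Lift.unique hfin
      (h1.mono (Set.subset_insert _ _) (Set.subset_insert _ _)) (h.mono hS hS)
    exact ⟨_, h1.scale subset_rfl hr, hrD⟩
  have : Nonempty E := ⟨v⟩
  let P : E → E → Prop := fun b c => c ∈ G ∧ T.B v c ≠ 0 ∧ Conn G T.B b c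
  let rep : E → E := fun b => Classical.epsilon (P b)
  have hrep : ∀ b ∈ G, T.B v b ≠ 0 → P b (rep b) := fun b hb hvb =>
    Classical.epsilon_spec (p := P b) ⟨b, hb, hvb, .refl⟩
  have rep_eq : ∀ a ∈ G, ∀ b ∈ G, T.B a b ≠ 0 → rep a = rep b := by
    intro a ha b hb hab
    have cab : Conn G T.B a b := .single ha hb hab
    have : P a = P b := by
      funext c
      simp only [P, eq_iff_iff]
      exact ⟨fun h => ⟨h.1, h.2.1, (cab.symm hc.skewB).trans h.2.2⟩,
        fun h => ⟨h.1, h.2.1, cab.trans h.2.2⟩⟩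
    simp only [rep, this]
  have exq : ∀ b : E, ∃ q : L', b ∈ G → T.B v b ≠ 0 → ∀ S ⊆ G, S.Finite → b ∈ S → rep b ∈ S →
      Conn S T.B b (rep b) → ∀ D₁, Lift f (insert v S) (insert v S) T D₁ →
      (∀ i ∈ S, ∀ j ∈ S, D i j = D₁ i j) → D₁ v b = q * D₁ v (rep b) := by
    intro b
    by_cases hb : b ∈ G ∧ T.B v b ≠ 0
    swap
    · exact ⟨0, fun h1 h2 => (hb ⟨h1, h2⟩).elim⟩
    obtain ⟨hb, hvb⟩ := hb
    obtain ⟨hr, hvr, hbr⟩ := hrep b hb hvb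
    obtain ⟨S₀, hS₀, hfin₀, hconn₀⟩ := hbr.exists_finite
    obtain ⟨D₀, h0, h0D⟩ := ex (insert b (insert (rep b) S₀))
      (Set.insert_subset hb (Set.insert_subset hr hS₀)) ((hfin₀.insert _).insert _)
    have n0 := h0.good.ne (i := v) (j := rep b) (by simp) (by simp) hvr
    refine ⟨D₀ v b / D₀ v (rep b), fun _ _ S hS hfin hbS hrS hconn D₁ h1 h1D => ?_⟩
    set S' := insert b (insert (rep b) S₀) with hS'
    obtain ⟨D₂, h2, h2D⟩ := ex (S ∪ S') (Set.union_subset hS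
      (Set.insert_subset hb (Set.insert_subset hr hS₀)))
      (hfin.union ((hfin₀.insert _).insert _))
    have sub1 := Set.insert_subset_insert (a := v) (Set.subset_union_left (s := S) (t := S'))
    have sub2 := Set.insert_subset_insert (a := v) (Set.subset_union_right (s := S) (t := S'))
    have k1 := Pair.ratio (v := v) (a := b) (b := rep b) ⟨h1, h2.mono sub1 sub1, fun i hi j hj => by
      rw [← h1D i hi j hj, h2D i (.inl hi) j (.inl hj)], hvb, hvr⟩ (fun h => hv (hS h)) hbS hrS hconn
    have k2 := Pair.ratio (v := v) (a := b) (b := rep b) ⟨h0, h2.mono sub2 sub2, fun i hi j hj => by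
      rw [← h0D i hi j hj, h2D i (.inr hi) j (.inr hj)], hvb, hvr⟩
      (fun h => hv ((Set.insert_subset hb (Set.insert_subset hr hS₀)) h)) (by simp [hS'])
      (by simp [hS']) (hconn₀.mono ((Set.subset_insert _ _).trans (Set.subset_insert _ _)))
    have n2 := h2.good.ne (i := v) (j := rep b) (by simp) (by simp [hrS]) hvr
    field_simp
    refine mul_left_cancel₀ n2 ?_
    linear_combination D₁ v (rep b) * k2 - D₀ v (rep b) * k1
  choose q hq using exq
  let D' : E → E → L' := fun i j =>
    if i = v then (if j ∈ G ∧ T.B v j ≠ 0 then q j else 0)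
    else if j = v then (if i ∈ G ∧ T.B v i ≠ 0 then -q i else 0) else D i j
  have nev : ∀ {i}, i ∈ G → i ≠ v := by rintro i hi rfl; exact hv hi
  have hD' : ∀ i ∈ G, ∀ j ∈ G, D i j = D' i j := fun i hi j hj => by
    simp only [D', if_neg (nev hi), if_neg (nev hj)]
  have sD' : Skew D' := by
    refine ⟨fun i j => ?_, fun i => ?_⟩
    · by_cases hi : i = v <;> by_cases hj : j = v
      · subst hi; subst hj; simp [D', hv]
      · simp only [D', hi, hj, if_true, if_false]; split_ifs <;> simp
      · simp only [D', hi, hj, if_true, if_false]; split_ifs <;> simp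
      · simp only [D', if_neg hi, if_neg hj]; exact h.good.skewD.1 i j
    · by_cases hi : i = v
      · subst hi; simp [D', hv]
      · simp only [D', if_neg hi]; exact h.good.skewD.2 i
  refine ⟨D', hT.lift_of_finite sD' ?_, hD'⟩
  intro S₀ hS₀ hfin₀
  have exS : ∀ b : E, ∃ S ⊆ G, S.Finite ∧ (b ∈ G → T.B v b ≠ 0 → b ∈ S ∧ rep b ∈ S ∧
      Conn S T.B b (rep b)) := by
    intro b
    by_cases hb : b ∈ G ∧ T.B v b ≠ 0
    · obtain ⟨hr, hvr, hbr⟩ := hrep b hb.1 hb.2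
      obtain ⟨S, hS, hfin, hconn⟩ := hbr.exists_finite
      exact ⟨insert b (insert (rep b) S), Set.insert_subset hb.1 (Set.insert_subset hr hS),
        (hfin.insert _).insert _, fun _ _ => ⟨by simp, by simp,
          hconn.mono ((Set.subset_insert _ _).trans (Set.subset_insert _ _))⟩⟩
    · exact ⟨∅, Set.empty_subset _, Set.finite_empty, fun h1 h2 => (hb ⟨h1, h2⟩).elim⟩
  choose R hRG hRfin hR using exS
  set S := (S₀ ∩ G) ∪ ⋃ b ∈ S₀, R b with hSdef
  have hSG : S ⊆ G := Set.union_subset Set.inter_subset_right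
    (Set.iUnion₂_subset fun b _ => hRG b)
  have hSfin : S.Finite := (hfin₀.subset Set.inter_subset_left).union
    (hfin₀.biUnion fun b _ => hRfin b)
  have hRS : ∀ b ∈ S₀, R b ⊆ S := fun b hb =>
    (Set.subset_biUnion_of_mem (u := R) hb).trans Set.subset_union_right
  have hS₀S : S₀ ⊆ insert v S := fun x hx => (hS₀ hx).imp id fun h => .inl ⟨hx, h⟩
  obtain ⟨D₁, h1, h1D⟩ := ex S hSG hSfin
  let g : E → L' := fun i => if D₁ v (rep i) = 0 then 1 else (D₁ v (rep i))⁻¹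
  let s : E → L' := fun i => if i = v then 1 else if T.side i = T.side v then (g i)⁻¹ else g i
  have hg : ∀ i, g i ≠ 0 := fun i => by
    simp only [g]
    split_ifs with h
    · exact one_ne_zero
    · exact inv_ne_zero h
  have hs : ∀ i, s i ≠ 0 := fun i => by
    simp only [s]
    split_ifs
    · exact one_ne_zero
    · exact inv_ne_zero (hg i)
    · exact hg i
  have key : ∀ j ∈ S₀, j ∈ G → TernaryLift.scale s D₁ v j = D' v j := by
    intro j hj hjG
    by_cases hvj : T.B v j = 0
    · simp [D', hvj, TernaryLift.scale,
        (h1.good.supp v (Set.mem_insert _ _) j (hS₀S hj)).1 hvj]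
    · obtain ⟨k1, k2, k3⟩ := hR j hjG hvj
      have := hq j hjG hvj S hSG hSfin (hRS j hj k1) (hRS j hj k2) (k3.mono (hRS j hj)) D₁ h1 h1D
      have hn := h1.good.ne (Set.mem_insert _ _) (Set.mem_insert_of_mem _ (hRS j hj k2))
        (hrep j hjG hvj).2.1
      have hside := (hc.bip v hv' j (mem hjG) hvj).symm
      simp only [TernaryLift.scale, s, if_true, if_neg (nev hjG), if_neg hside, g, if_neg hn, D',
        hjG, hvj, Ne, not_false_eq_true, and_self, this]
      field_simp
  refine ((h1.mono hS₀S hS₀S).scale subset_rfl hs).congr subset_rfl sD' ?_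
  intro i hi j hj
  rcases hS₀ hi with rfl | hiG <;> rcases hS₀ hj with rfl | hjG
  · rw [sD'.2, (h1.good.skewD.scale s).2]
  · exact key j hj hjG
  · rw [sD'.1 _ i, (h1.good.skewD.scale s).1 _ i, key i hi hiG]
  · have hiS : i ∈ S := .inl ⟨hi, hiG⟩
    have hjS : j ∈ S := .inl ⟨hj, hjG⟩
    rw [← hD' i hiG j hjG, h1D i hiS j hjS]
    by_cases hij : T.B i j = 0
    · simp [TernaryLift.scale, (h1.good.supp i (hS₀S hi) j (hS₀S hj)).1 hij]
    · have hsd := hc.bip i (mem hiG) j (mem hjG) hij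
      have hgj : g i = g j := by simp only [g, rep_eq i hiG j hjG hij]
      have : s i * s j = 1 := by
        simp only [s, if_neg (nev hiG), if_neg (nev hjG), ← hgj]
        by_cases h3 : T.side i = T.side v
        · rw [if_pos h3, if_neg (h3 ▸ hsd.symm), inv_mul_cancel₀ (hg i)]
        · rw [if_neg h3, if_pos (bool_side hsd.symm h3), mul_inv_cancel₀ (hg i)]
      simp only [TernaryLift.scale]
      rw [this, one_mul]

/-- Compatible models have lifts. -/
theorem Rel.exists_lift_of_infinite (hf : CrMap f) (hT : Rel F T) :
    ∃ D : E → E → L', Lift f F F T D := by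
  classical
  let X := {p : Set E × (E → E → L') // p.1 ⊆ F ∧ Lift f p.1 p.1 T p.2}
  let r : X → X → Prop := fun p q => p.1.1 ⊆ q.1.1 ∧ ∀ i ∈ p.1.1, ∀ j ∈ p.1.1,
    p.1.2 i j = q.1.2 i j
  obtain ⟨⟨⟨G, D⟩, hGF, hD⟩, hmax⟩ := exists_maximal_of_chains_bounded (r := r) (by
    intro c hc
    have dir : ∀ p ∈ c, ∀ q ∈ c, r p q ∨ r q p := by
      intro p hp q hq
      by_cases hpq : p = q
      · subst hpq; exact .inl ⟨subset_rfl, fun _ _ _ _ => rfl⟩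
      · exact hc hp hq hpq
    let D : E → E → L' := fun i j =>
      if h : ∃ p ∈ c, i ∈ p.1.1 ∧ j ∈ p.1.1 then h.choose.1.2 i j else 0
    have hD : ∀ p ∈ c, ∀ i ∈ p.1.1, ∀ j ∈ p.1.1, p.1.2 i j = D i j := by
      intro p hp i hi j hj
      have h : ∃ p ∈ c, i ∈ p.1.1 ∧ j ∈ p.1.1 := ⟨p, hp, hi, hj⟩
      simp only [D, dif_pos h]
      obtain ⟨h1, h2, h3⟩ := h.choose_spec
      rcases dir p hp _ h1 with h4 | h4
      · exact h4.2 i hi j hj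
      · exact (h4.2 i h2 j h3).symm
    have sD : Skew D := by
      refine ⟨fun i j => ?_, fun i => ?_⟩
      · by_cases h : ∃ p ∈ c, i ∈ p.1.1 ∧ j ∈ p.1.1
        · obtain ⟨p, hp, hi, hj⟩ := h
          rw [← hD p hp i hi j hj, ← hD p hp j hj i hi]
          exact p.2.2.good.skewD.1 i j
        · have h' : ¬ ∃ p ∈ c, j ∈ p.1.1 ∧ i ∈ p.1.1 :=
            fun ⟨p, hp, hj, hi⟩ => h ⟨p, hp, hi, hj⟩
          simp only [D, dif_neg h, dif_neg h', neg_zero]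
      · by_cases h : ∃ p ∈ c, i ∈ p.1.1 ∧ i ∈ p.1.1
        · obtain ⟨p, hp, hi, -⟩ := h
          rw [← hD p hp i hi i hi]
          exact p.2.2.good.skewD.2 i
        · simp only [D, dif_neg h]
    let G : Set E := ⋃ p ∈ c, p.1.1
    have hGF : G ⊆ F := Set.iUnion₂_subset fun p _ => p.2.1
    have cover : ∀ S : Set E, S.Finite → S ⊆ G → S = ∅ ∨ ∃ p ∈ c, S ⊆ p.1.1 := by
      intro S hS
      induction S, hS using Set.Finite.induction_on with
      | empty => exact fun _ => .inl rfl
      | @insert a S ha hS ih =>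
        intro hSG
        refine .inr ?_
        obtain ⟨p, hp, hap⟩ := Set.mem_iUnion₂.1 (hSG (Set.mem_insert a S))
        rcases ih ((Set.subset_insert a S).trans hSG) with rfl | ⟨p', hp', hSp⟩
        · exact ⟨p, hp, by simpa using hap⟩
        · rcases dir p hp p' hp' with h | h
          · exact ⟨p', hp', Set.insert_subset (h.1 hap) hSp⟩
          · exact ⟨p, hp, Set.insert_subset hap (hSp.trans h.1)⟩
    have hlift : Lift f G G T D := by
      refine (hT.mono hGF).lift_of_finite sD fun S hS hfin => ?_
      rcases cover S hfin hS with rfl | ⟨p, hp, hSp⟩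
      · obtain ⟨D₀, h0⟩ := Rel.exists_lift hf hfin (hT.mono (Set.empty_subset F))
        exact h0.congr subset_rfl sD (by simp)
      · exact (p.2.2.mono hSp hSp).congr subset_rfl sD fun i hi j hj => hD p hp i (hSp hi) j (hSp hj)
    exact ⟨⟨(G, D), hGF, hlift⟩, fun p hp =>
      ⟨Set.subset_biUnion_of_mem (u := fun p : X => p.1.1) hp, hD p hp⟩⟩)
    (fun {p q t} h1 h2 => ⟨h1.1.trans h2.1, fun i hi j hj =>
      (h1.2 i hi j hj).trans (h2.2 i (h1.1 hi) j (h1.1 hj))⟩)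
  have : F ⊆ G := by
    intro v hvF
    by_contra hv
    obtain ⟨D', h1, h2⟩ := hD.exists_insert hf hv (hT.mono (Set.insert_subset hvF hGF))
    exact hv ((hmax ⟨(insert v G, D'), Set.insert_subset hvF hGF, h1⟩
      ⟨Set.subset_insert _ _, h2⟩).1 (Set.mem_insert _ _))
  obtain rfl := hGF.antisymm this
  exact ⟨D, hD⟩

end

section


/-- Vectors `φ` in coordinates with respect to the basis formed by the elements of `F` on the
`true` side of `σ`; the entries of `N` are, up to sign, the coordinates of the other elements. -/
structure Coords {E K : Type*} [Field K] (F : Set E) (σ : E → Bool) (N : E → E → K)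
    (φ : E → E →₀ K) : Prop where
  skew : Skew N
  base : ∀ b ∈ F, σ b = true → φ b = Finsupp.single b 1
  supp : ∀ e ∈ F, ∀ b, φ e b ≠ 0 → b ∈ F ∧ σ b = true
  entry : ∀ b ∈ F, ∀ e ∈ F, σ b = true → σ e = false → N b e = φ e b
  zero : ∀ i ∈ F, ∀ j ∈ F, σ i = σ j → N i j = 0

variable {E K : Type*} [Field K] {F : Set E} {σ : E → Bool} {N : E → E → K} {φ : E → E →₀ K}

/-- The change of coordinates corresponding to a pivot. -/
noncomputable def shear (u : E →₀ K) (x y : E) : (E →₀ K) →ₗ[K] (E →₀ K) :=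
  LinearMap.id - (u x)⁻¹ • (Finsupp.lapply x).smulRight (Finsupp.single y 1 + u)

theorem shear_apply (u : E →₀ K) (x y : E) (v : E →₀ K) (b : E) :
    shear u x y v b = v b - (u x)⁻¹ * (v x * (delta K y b + u b)) := by
  classical
  simp [shear, Finsupp.single_apply, delta]
  split_ifs <;> ring

theorem Coords.outside (h : Coords F σ N φ) {e b : E} (he : e ∈ F) (hb : σ b = false) :
    φ e b = 0 := by
  by_contra h'
  simpa [hb] using (h.supp e he b h').2

theorem Coords.pivot_aux (h : Coords F σ N φ) {x y : E} (hx : x ∈ F) (hy : y ∈ F)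
    (hsx : σ x = true) (hsy : σ y = false) (hxy : N x y ≠ 0) :
    ∃ ψ : E → E →₀ K, Coords F (flip σ x y) (piv N x y) ψ ∧
      ∀ I ⊆ F, (LinearIndepOn K ψ I ↔ LinearIndepOn K φ I) := by
  classical
  have hne : x ≠ y := by rintro rfl; simp [hsx] at hsy
  have hd := h.entry x hx y hy hsx hsy
  have hd0 : φ y x ≠ 0 := hd ▸ hxy
  have hyy : φ y y = 0 := h.outside hy hsy
  let w : E → Kˣ := fun e => if e = x ∨ e = y then -1 else 1
  let g := shear (φ y) x y
  have hwx : w x = -1 := by simp [w]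
  have hwy : w y = -1 := by simp [w]
  have hw : ∀ e, e ≠ x → e ≠ y → w e = 1 := fun e h1 h2 => by simp [w, h1, h2]
  let ψ : E → E →₀ K := fun e => w e • g (φ e)
  have ψx : ∀ b, ψ x b = (φ y x)⁻¹ * (delta K y b + φ y b) - delta K x b := fun b => by
    simp only [ψ, hwx, g, Units.neg_smul, one_smul, Finsupp.neg_apply, shear_apply, h.base x hx hsx,
      Finsupp.single_apply, delta]
    simp
  have ψy : ∀ b, ψ y b = delta K y b := fun b => by
    simp only [ψ, hwy, g, Units.neg_smul, one_smul, Finsupp.neg_apply, shear_apply]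
    field_simp
    ring
  have ψe : ∀ e, e ≠ x → e ≠ y → ∀ b,
      ψ e b = φ e b - (φ y x)⁻¹ * (φ e x * (delta K y b + φ y b)) := fun e h1 h2 b => by
    simp only [ψ, hw e h1 h2, g, one_smul, shear_apply]
  have flip_true : ∀ b, flip σ x y b = true → b = y ∨ b ≠ x ∧ b ≠ y ∧ σ b = true := fun b hb => by
    by_cases h1 : b = x
    · subst h1; simp [flip_left, hsx] at hb
    by_cases h2 : b = y
    · exact .inl h2
    · exact .inr ⟨h1, h2, by rwa [flip_of_ne h1 h2] at hb⟩
  have flip_false : ∀ b, flip σ x y b = false → b = x ∨ b ≠ x ∧ b ≠ y ∧ σ b = false :=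
    fun b hb => by
    by_cases h1 : b = x
    · exact .inl h1
    by_cases h2 : b = y
    · subst h2; simp [flip_right, hsy] at hb
    · exact .inr ⟨h1, h2, by rwa [flip_of_ne h1 h2] at hb⟩
  refine ⟨ψ, ⟨h.skew.piv x y, fun b hb hs => ?_, fun e he b hb => ?_, fun b hb e he hsb hse => ?_,
    fun i hi j hj hij => ?_⟩, fun I hI => ?_⟩
  · ext c
    rcases flip_true b hs with rfl | ⟨h1, h2, h3⟩
    · rw [ψy, Finsupp.single_apply, delta]
    · rw [ψe b h1 h2, h.base b hb h3, Finsupp.single_eq_of_ne h1.symm]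
      simp
  · by_cases hby : b = y
    · subst hby; exact ⟨hy, by simp [flip_right, hsy]⟩
    by_cases hbx : b = x
    · subst hbx
      exfalso
      by_cases h1 : e = b
      · subst h1
        apply hb
        rw [ψx, delta_self, delta_ne (Ne.symm hne)]
        field_simp
        ring
      by_cases h2 : e = y
      · subst h2
        exact hb (by rw [ψy, delta_ne (Ne.symm hne)])
      · apply hb
        rw [ψe e h1 h2, delta_ne (Ne.symm hne)]
        field_simp
        ring
    have key : b ∈ F ∧ σ b = true := by
      by_contra hcon
      have h0 : ∀ e ∈ F, φ e b = 0 := fun e he => by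
        by_contra h'; exact hcon (h.supp e he b h')
      apply hb
      by_cases h1 : e = x
      · subst h1
        rw [ψx, delta_ne (Ne.symm hby), delta_ne (Ne.symm hbx), h0 y hy]; simp
      by_cases h2 : e = y
      · subst h2; rw [ψy, delta_ne (Ne.symm hby)]
      · rw [ψe e h1 h2, delta_ne (Ne.symm hby), h0 y hy, h0 e he]; simp
    exact ⟨key.1, by rw [flip_of_ne hbx hby, key.2]⟩
  · rcases flip_true b hsb with rfl | ⟨hbx, hby, hb'⟩ <;>
      rcases flip_false e hse with rfl | ⟨hex, hey, he'⟩
    · rw [piv_self' h.skew hxy, ψx, delta_self, delta_ne hne, hyy, hd]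
      ring
    · rw [piv_right h.skew hxy hex hey, ψe e hex hey, h.entry x hx e he hsx he', hd, delta_self,
        hyy, h.outside he hsy]
      field_simp
      ring
    · rw [piv_left' h.skew hxy hbx hby, ψx, delta_ne (Ne.symm hby), delta_ne (Ne.symm hbx), hd,
        h.entry b hb y hy hb' hsy]
      field_simp
      ring
    · rw [piv_of_left hbx hby hex hey (h.zero b hb x hx (hb'.trans hsx.symm)), ψe e hex hey,
        h.entry b hb e he hb' he', h.entry b hb y hy hb' hsy, h.entry x hx e he hsx he',
        delta_ne (Ne.symm hby), hd]
      field_simp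
      ring
  · cases hsi : flip σ x y i
    · have hsj := hij.symm.trans hsi
      rcases flip_false i hsi with rfl | ⟨hix, hiy, hi'⟩ <;>
        rcases flip_false j hsj with rfl | ⟨hjx, hjy, hj'⟩
      · exact (h.skew.piv _ _).2 _
      · rw [piv_left h.skew hxy hjx hjy, h.zero y hy j hj (hsy.trans hj'.symm), zero_div]
      · rw [piv_left' h.skew hxy hix hiy, h.zero i hi y hy (hi'.trans hsy.symm)]; simp
      · rw [piv_unchanged hix hiy hjx hjy, h.zero i hi j hj (hi'.trans hj'.symm)]
        · rw [h.zero y hy j hj (hsy.trans hj'.symm), mul_zero]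
        · rw [h.zero i hi y hy (hi'.trans hsy.symm), zero_mul]
    · have hsj := hij.symm.trans hsi
      rcases flip_true i hsi with rfl | ⟨hix, hiy, hi'⟩ <;>
        rcases flip_true j hsj with rfl | ⟨hjx, hjy, hj'⟩
      · exact (h.skew.piv _ _).2 _
      · rw [piv_right h.skew hxy hjx hjy, h.zero x hx j hj (hsx.trans hj'.symm)]; simp
      · rw [piv_right' h.skew hxy hix hiy, h.zero i hi x hx (hi'.trans hsx.symm)]; simp
      · rw [piv_unchanged hix hiy hjx hjy, h.zero i hi j hj (hi'.trans hj'.symm)]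
        · rw [h.zero i hi x hx (hi'.trans hsx.symm), zero_mul]
        · rw [h.zero x hx j hj (hsx.trans hj'.symm), mul_zero]
  · have h1 : LinearIndepOn K ψ I ↔ LinearIndepOn K (g ∘ φ) I :=
      LinearIndependent.units_smul_iff (fun e : I => g (φ e)) fun e => w e
    rw [h1]
    apply LinearMap.linearIndepOn_iff_of_injOn
    have hspan : Submodule.span K (φ '' I) ≤ LinearMap.ker (Finsupp.lapply (R := K) y) := by
      rw [Submodule.span_le]
      rintro _ ⟨e, he, rfl⟩
      exact h.outside (hI he) hsy
    intro v hv v' hv' hvv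
    rw [← sub_eq_zero] at hvv ⊢
    rw [← map_sub] at hvv
    have h0 : (v - v') y = 0 := hspan (sub_mem hv hv')
    generalize v - v' = u at hvv h0
    have hu : ∀ b, u b - (φ y x)⁻¹ * (u x * (delta K y b + φ y b)) = 0 := fun b => by
      have := DFunLike.congr_fun hvv b
      simpa only [g, shear_apply, Finsupp.zero_apply] using this
    have hux : u x = 0 := by
      have := hu y
      rw [h0, delta_self, hyy] at this
      simpa [hd0] using this
    ext b
    simpa [hux] using hu b

theorem Coords.pivot (h : Coords F σ N φ) {x y : E} (hx : x ∈ F) (hy : y ∈ F) (hxy : N x y ≠ 0) :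
    ∃ ψ : E → E →₀ K, Coords F (flip σ x y) (piv N x y) ψ ∧
      ∀ I ⊆ F, (LinearIndepOn K ψ I ↔ LinearIndepOn K φ I) := by
  have hs : σ x ≠ σ y := fun hs => hxy (h.zero x hx y hy hs)
  cases hsx : σ x <;> cases hsy : σ y
  · simp [hsx, hsy] at hs
  · rw [flip_comm, piv_comm h.skew]
    exact h.pivot_aux hy hx hsy hsx (fun h' => hxy (h.skew.comm_zero.1 h'))
  · exact h.pivot_aux hx hy hsx hsy hxy
  · simp [hsx, hsy] at hs

theorem Coords.indep_of_base (h : Coords F σ N φ) {I : Set E} (hI : I ⊆ F)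
    (hs : ∀ e ∈ I, σ e = true) : LinearIndepOn K φ I := by
  have : LinearIndepOn K (fun i : E => Finsupp.single i (1 : K)) I :=
    (Finsupp.linearIndependent_single_one K E).linearIndepOn _
  exact this.congr fun e he => (h.base e (hI he) (hs e he)).symm

theorem Coords.mem_span (h : Coords F σ N φ) {e : E} (he : e ∈ F) {S : Set E} (hS : S ⊆ F)
    (hs : ∀ b ∈ S, σ b = true) (hS' : ∀ b ∈ F, σ b = true → b ∉ S → φ e b = 0) :
    φ e ∈ Submodule.span K (φ '' S) := by
  have : φ '' S = (fun i => Finsupp.single i 1) '' S :=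
    Set.image_congr fun b hb => h.base b (hS hb) (hs b hb)
  rw [this, ← Finsupp.supported_eq_span_single, Finsupp.mem_supported]
  intro b hb
  have hb' := Finsupp.mem_support_iff.1 hb
  by_contra hbS
  obtain ⟨h1, h2⟩ := h.supp e he b hb'
  exact hb' (hS' b h1 h2 hbS)

theorem Coords.entry_ne_zero_iff (h : Coords F σ N φ) {b e : E} (hb : b ∈ F) (he : e ∈ F)
    (hsb : σ b = true) (hse : σ e = false) :
    N b e ≠ 0 ↔ LinearIndepOn K φ (insert e {c | c ∈ F ∧ σ c = true ∧ c ≠ b}) := by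
  have hS : {c | c ∈ F ∧ σ c = true ∧ c ≠ b} ⊆ F := fun c hc => hc.1
  have hs : ∀ c ∈ {c | c ∈ F ∧ σ c = true ∧ c ≠ b}, σ c = true := fun c hc => hc.2.1
  have heS : e ∉ {c | c ∈ F ∧ σ c = true ∧ c ≠ b} := fun h => by simp [hse] at h
  rw [linearIndepOn_insert heS, h.entry b hb e he hsb hse]
  refine ⟨fun h0 => ⟨h.indep_of_base hS hs, fun hmem => h0 ?_⟩, fun h0 h1 => h0.2 ?_⟩
  · have hspan : Submodule.span K (φ '' {c | c ∈ F ∧ σ c = true ∧ c ≠ b}) ≤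
        LinearMap.ker (Finsupp.lapply (R := K) b) := by
      rw [Submodule.span_le]
      rintro _ ⟨c, hc, rfl⟩
      rw [h.base c hc.1 hc.2.1]
      simp [hc.2.2.symm]
    exact hspan hmem
  · refine h.mem_span he hS hs fun c hc hsc hcS => ?_
    obtain rfl : c = b := by
      by_contra hcb
      exact hcS ⟨hc, hsc, hcb⟩
    exact h1

end

section


variable {E K K' L L' : Type*} [Field K] [Field K'] [Field L] [Field L'] {F : Set E}
  {σ : E → Bool} {N : E → E → K} {φ : E → E →₀ K}

/-- A spanning independent set of a vector configuration yields coordinates. -/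
theorem exists_coords {V : Type*} [AddCommGroup V] [Module K V] {v : E → V} {X : Set E}
    (hXF : X ⊆ F) (hX : LinearIndepOn K v X)
    (hspan : ∀ e ∈ F, v e ∈ Submodule.span K (v '' X)) {σ : E → Bool}
    (hσ : ∀ e ∈ F, (σ e = true ↔ e ∈ X)) :
    ∃ (N : E → E → K) (φ : E → E →₀ K), Coords F σ N φ ∧
      ∀ I ⊆ F, (LinearIndepOn K φ I ↔ LinearIndepOn K v I) := by
  classical
  have h1 : ∀ e, ∃ l : E →₀ K, (e ∈ X → l = Finsupp.single e 1) ∧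
      (e ∈ F → l ∈ Finsupp.supported K K X ∧ Finsupp.linearCombination K v l = v e) := by
    intro e
    by_cases heX : e ∈ X
    · exact ⟨_, fun _ => rfl, fun _ => ⟨Finsupp.single_mem_supported K 1 heX, by simp⟩⟩
    by_cases heF : e ∈ F
    · obtain ⟨l, hl, hl'⟩ := (Finsupp.mem_span_image_iff_linearCombination K).1 (hspan e heF)
      exact ⟨l, fun h => (heX h).elim, fun _ => ⟨hl, hl'⟩⟩
    · exact ⟨0, fun h => (heX h).elim, fun h => (heF h).elim⟩
  choose φ hφ hφ' using h1
  have hsupp : ∀ e ∈ F, ∀ b, φ e b ≠ 0 → b ∈ X := fun e he b hb =>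
    (Finsupp.mem_supported K _).1 (hφ' e he).1 (Finsupp.mem_support_iff.2 hb)
  let N : E → E → K := fun i j => if σ i = true ∧ σ j = false then φ j i else
    if σ i = false ∧ σ j = true then -φ i j else 0
  refine ⟨N, φ, ⟨⟨fun i j => ?_, fun i => ?_⟩, fun b hb hs => hφ b ((hσ b hb).1 hs),
    fun e he b hb => ?_, fun b hb e he hs hs' => ?_, fun i hi j hj hij => ?_⟩, fun I hI => ?_⟩
  · simp only [N]
    cases σ i <;> cases σ j <;> simp
  · simp only [N]
    cases σ i <;> simp
  · have := hsupp e he b hb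
    exact ⟨hXF this, (hσ b (hXF this)).2 this⟩
  · simp [N, hs, hs']
  · simp only [N, hij]
    cases σ j <;> simp
  · have h2 : LinearIndepOn K v I ↔ LinearIndepOn K (Finsupp.linearCombination K v ∘ φ) I :=
      linearIndepOn_congr fun e he => ((hφ' e (hI he)).2).symm
    rw [h2]
    refine (LinearMap.linearIndepOn_iff_of_injOn _ ?_).symm
    have hle : Submodule.span K (φ '' I) ≤ Finsupp.supported K K X := by
      rw [Submodule.span_le]
      rintro _ ⟨e, he, rfl⟩
      exact (hφ' e (hI he)).1
    intro a ha b hb hab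
    rw [linearIndepOn_iff] at hX
    rw [← sub_eq_zero]
    exact hX _ (sub_mem (hle ha) (hle hb)) (by rw [map_sub, hab, sub_self])

/-- Two coordinate systems with the same supports for all sequences of pivots describe the same
independent sets. -/
theorem indep_iff_of_finite {f : L → L'} {I : Set E} (hI : I ⊆ F) (hfin : I.Finite) :
    ∀ (n : ℕ) {T : Model E L} {D : E → E → L'} {φ : E → E →₀ L} {ψ : E → E →₀ L'},
      (I ∩ {e | T.side e = false}).ncard = n → Lift f F F T D → Coords F T.side T.B φ →
      Coords F T.side D ψ → (LinearIndepOn L φ I ↔ LinearIndepOn L' ψ I) := by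
  intro n
  induction n with
  | zero =>
    intro T D φ ψ hn hL h1 h2
    have hs : ∀ e ∈ I, T.side e = true := fun e he => by
      by_contra hs
      have : e ∈ I ∩ {e | T.side e = false} := ⟨he, by simpa using hs⟩
      rw [(Set.ncard_eq_zero (hfin.subset Set.inter_subset_left)).1 hn] at this
      exact this
    exact ⟨fun _ => h2.indep_of_base hI hs, fun _ => h1.indep_of_base hI hs⟩
  | succ n ih =>
    intro T D φ ψ hn hL h1 h2
    have hG := hL.good
    obtain ⟨e, heI, hse⟩ : (I ∩ {e | T.side e = false}).Nonempty := by
      rw [← Set.ncard_pos (hfin.subset Set.inter_subset_left)]; omega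
    have hse : T.side e = false := hse
    have heF := hI heI
    by_cases hb : ∃ b ∈ F, T.side b = true ∧ b ∉ I ∧ T.B b e ≠ 0
    · obtain ⟨b, hbF, hsb, hbI, hbe⟩ := hb
      have hbe' : D b e ≠ 0 := fun h => hbe ((hG.supp b hbF e heF).2 h)
      obtain ⟨φ', h1', hφ'⟩ := h1.pivot hbF heF hbe
      obtain ⟨ψ', h2', hψ'⟩ := h2.pivot hbF heF hbe'
      rw [← hφ' I hI, ← hψ' I hI]
      refine ih (T := T.piv b e) ?_ (hL.piv hbF heF hbe) h1' h2'
      have : I ∩ {c | (T.piv b e).side c = false} = (I ∩ {c | T.side c = false}) \ {e} := by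
        ext c
        simp only [Set.mem_inter_iff, Set.mem_ofPred_eq, Set.mem_sdiff, Set.mem_singleton_iff,
          Model.piv_side]
        by_cases hce : c = e
        · subst hce
          simp [flip_right, hse]
        by_cases hcb : c = b
        · subst hcb
          simp [hbI]
        · simp [flip_of_ne hcb hce, hce]
      have hmem : e ∈ I ∩ {c | T.side c = false} := ⟨heI, hse⟩
      rw [this, Set.ncard_sdiff_singleton_of_mem hmem, hn]
      rfl
    · have hmem : ∀ b ∈ F, T.side b = true → b ∉ I ∩ {c | T.side c = true} → T.B b e = 0 :=
        fun b hbF hsb hbI => by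
        by_contra h
        exact hb ⟨b, hbF, hsb, fun h' => hbI ⟨h', hsb⟩, h⟩
      have hsub : I ∩ {c | T.side c = true} ⊆ I \ {e} := fun c hc => ⟨hc.1, by
        rintro rfl
        simpa [hse] using hc.2⟩
      have hS : I ∩ {c | T.side c = true} ⊆ F := Set.inter_subset_left.trans hI
      have m1 := h1.mem_span heF hS (fun c hc => hc.2) fun b hbF hsb hbI => by
        rw [← h1.entry b hbF e heF hsb hse]
        exact hmem b hbF hsb hbI
      have m2 := h2.mem_span heF hS (fun c hc => hc.2) fun b hbF hsb hbI => by
        rw [← h2.entry b hbF e heF hsb hse]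
        exact (hG.supp b hbF e heF).1 (hmem b hbF hsb hbI)
      exact ⟨fun h => (h.notMem_span heI (Submodule.span_mono (Set.image_mono hsub) m1)).elim,
        fun h => (h.notMem_span heI (Submodule.span_mono (Set.image_mono hsub) m2)).elim⟩

/-- Coordinates over the ternary field and over `L` of the same configuration. -/
theorem Coords.rel {T : Model E L} {φ₃ : E → E →₀ ZMod 3} {φ : E → E →₀ L}
    (h3 : Coords F T.side T.A φ₃) (h : Coords F T.side T.B φ)
    (hI : ∀ I ⊆ F, (LinearIndepOn (ZMod 3) φ₃ I ↔ LinearIndepOn L φ I)) : Rel F T := by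
  refine ⟨fun T => ∃ (φ₃ : E → E →₀ ZMod 3) (φ : E → E →₀ L), Coords F T.side T.A φ₃ ∧
    Coords F T.side T.B φ ∧ ∀ I ⊆ F, (LinearIndepOn (ZMod 3) φ₃ I ↔ LinearIndepOn L φ I),
    ⟨φ₃, φ, h3, h, hI⟩, ?_⟩
  clear h3 h hI φ₃ φ T
  rintro T ⟨φ₃, φ, h3, h, hI⟩
  have hsupp : ∀ i ∈ F, ∀ j ∈ F, (T.A i j = 0 ↔ T.B i j = 0) := by
    have key : ∀ i ∈ F, ∀ j ∈ F, T.side i = true → T.side j = false →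
        (T.A i j = 0 ↔ T.B i j = 0) := fun i hi j hj hsi hsj => by
      rw [← not_iff_not]
      refine (h3.entry_ne_zero_iff hi hj hsi hsj).trans
        (Iff.trans ?_ (h.entry_ne_zero_iff hi hj hsi hsj).symm)
      exact hI _ (Set.insert_subset hj fun c hc => hc.1)
    intro i hi j hj
    cases hsi : T.side i <;> cases hsj : T.side j
    · simp [h3.zero i hi j hj (hsi.trans hsj.symm), h.zero i hi j hj (hsi.trans hsj.symm)]
    · rw [h3.skew.comm_zero, h.skew.comm_zero]
      exact key j hj i hi hsj hsi
    · exact key i hi j hj hsi hsj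
    · simp [h3.zero i hi j hj (hsi.trans hsj.symm), h.zero i hi j hj (hsi.trans hsj.symm)]
  refine ⟨⟨h3.skew, h.skew, fun i hi j hj hij hs => hij (h.zero i hi j hj hs), hsupp⟩,
    fun x hx y hy hxy => ?_⟩
  obtain ⟨φ₃', h3', e3⟩ := h3.pivot hx hy fun h0 => hxy ((hsupp x hx y hy).1 h0)
  obtain ⟨φ', h', e⟩ := h.pivot hx hy hxy
  exact ⟨φ₃', φ', h3', h', fun I hIF => (e3 I hIF).trans ((hI I hIF).trans (e I hIF).symm)⟩

/-- A vector configuration that is realizable over the ternary field and over `L` is realizable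
over `L'`. -/
theorem exists_realization {f : L → L'} (hf : CrMap f) {V₃ V : Type*} [AddCommGroup V₃]
    [Module (ZMod 3) V₃] [AddCommGroup V] [Module L V] {v₃ : E → V₃} {v : E → V}
    (hI : ∀ I ⊆ F, (LinearIndepOn (ZMod 3) v₃ I ↔ LinearIndepOn L v I)) :
    ∃ ψ : E → E →₀ L', ∀ I ⊆ F, (LinearIndepOn L' ψ I ↔ LinearIndepOn L v I) := by
  classical
  obtain ⟨X, hXF, -, hspan, hX⟩ := exists_linearIndepOn_extension (K := L) (v := v)
    (linearIndepOn_empty L v) (Set.empty_subset F)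
  have hspan : ∀ e ∈ F, v e ∈ Submodule.span L (v '' X) := fun e he => hspan ⟨e, he, rfl⟩
  have hX3 : LinearIndepOn (ZMod 3) v₃ X := (hI X hXF).2 hX
  have hspan3 : ∀ e ∈ F, v₃ e ∈ Submodule.span (ZMod 3) (v₃ '' X) := fun e he => by
    by_contra h3
    have heX : e ∉ X := fun heX => h3 (Submodule.subset_span ⟨e, heX, rfl⟩)
    have := (hI _ (Set.insert_subset he hXF)).1 ((linearIndepOn_insert heX).2 ⟨hX3, h3⟩)
    exact ((linearIndepOn_insert heX).1 this).2 (hspan e he)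
  let σ : E → Bool := fun e => decide (e ∈ X)
  have hσ : ∀ e ∈ F, (σ e = true ↔ e ∈ X) := fun e _ => by simp [σ]
  obtain ⟨A, φ₃, hA, iA⟩ := exists_coords hXF hX3 hspan3 hσ
  obtain ⟨B, φ, hB, iB⟩ := exists_coords hXF hX hspan hσ
  let T : Model E L := ⟨σ, A, B⟩
  have hT : Rel F T := Coords.rel (T := T) hA hB fun I hIF =>
    (iA I hIF).trans ((hI I hIF).trans (iB I hIF).symm)
  obtain ⟨D, hD⟩ := Rel.exists_lift_of_infinite hf hT
  have hsupp := hD.good.supp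
  let ψ : E → E →₀ L' := fun e => if σ e = true then Finsupp.single e 1 else
    Finsupp.onFinset (φ e).support
      (fun b => if e ∈ F ∧ b ∈ F ∧ σ b = true then D b e else 0) fun b hb => by
        by_cases h : e ∈ F ∧ b ∈ F ∧ σ b = true
        · rw [if_pos h] at hb
          rw [Finsupp.mem_support_iff]
          intro h0
          by_cases hse : σ e = true
          · exact hb ((hsupp b h.2.1 e h.1).1 (hB.zero b h.2.1 e h.1 (h.2.2.trans hse.symm)))
          · refine hb ((hsupp b h.2.1 e h.1).1 ?_)
            exact (hB.entry b h.2.1 e h.1 h.2.2 (by simpa using hse)).trans h0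
        · rw [if_neg h] at hb
          exact (hb rfl).elim
  have hψ : Coords F σ D ψ := by
    refine ⟨hD.good.skewD, fun b hb hs => by simp [ψ, hs], fun e he b hb => ?_,
      fun b hb e he hs hs' => by simp [ψ, hs, hs', hb, he],
      fun i hi j hj hij => (hsupp i hi j hj).1 (hB.zero i hi j hj hij)⟩
    by_cases hse : σ e = true
    · have : b = e := by
        by_contra hbe
        simp [ψ, hse, Finsupp.single_eq_of_ne hbe] at hb
      subst this
      exact ⟨he, hse⟩
    · by_contra hcon
      simp [ψ, hse, he, hcon] at hb
  refine ⟨ψ, fun I hIF => ?_⟩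
  rw [← iB I hIF]
  have key : ∀ J ⊆ I, J.Finite → (LinearIndepOn L φ J ↔ LinearIndepOn L' ψ J) :=
    fun J hJ hfin => indep_iff_of_finite (hJ.trans hIF) hfin _ rfl hD hB hψ
  exact ⟨fun h => linearIndepOn_of_finite _ fun J hJ hfin => (key J hJ hfin).2 (h.mono hJ),
    fun h => linearIndepOn_of_finite _ fun J hJ hfin => (key J hJ hfin).1 (h.mono hJ)⟩

end

end TernaryLift

theorem Paper.Representable.lift {α : Type u} {L : Type v} {L' : Type w} [Field L] [Field L']
    {M : Matroid α} (h3 : Paper.Representable M (ZMod 3)) (h : Paper.Representable M L)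
    {f : L → L'} (hf : TernaryLift.CrMap f) : Paper.Representable M L' := by
  obtain ⟨V₃, _, _, v₃, hv₃⟩ := h3
  obtain ⟨V, _, _, v, hv⟩ := h
  obtain ⟨ψ, hψ⟩ := TernaryLift.exists_realization (F := M.E) (v₃ := v₃) (v := v) hf
    fun I hI => (hv₃ I hI).symm.trans (hv I hI)
  exact ⟨α →₀ L', inferInstance, inferInstance, ψ, fun I hI => (hv I hI).trans (hψ I hI).symm⟩

/-- A finite field whose order is one modulo three contains a primitive sixth root of unity. -/
theorem TernaryLift.exists_sixth_root {K : Type*} [Field K] [Finite K] (h : Nat.card K % 3 = 1) :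
    ∃ ω : K, ω ^ 2 - ω + 1 = 0 := by
  have h1 : 3 ∣ Nat.card Kˣ := by
    rw [Nat.card_units]
    omega
  have : Fact (Nat.Prime 3) := ⟨Nat.prime_three⟩
  obtain ⟨ζ, hζ⟩ := exists_prime_orderOf_dvd_card' 3 h1
  have h3 : (ζ : K) ^ 3 = 1 := by
    rw [← Units.val_pow_eq_pow_val, ← hζ, pow_orderOf_eq_one, Units.val_one]
  have h4 : (ζ : K) - 1 ≠ 0 := by
    intro h
    have : ζ = 1 := Units.ext (sub_eq_zero.1 h)
    rw [this, orderOf_one] at hζ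
    omega
  refine ⟨-ζ, mul_left_cancel₀ h4 ?_⟩
  linear_combination h3

theorem TernaryLift.exists_sixth_root_complex : ∃ ω : ℂ, ω ^ 2 - ω + 1 = 0 := by
  obtain ⟨s, hs⟩ := IsAlgClosed.exists_pow_nat_eq (-3 : ℂ) (n := 2) (by norm_num)
  exact ⟨(1 + s) / 2, by linear_combination hs / 4⟩

/-- Let `q = p ^ n` be an odd prime power with `q ≡ 1 (mod 3)`. A matroid
`M` is representable over both `𝔽₃` and the field `ℂ` of complex numbers if and only if
`M` is representable over both `𝔽₃` and `𝔽_q`. -/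
theorem representable_F3_and_C_iff_representable_F3_and_Fq
    (p n : ℕ) [Fact p.Prime] (hp : p ≠ 2) (hn : n ≠ 0) (hq : p ^ n % 3 = 1)
    {α : Type u} (M : Matroid α) :
    (Paper.Representable M (ZMod 3) ∧ Paper.Representable M ℂ) ↔
      (Paper.Representable M (ZMod 3) ∧ Paper.Representable M (GaloisField p n)) := by
  have hcard : Nat.card (GaloisField p n) = p ^ n := GaloisField.card p n hn
  have : Finite (GaloisField p n) := Nat.finite_of_card_ne_zero (by
    rw [hcard]; exact pow_ne_zero _ (Fact.out : p.Prime).ne_zero)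
  have cast_ne : ∀ r : ℕ, r.Prime → p ≠ r → (r : GaloisField p n) ≠ 0 := fun r hr hpr h => by
    rw [CharP.cast_eq_zero_iff (GaloisField p n) p] at h
    exact hpr ((Nat.prime_dvd_prime_iff_eq Fact.out hr).1 h)
  have h2 : (2 : GaloisField p n) ≠ 0 := by exact_mod_cast cast_ne 2 Nat.prime_two hp
  have h3 : (3 : GaloisField p n) ≠ 0 := by
    refine mod_cast cast_ne 3 Nat.prime_three fun h => ?_
    rw [h, Nat.mod_eq_zero_of_dvd (dvd_pow_self 3 hn)] at hq
    exact zero_ne_one hq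
  obtain ⟨ω, hω⟩ := TernaryLift.exists_sixth_root (K := GaloisField p n) (by rw [hcard, hq])
  obtain ⟨ω', hω'⟩ := TernaryLift.exists_sixth_root_complex
  refine ⟨fun h => ⟨h.1, ?_⟩, fun h => ⟨h.1, ?_⟩⟩
  · obtain ⟨f, hf⟩ := TernaryLift.CrMap.exists_crMap (L := ℂ) two_ne_zero three_ne_zero h2 hω
    exact h.1.lift h.2 hf
  · obtain ⟨f, hf⟩ := TernaryLift.CrMap.exists_crMap (L' := ℂ) h2 h3 two_ne_zero hω'
    exact h.1.lift h.2 hf
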